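/- There exists a constant C > 0 such that for all n ≥ 3, every proper edge-coloring of the complete bipartite graph K_{n,n} using exactly n colors contains a rainbow matching with at least n − C·log(n)/log(log(n)) edges. -/

import Mathlib

namespace RainbowLatin

open scoped Classical
open Finset

/-- A Latin square of order `n`, given through its three quasigroup operations. -/
structure LatinSquare (n : ℕ) where
  /-- the symbol in a given row and column -/
  sym : Fin n → Fin n → Fin n
  /-- the column in which a given row contains a given symbol -/
  col : Fin n → Fin n → Fin n
  /-- the row in which a given column contains a given symbol -/
  row : Fin n → Fin n → Fin n
  col_sym : ∀ x y, col x (sym x y) = y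
  sym_col : ∀ x c, sym x (col x c) = c
  row_sym : ∀ x y, row y (sym x y) = x
  sym_row : ∀ y c, sym (row y c) y = c

namespace LatinSquare

variable {n : ℕ} (Λ : LatinSquare n)

/-- Exchange rows and columns. -/
def transpose : LatinSquare n where
  sym x y := Λ.sym y x
  col := Λ.row
  row := Λ.col
  col_sym x y := Λ.row_sym y x
  sym_col x c := Λ.sym_row x c
  row_sym x y := Λ.col_sym y x
  sym_row y c := Λ.sym_col y c

@[simp] theorem transpose_sym (x y : Fin n) : Λ.transpose.sym x y = Λ.sym y x := rfl
@[simp] theorem transpose_col (x y : Fin n) : Λ.transpose.col x y = Λ.row x y := rfl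
@[simp] theorem transpose_row (x y : Fin n) : Λ.transpose.row x y = Λ.col x y := rfl

theorem row_col (x c : Fin n) : Λ.row (Λ.col x c) c = x := by
  have := Λ.row_sym x (Λ.col x c)
  rwa [Λ.sym_col] at this

theorem col_row (y c : Fin n) : Λ.col (Λ.row y c) c = y := Λ.transpose.row_col y c

theorem col_inj_right {x c c' : Fin n} (h : Λ.col x c = Λ.col x c') : c = c' := by
  rw [← Λ.sym_col x c, h, Λ.sym_col]

theorem col_inj_left {x x' c : Fin n} (h : Λ.col x c = Λ.col x' c) : x = x' := by
  rw [← Λ.row_col x c, h, Λ.row_col]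

theorem row_inj_right {y c c' : Fin n} (h : Λ.row y c = Λ.row y c') : c = c' :=
  Λ.transpose.col_inj_right h

theorem sym_inj_right {x y y' : Fin n} (h : Λ.sym x y = Λ.sym x y') : y = y' := by
  rw [← Λ.col_sym x y, h, Λ.col_sym]

theorem sym_inj_left {x x' y : Fin n} (h : Λ.sym x y = Λ.sym x' y) : x = x' :=
  Λ.transpose.sym_inj_right h

/-- The columns met by the symbols of `C` in the rows of `S`. -/
noncomputable def nbr (C S : Finset (Fin n)) : Finset (Fin n) := Finset.image₂ Λ.col S C

theorem mem_nbr {C S : Finset (Fin n)} {y : Fin n} :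
    y ∈ Λ.nbr C S ↔ ∃ x ∈ S, ∃ c ∈ C, Λ.col x c = y := by
  simp [nbr, Finset.mem_image₂]

theorem card_nbr_le (C S : Finset (Fin n)) : (Λ.nbr C S).card ≤ S.card * C.card :=
  Finset.card_image₂_le _ _ _

theorem nbr_mono {C S S' : Finset (Fin n)} (h : S ⊆ S') : Λ.nbr C S ⊆ Λ.nbr C S' :=
  Finset.image₂_subset_right h

end LatinSquare

section Probability

variable {Ω Θ : Type*} [Fintype Ω] [Fintype Θ]

/-- The proportion of elements of a finite type satisfying a predicate. -/
noncomputable def pr (P : Ω → Prop) : ℝ := ((univ.filter P).card : ℝ) / Fintype.card Ω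

theorem pr_eq (P : Ω → Prop) [DecidablePred P] :
    pr P = ((univ.filter P).card : ℝ) / Fintype.card Ω := by
  unfold pr
  congr!

theorem pr_mono {P Q : Ω → Prop} (h : ∀ ω, P ω → Q ω) : pr P ≤ pr Q := by
  unfold pr
  gcongr with ω
  exact h ω

theorem pr_or_le (P Q : Ω → Prop) : pr (fun ω => P ω ∨ Q ω) ≤ pr P + pr Q := by
  rw [pr_eq, pr_eq, pr_eq, ← add_div]
  gcongr
  rw [filter_or]
  exact_mod_cast card_union_le _ _

theorem pr_exists_le {ι : Type*} (s : Finset ι) (P : ι → Ω → Prop) :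
    pr (fun ω => ∃ i ∈ s, P i ω) ≤ ∑ i ∈ s, pr (P i) := by
  simp only [pr_eq]
  rw [← sum_div]
  gcongr
  have : (univ.filter fun ω => ∃ i ∈ s, P i ω) = s.biUnion fun i => univ.filter (P i) := by
    ext ω; simp
  rw [this]
  exact_mod_cast card_biUnion_le

theorem pr_exists_le_card_mul {ι : Type*} (s : Finset ι) (P : ι → Ω → Prop) {b : ℝ}
    (h : ∀ i ∈ s, pr (P i) ≤ b) : pr (fun ω => ∃ i ∈ s, P i ω) ≤ s.card * b := by
  refine (pr_exists_le s P).trans ?_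
  calc _ ≤ ∑ _i ∈ s, b := sum_le_sum h
    _ = _ := by simp

theorem pr_false_of {P : Ω → Prop} (h : ∀ ω, ¬ P ω) : pr P = 0 := by
  unfold pr
  simp [filter_false_of_mem (fun ω _ => h ω)]

theorem pr_le_one (P : Ω → Prop) : pr P ≤ 1 := by
  unfold pr
  apply div_le_one_of_le₀ _ (by positivity)
  exact_mod_cast card_filter_le _ _

theorem exists_not_of_pr_lt_one [Nonempty Ω] {P : Ω → Prop} (h : pr P < 1) : ∃ ω, ¬ P ω := by
  by_contra! hc
  unfold pr at h
  rw [filter_true_of_mem (fun ω _ => hc ω), card_univ, div_self] at h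
  · exact lt_irrefl _ h
  · exact_mod_cast Fintype.card_ne_zero

theorem pr_comp_equiv (e : Θ ≃ Ω) (P : Ω → Prop) : pr (fun ω => P (e ω)) = pr P := by
  unfold pr
  rw [Fintype.card_congr e]
  congr 2
  apply card_bij (fun ω _ => e ω)
  · intro a ha; simpa using ha
  · intro a _ b _ h; exact e.injective h
  · intro b hb; exact ⟨e.symm b, by simpa using hb, by simp⟩

theorem pr_prod (P : Ω × Θ → Prop) :
    pr P = (∑ b : Θ, pr (fun a => P (a, b))) / Fintype.card Θ := by
  unfold pr
  rw [← sum_div, div_div, Fintype.card_prod, Nat.cast_mul]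
  congr 1
  have : (univ.filter P).card = ∑ b : Θ, (univ.filter fun a => P (a, b)).card := by
    rw [card_eq_sum_card_fiberwise (f := Prod.snd) (t := univ) (by simp)]
    refine sum_congr rfl fun b _ => ?_
    apply card_bij (fun p _ => p.1)
    · rintro ⟨a, b'⟩ h
      simp at h; simp [← h.2, h.1]
    · rintro ⟨a, b1⟩ h1 ⟨a', b2⟩ h2 h
      simp at h1 h2 h; simp [h, h1.2, h2.2]
    · intro a h
      exact ⟨(a, b), by simpa using h, rfl⟩
  rw [this]; push_cast; rfl

/-- Conditioning on the second coordinate. -/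
theorem pr_prod_le (P : Ω × Θ → Prop) (E : Θ → Prop) {b : ℝ}
    (hE : ∀ ω, P ω → E ω.2) (h : ∀ v, E v → pr (fun a => P (a, v)) ≤ b) :
    pr P ≤ pr E * b := by
  rw [pr_prod]
  unfold pr at *
  rw [div_mul_eq_mul_div]
  gcongr
  calc ∑ v : Θ, ((univ.filter fun a => P (a, v)).card : ℝ) / Fintype.card Ω
      ≤ ∑ v : Θ, if E v then b else 0 := by
        refine sum_le_sum fun v _ => ?_
        split_ifs with hv
        · exact h v hv
        · rw [filter_false_of_mem (fun a _ ha => hv (hE _ ha))]; simp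
    _ = _ := by rw [← sum_filter, sum_const, nsmul_eq_mul]

theorem pr_prod_le' (P : Ω × Θ → Prop) {b : ℝ} (hb : 0 ≤ b)
    (h : ∀ v, pr (fun a => P (a, v)) ≤ b) : pr P ≤ b := by
  refine (pr_prod_le P (fun _ => True) (fun _ _ => trivial) fun v _ => h v).trans ?_
  exact mul_le_of_le_one_left hb (pr_le_one _)

theorem pr_snd [Nonempty Ω] (E : Θ → Prop) : pr (fun ω : Ω × Θ => E ω.2) = pr E := by
  rw [pr_prod]
  have h : ∀ v, pr (fun _ : Ω => E v) = if E v then 1 else 0 := by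
    intro v
    split_ifs with hv
    · unfold pr; simp [hv]
    · exact pr_false_of fun _ => hv
  simp only [h]
  unfold pr
  rw [← sum_filter]; simp

end Probability

section Binomial

theorem choose_mul_pow_le (n s : ℕ) {x : ℝ} (hx : 0 ≤ x) :
    (n.choose s : ℝ) * x ^ s ≤ Real.exp (x * n) := by
  rcases le_or_gt s n with hs | hs
  · calc (n.choose s : ℝ) * x ^ s ≤ ∑ i ∈ range (n + 1), x ^ i * 1 ^ (n - i) * (n.choose i) := by
          refine le_trans (le_of_eq ?_) (single_le_sum (f := fun i =>
            x ^ i * 1 ^ (n - i) * (n.choose i : ℝ)) (fun i _ => by positivity)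
            (mem_range.2 (Nat.lt_succ_of_le hs)))
          simp [mul_comm]
      _ = (x + 1) ^ n := (add_pow x 1 n).symm
      _ ≤ (Real.exp x) ^ n := by gcongr; exact Real.add_one_le_exp x
      _ = _ := by rw [← Real.exp_nat_mul, mul_comm]
  · rw [Nat.choose_eq_zero_of_lt hs]; simp; positivity

theorem exp_nat_le (t : ℕ) : Real.exp t ≤ 3 ^ t := by
  have : Real.exp 1 ≤ 3 := by linarith [Real.exp_one_lt_d9]
  calc Real.exp t = Real.exp 1 ^ t := by rw [← Real.exp_nat_mul, mul_one]
    _ ≤ 3 ^ t := by gcongr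

theorem choose_le_div_pow (n s t : ℕ) (ht : 0 < t) (hn : 0 < n) :
    (n.choose s : ℝ) ≤ (n / t : ℝ) ^ s * 3 ^ t := by
  have h := choose_mul_pow_le n s (x := (t : ℝ) / n) (by positivity)
  rw [div_mul_cancel₀ _ (by positivity)] at h
  have h2 := h.trans (exp_nat_le t)
  calc (n.choose s : ℝ) = (n / t : ℝ) ^ s * (n.choose s * (t / n : ℝ) ^ s) := by
        rw [mul_left_comm, ← mul_pow, div_mul_div_comm, mul_comm (n : ℝ) t, div_self (by positivity)]
        simp
    _ ≤ _ := by gcongr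

theorem choose_le_three_mul_div_pow (n s : ℕ) : (n.choose s : ℝ) ≤ (3 * n / s : ℝ) ^ s := by
  rcases Nat.eq_zero_or_pos s with rfl | hs
  · simp
  rcases Nat.eq_zero_or_pos n with rfl | hn
  · rw [Nat.choose_eq_zero_of_lt hs]; simp
  refine (choose_le_div_pow n s s hs hn).trans (le_of_eq ?_)
  rw [← mul_pow]; ring

theorem card_powersetCard_le {α : Type*} (Z : Finset α) (j : ℕ) {z : ℝ} (hz : Z.card ≤ z) :
    ((Z.powersetCard j).card : ℝ) ≤ (3 * z / j) ^ j := by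
  rw [card_powersetCard]
  refine (choose_le_three_mul_div_pow _ _).trans ?_
  gcongr

theorem card_small_subsets_le {α : Type*} (T : Finset α) {t : ℕ} (hT : T.card ≤ t) {m : ℕ}
    (h : 64 * m ≤ t) :
    ((T.powerset.filter fun A => A.card ≤ m).card : ℝ) ^ 8 ≤ 2 ^ t := by
  have h1 : ((T.powerset.filter fun A => A.card ≤ m).card : ℝ) * (1 / 64) ^ m
      ≤ (1 + 1 / 64) ^ t := by
    calc ((T.powerset.filter fun A => A.card ≤ m).card : ℝ) * (1 / 64) ^ m
        = ∑ A ∈ T.powerset.filter (fun A => A.card ≤ m), (1 / 64 : ℝ) ^ m := by simp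
      _ ≤ ∑ A ∈ T.powerset.filter (fun A => A.card ≤ m), (1 / 64 : ℝ) ^ A.card := by
          refine sum_le_sum fun A hA => ?_
          exact pow_le_pow_of_le_one (by norm_num) (by norm_num) (mem_filter.1 hA).2
      _ ≤ ∑ A ∈ T.powerset, (1 / 64 : ℝ) ^ A.card :=
          sum_le_sum_of_subset_of_nonneg (filter_subset _ _) fun _ _ _ => by positivity
      _ = (1 + 1 / 64) ^ T.card := by
          rw [add_comm, ← sum_pow_mul_eq_add_pow (1 / 64 : ℝ) 1 T]
          simp
      _ ≤ _ := by gcongr; norm_num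
  have h2 : ((T.powerset.filter fun A => A.card ≤ m).card : ℝ) ≤ (1 + 1 / 64) ^ t * 64 ^ m := by
    have : (64 : ℝ) ^ m * (1 / 64) ^ m = 1 := by rw [← mul_pow]; norm_num
    calc _ = ((T.powerset.filter fun A => A.card ≤ m).card : ℝ) * (1 / 64) ^ m * 64 ^ m := by
          rw [mul_assoc, mul_comm ((1 / 64 : ℝ) ^ m), this, mul_one]
      _ ≤ _ := by gcongr
  have h64 : ((64 : ℝ) ^ m) ^ 32 ≤ 8 ^ t := by
    rw [← pow_mul]
    have : (64 : ℝ) ^ (m * 32) = 8 ^ (64 * m) := by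
      rw [show (64 : ℝ) = 8 ^ 2 by norm_num, ← pow_mul]; ring_nf
    rw [this]
    exact pow_le_pow_right₀ (by norm_num) h
  have h3 : (((T.powerset.filter fun A => A.card ≤ m).card : ℝ) ^ 8) ^ 4 ≤ (2 ^ t) ^ 4 := by
    calc _ = ((T.powerset.filter fun A => A.card ≤ m).card : ℝ) ^ 32 := by rw [← pow_mul]
      _ ≤ ((1 + 1 / 64) ^ t * 64 ^ m) ^ 32 := by gcongr
      _ = ((1 + 1 / 64) ^ 32) ^ t * (64 ^ m) ^ 32 := by rw [mul_pow, ← pow_mul, ← pow_mul (1 + 1 / 64 : ℝ) 32 t, mul_comm t]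
      _ ≤ 2 ^ t * 8 ^ t := by
          gcongr
          norm_num
      _ = _ := by rw [← mul_pow, ← pow_mul, mul_comm t 4, pow_mul]; norm_num
  exact le_of_pow_le_pow_left₀ (by norm_num) (by positivity) h3

end Binomial

section DisjointFamily

variable {n : ℕ}

theorem exists_disjoint_family (f : Fin n → Fin n → Fin n)
    (hf1 : ∀ b, Function.Injective fun u => f u b)
    (B Z : Finset (Fin n)) (m : ℕ) (h : m * (B.card ^ 2 + 1) ≤ Z.card) :
    ∃ Z' ⊆ Z, Z'.card = m ∧
      ∀ u ∈ Z', ∀ u' ∈ Z', u ≠ u' → Disjoint (B.image (f u)) (B.image (f u')) := by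
  induction m with
  | zero => exact ⟨∅, by simp, by simp, by simp⟩
  | succ m ih =>
    obtain ⟨Z', hZ', hc, hd⟩ := ih (by nlinarith)
    set K : Finset (Fin n) := Z' ∪ Z'.biUnion fun u =>
      (B ×ˢ B).biUnion fun p => univ.filter fun u' => f u' p.2 = f u p.1 with hK
    have hKc : K.card ≤ m * (B.card ^ 2 + 1) := by
      refine (card_union_le _ _).trans ?_
      have : (Z'.biUnion fun u => (B ×ˢ B).biUnion fun p =>
          univ.filter fun u' => f u' p.2 = f u p.1).card ≤ Z'.card * (B.card ^ 2) := by
        refine card_biUnion_le_card_mul _ _ _ fun u _ => ?_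
        refine (card_biUnion_le_card_mul _ _ 1 fun p _ => ?_).trans (by simp [sq])
        rw [card_le_one]
        intro a ha b hb
        simp only [mem_filter, mem_univ, true_and] at ha hb
        exact hf1 p.2 (ha.trans hb.symm)
      rw [hc] at this
      nlinarith
    obtain ⟨u, huZ, huK⟩ := exists_mem_notMem_of_card_lt_card
      (show K.card < Z.card by nlinarith [sq_nonneg B.card])
    have huZ' : u ∉ Z' := fun hu => huK (mem_union_left _ hu)
    have hdis : ∀ v ∈ Z', Disjoint (B.image (f v)) (B.image (f u)) := by
      intro v hv
      rw [disjoint_left]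
      intro y hy hy'
      obtain ⟨b, hb, rfl⟩ := mem_image.1 hy
      obtain ⟨b', hb', hbb⟩ := mem_image.1 hy'
      apply huK
      refine mem_union_right _ (mem_biUnion.2 ⟨v, hv, mem_biUnion.2 ⟨(b, b'), ?_, ?_⟩⟩)
      · simp [hb, hb']
      · simp [hbb]
    refine ⟨insert u Z', insert_subset huZ hZ', by rw [card_insert_of_notMem huZ', hc], ?_⟩
    intro a ha b hb hab
    rcases mem_insert.1 ha with rfl | ha <;> rcases mem_insert.1 hb with rfl | hb
    · exact absurd rfl hab
    · exact (hdis b hb).symm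
    · exact hdis a (by assumption)
    · exact hd a ha b hb hab

end DisjointFamily

section Permutations

variable {n : ℕ}

theorem perm_card_mul_le (G J : Finset (Fin n)) (hGJ : Disjoint G J)
    (B : Equiv.Perm (Fin n) → Fin n → Finset (Fin n)) (b : ℕ)
    (hB : ∀ σ, ∀ y ∈ J, (B σ y).card ≤ b)
    (hdep : ∀ σ τ : Equiv.Perm (Fin n), (∀ g ∈ G, σ g = τ g) → ∀ y ∈ J, B σ y = B τ y) :
    (univ.filter fun σ : Equiv.Perm (Fin n) => ∀ y ∈ J, σ y ∈ B σ y).card *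
      (n - G.card - J.card) ^ J.card ≤ n.factorial * b ^ J.card := by
  induction J using Finset.induction_on with
  | empty => simp [Fintype.card_perm]
  | insert y J hy ih =>
    have hdisj : Disjoint G J := hGJ.mono_right (subset_insert _ _)
    have ih := ih hdisj (fun σ z hz => hB σ z (mem_insert_of_mem hz))
      (fun σ τ h z hz => hdep σ τ h z (mem_insert_of_mem hz))
    set S := univ.filter fun σ : Equiv.Perm (Fin n) => ∀ z ∈ insert y J, σ z ∈ B σ z with hS
    set S' := univ.filter fun σ : Equiv.Perm (Fin n) => ∀ z ∈ J, σ z ∈ B σ z with hS'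
    set E := univ \ (G ∪ J) with hE
    have hyG : y ∉ G := fun h => disjoint_left.1 hGJ h (mem_insert_self _ _)
    have hEc : E.card = n - G.card - J.card := by
      rw [hE, card_sdiff_of_subset (subset_univ _), card_union_of_disjoint hdisj, card_univ,
        Fintype.card_fin, Nat.sub_sub]
    have key : (S ×ˢ E).card ≤ b * S'.card := by
      refine card_le_mul_card_image_of_maps_to (t := S')
        (f := fun p : Equiv.Perm (Fin n) × Fin n => p.1 * Equiv.swap y p.2) ?_ b ?_
      · rintro ⟨σ, y2⟩ hp
        simp only [mem_product, hS, hE, mem_filter, mem_univ, true_and, mem_sdiff, mem_union,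
          not_or] at hp
        obtain ⟨h1, hG, hJ⟩ := hp
        simp only [hS', mem_filter, mem_univ, true_and]
        intro z hz
        have hzy : z ≠ y := fun h => hy (h ▸ hz)
        have hz2 : z ≠ y2 := fun h => hJ (h ▸ hz)
        rw [hdep (σ * Equiv.swap y y2) σ ?_ z (mem_insert_of_mem hz)]
        · rw [Equiv.Perm.mul_apply, Equiv.swap_apply_of_ne_of_ne hzy hz2]
          exact h1 z (mem_insert_of_mem hz)
        · intro g hg
          rw [Equiv.Perm.mul_apply, Equiv.swap_apply_of_ne_of_ne]
          · rintro rfl; exact hyG hg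
          · rintro rfl; exact hG hg
      · intro τ hτ
        refine le_trans ?_ (hB τ y (mem_insert_self _ _))
        apply card_le_card_of_injOn (fun p => p.1 y)
        · rintro ⟨σ, y2⟩ hp
          simp only [coe_filter, mem_product, hS, hE, mem_filter, mem_univ, true_and, mem_sdiff,
            mem_union, not_or, Set.mem_ofPred_eq] at hp
          obtain ⟨⟨h1, hG, hJ⟩, rfl⟩ := hp
          rw [hdep (σ * Equiv.swap y y2) σ ?_ y (mem_insert_self _ _)]
          · exact h1 y (mem_insert_self _ _)
          · intro g hg
            rw [Equiv.Perm.mul_apply, Equiv.swap_apply_of_ne_of_ne]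
            · rintro rfl; exact hyG hg
            · rintro rfl; exact hG hg
        · rintro ⟨σ, y2⟩ hp ⟨σ', y2'⟩ hp' h
          simp only [coe_filter, Set.mem_ofPred_eq] at hp hp' h
          have e1 := congrArg (fun τ : Equiv.Perm (Fin n) => τ y2) hp.2
          have e2 := congrArg (fun τ : Equiv.Perm (Fin n) => τ y2') hp'.2
          simp only [Equiv.Perm.mul_apply, Equiv.swap_apply_right] at e1 e2
          have : y2 = y2' := τ.injective (by rw [← e1, ← e2, h])
          subst this
          have := mul_right_cancel (hp.2.trans hp'.2.symm)
          simp [this]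
    rw [card_product, hEc] at key
    rw [card_insert_of_notMem hy]
    calc S.card * (n - G.card - (J.card + 1)) ^ (J.card + 1)
        ≤ S.card * (n - G.card - J.card) ^ (J.card + 1) := by gcongr; omega
      _ = (S.card * (n - G.card - J.card)) * (n - G.card - J.card) ^ J.card := by ring
      _ ≤ (b * S'.card) * (n - G.card - J.card) ^ J.card := by gcongr
      _ = b * (S'.card * (n - G.card - J.card) ^ J.card) := by ring
      _ ≤ b * (n.factorial * b ^ J.card) := by gcongr
      _ = _ := by ring

theorem perm_pr_le (G J : Finset (Fin n)) (hGJ : Disjoint G J)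
    (B : Equiv.Perm (Fin n) → Fin n → Finset (Fin n)) {b m : ℝ}
    (hB : ∀ σ, ∀ y ∈ J, ((B σ y).card : ℝ) ≤ b)
    (hdep : ∀ σ τ : Equiv.Perm (Fin n), (∀ g ∈ G, σ g = τ g) → ∀ y ∈ J, B σ y = B τ y)
    (hb : 0 ≤ b) (hm : 0 < m) (hmn : m + G.card + J.card ≤ n) :
    pr (fun σ : Equiv.Perm (Fin n) => ∀ y ∈ J, σ y ∈ B σ y) ≤ (b / m) ^ J.card := by
  have h := perm_card_mul_le G J hGJ B ⌊b⌋₊ (fun σ y hy => Nat.le_floor (hB σ y hy)) hdep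
  have hfb : ((⌊b⌋₊ : ℕ) : ℝ) ≤ b := Nat.floor_le hb
  have hmn' : m ≤ ((n - G.card - J.card : ℕ) : ℝ) := by
    have h1 : (G.card + J.card : ℕ) ≤ n := by
      have : ((G.card + J.card : ℕ) : ℝ) ≤ n := by push_cast; linarith
      exact_mod_cast this
    rw [Nat.sub_sub, Nat.cast_sub h1]; push_cast; linarith
  unfold pr
  rw [Fintype.card_perm, Fintype.card_fin, div_pow, div_le_div_iff₀ (by positivity) (by positivity)]
  have h' : (((univ.filter fun σ : Equiv.Perm (Fin n) => ∀ y ∈ J, σ y ∈ B σ y).card *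
      (n - G.card - J.card) ^ J.card : ℕ) : ℝ) ≤ (n.factorial * ⌊b⌋₊ ^ J.card : ℕ) := by
    exact_mod_cast h
  push_cast at h'
  calc _ ≤ ((univ.filter fun σ : Equiv.Perm (Fin n) => ∀ y ∈ J, σ y ∈ B σ y).card : ℝ) *
        ((n - G.card - J.card : ℕ) : ℝ) ^ J.card := by gcongr
    _ ≤ _ := h'
    _ ≤ n.factorial * b ^ J.card := by gcongr
    _ = _ := by ring

end Permutations

section Labels

variable {n N : ℕ}

/-- The columns with label `a`. -/
noncomputable def lab (l : Fin n → Fin N) (a : ℕ) : Finset (Fin n) :=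
  univ.filter fun y => (l y).val = a

/-- The columns with one of the labels `0`, `1`, `2`. -/
noncomputable def marked (l : Fin n → Fin N) : Finset (Fin n) :=
  univ.filter fun y => (l y).val < 3

theorem mem_lab {l : Fin n → Fin N} {a : ℕ} {y : Fin n} : y ∈ lab l a ↔ (l y).val = a := by
  simp [lab]

theorem mem_marked {l : Fin n → Fin N} {y : Fin n} : y ∈ marked l ↔ (l y).val < 3 := by
  simp [marked]

theorem lab_subset_marked (l : Fin n → Fin N) {a : ℕ} (ha : a < 3) : lab l a ⊆ marked l := by
  intro y hy
  rw [mem_lab] at hy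
  rw [mem_marked, hy]
  exact ha

theorem sum_prod_labels (w : Fin n → Fin N → ℝ) :
    ∑ l : Fin n → Fin N, ∏ y, w y (l y) = ∏ y, ∑ i, w y i := by
  rw [Finset.prod_univ_sum, Fintype.piFinset_univ]

theorem pr_mul_le_of_moment {Ω : Type*} [Fintype Ω] {P : Ω → Prop} {g : Ω → ℝ} {θ : ℝ}
    (hg : ∀ ω, 0 ≤ g ω) (h : ∀ ω, P ω → θ ≤ g ω) :
    pr P * θ ≤ (∑ ω, g ω) / Fintype.card Ω := by
  unfold pr
  rw [div_mul_eq_mul_div]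
  gcongr
  calc ((univ.filter P).card : ℝ) * θ = ∑ _ω ∈ univ.filter P, θ := by simp
    _ ≤ ∑ ω ∈ univ.filter P, g ω := sum_le_sum fun ω hω => h ω (mem_filter.1 hω).2
    _ ≤ _ := sum_le_sum_of_subset_of_nonneg (filter_subset _ _) fun ω _ _ => hg ω

theorem card_labels : (Fintype.card (Fin n → Fin N) : ℝ) = (N : ℝ) ^ n := by
  simp

theorem sum_label_weight (a : ℕ) (ha : a < N) (u : ℝ) :
    ∑ i : Fin N, (if i.val = a then u else 1) = N - 1 + u := by
  have : ∀ i : Fin N, (if i.val = a then u else 1) = 1 + if i = ⟨a, ha⟩ then u - 1 else 0 := by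
    intro i
    by_cases h : i.val = a
    · simp [h, Fin.ext_iff]
    · simp [h, Fin.ext_iff]
  simp only [this, sum_add_distrib, sum_ite_eq', mem_univ, if_true]
  simp
  ring

theorem label_moment (Z : Finset (Fin n)) (a : ℕ) (ha : a < N) {u : ℝ} (hu : 0 ≤ u) :
    (∑ l : Fin n → Fin N, u ^ (Z ∩ lab l a).card) / Fintype.card (Fin n → Fin N) ≤
      Real.exp ((u - 1) * (Z.card / N)) := by
  have hN : (0 : ℝ) < N := by exact_mod_cast (Nat.zero_le a).trans_lt ha
  have h1 : ∀ l : Fin n → Fin N, u ^ (Z ∩ lab l a).card =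
      ∏ y, if y ∈ Z then (if (l y).val = a then u else 1) else 1 := by
    intro l
    rw [← Finset.prod_filter, Finset.prod_ite, prod_const, prod_const_one, mul_one]
    congr 2
    ext y; simp [lab]
  simp only [h1]
  rw [sum_prod_labels (fun y i => if y ∈ Z then (if i.val = a then u else 1) else 1), card_labels]
  have h2 : ∀ y : Fin n, ∑ i : Fin N, (if y ∈ Z then (if i.val = a then u else 1) else 1) =
      N * if y ∈ Z then (1 + (u - 1) / N) else 1 := by
    intro y
    split_ifs with h
    · rw [sum_label_weight a ha]; field_simp; ring
    · simp
  simp only [h2]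
  rw [prod_mul_distrib, prod_const, card_univ, Fintype.card_fin, mul_div_assoc, mul_comm,
    div_mul_cancel₀ _ (by positivity), ← prod_filter, prod_const]
  have h3 : 0 ≤ 1 + (u - 1) / N := by
    have : (1 : ℝ) ≤ N := by exact_mod_cast (Nat.zero_le a).trans_lt ha
    have : -1 ≤ (u - 1) / N := by rw [le_div_iff₀ hN]; linarith
    linarith
  calc _ ≤ (Real.exp ((u - 1) / N)) ^ Z.card := by
        rw [filter_mem_eq_inter, univ_inter]
        gcongr
        linarith [Real.add_one_le_exp ((u - 1) / N)]
    _ = _ := by rw [← Real.exp_nat_mul]; congr 1; ring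

theorem pr_label_lower (Z : Finset (Fin n)) (a : ℕ) (ha : a < N) :
    pr (fun l : Fin n → Fin N => 4 * N * (Z ∩ lab l a).card ≤ Z.card) ≤
      Real.exp (-(Z.card / (4 * N))) := by
  have hN : (0 : ℝ) < N := by exact_mod_cast (Nat.zero_le a).trans_lt ha
  have hq : Real.exp (-2) ≤ 1 / 4 := by
    have := Real.exp_one_gt_d9
    have h2 : Real.exp 2 = Real.exp 1 ^ 2 := by rw [← Real.exp_nat_mul]; norm_num
    rw [Real.exp_neg, inv_le_comm₀ (by positivity) (by norm_num), h2]
    nlinarith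
  have h := pr_mul_le_of_moment (P := fun l : Fin n → Fin N => 4 * N * (Z ∩ lab l a).card ≤ Z.card)
    (g := fun l => (1 / 4 : ℝ) ^ (Z ∩ lab l a).card) (θ := Real.exp (-(2 * (Z.card / (4 * N)))))
    (fun l => by positivity) (by
      intro l hl
      have hl' : (4 * N * (Z ∩ lab l a).card : ℝ) ≤ Z.card := by exact_mod_cast hl
      calc Real.exp (-(2 * (Z.card / (4 * N)))) ≤ Real.exp ((Z ∩ lab l a).card * (-2)) := by
            apply Real.exp_le_exp.2
            have : ((Z ∩ lab l a).card : ℝ) ≤ Z.card / (4 * N) := by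
              rw [le_div_iff₀ (by positivity)]; linarith
            linarith
        _ = Real.exp (-2) ^ (Z ∩ lab l a).card := by rw [← Real.exp_nat_mul]
        _ ≤ _ := by gcongr)
  have h2 := h.trans (label_moment Z a ha (by norm_num))
  rw [← le_div_iff₀ (by positivity), ← Real.exp_sub] at h2
  refine h2.trans (le_of_eq ?_)
  congr 1
  field_simp
  ring

theorem pr_label_upper (a : ℕ) (ha : a < N) :
    pr (fun l : Fin n → Fin N => 2 * n < N * (lab l a).card) ≤ Real.exp (-(n / (4 * N))) := by
  have hN : (0 : ℝ) < N := by exact_mod_cast (Nat.zero_le a).trans_lt ha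
  have hq : Real.exp (5 / 8) ≤ 2 := by
    rw [← Real.le_log_iff_exp_le (by norm_num)]
    linarith [Real.log_two_gt_d9]
  have h := pr_mul_le_of_moment (P := fun l : Fin n → Fin N => 2 * n < N * (lab l a).card)
    (g := fun l => (2 : ℝ) ^ (univ ∩ lab l a).card) (θ := Real.exp (5 / 8 * (2 * n / N)))
    (fun l => by positivity) (by
      intro l hl
      have hl' : (2 * n : ℝ) < N * (lab l a).card := by exact_mod_cast hl
      rw [univ_inter]
      calc Real.exp (5 / 8 * (2 * n / N)) ≤ Real.exp ((lab l a).card * (5 / 8)) := by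
            apply Real.exp_le_exp.2
            have : (2 * n / N : ℝ) ≤ (lab l a).card := by
              rw [div_le_iff₀ (by positivity)]; linarith
            linarith
        _ = Real.exp (5 / 8) ^ (lab l a).card := by rw [← Real.exp_nat_mul]
        _ ≤ _ := by gcongr)
  have h2 := h.trans (label_moment univ a ha (by norm_num))
  rw [← le_div_iff₀ (by positivity), ← Real.exp_sub] at h2
  refine h2.trans (le_of_eq ?_)
  congr 1
  simp
  field_simp
  ring

theorem pr_label_eq_on (J : Finset (Fin n)) (a : ℕ) (hN : 0 < N) :
    pr (fun l : Fin n → Fin N => ∀ y ∈ J, y ∈ lab l a) ≤ (1 / N : ℝ) ^ J.card := by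
  have hN' : (0 : ℝ) < N := by exact_mod_cast hN
  have h := pr_mul_le_of_moment (P := fun l : Fin n → Fin N => ∀ y ∈ J, y ∈ lab l a)
    (g := fun l => ∏ y, if y ∈ J then (if (l y).val = a then 1 else 0) else 1) (θ := 1)
    (fun l => prod_nonneg fun y _ => by split_ifs <;> norm_num) (by
      intro l hl
      apply le_of_eq
      symm
      apply prod_eq_one
      intro y _
      split_ifs with h1 h2
      · rfl
      · exact absurd (mem_lab.1 (hl y h1)) h2
      · rfl)
  rw [mul_one] at h
  refine h.trans ?_
  rw [sum_prod_labels (fun y i => if y ∈ J then (if i.val = a then (1 : ℝ) else 0) else 1),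
    card_labels]
  have h2 : ∏ y : Fin n, ∑ i : Fin N, (if y ∈ J then (if i.val = a then (1 : ℝ) else 0) else 1) ≤
      ∏ y : Fin n, (N * if y ∈ J then (1 / N : ℝ) else 1) := by
    apply prod_le_prod
    · intro y _; exact sum_nonneg fun i _ => by split_ifs <;> norm_num
    · intro y _
      split_ifs with hy
      · rw [mul_one_div_cancel hN'.ne', sum_boole]
        have : (univ.filter fun i : Fin N => i.val = a).card ≤ 1 := by
          rw [card_le_one]
          intro i hi j hj
          simp only [mem_filter, mem_univ, true_and] at hi hj
          exact Fin.ext (hi.trans hj.symm)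
        exact_mod_cast this
      · simp
  rw [div_le_iff₀ (by positivity)]
  refine h2.trans (le_of_eq ?_)
  rw [prod_mul_distrib, prod_const, card_univ, Fintype.card_fin, mul_comm, ← prod_filter, prod_const,
    filter_mem_eq_inter, univ_inter]

end Labels

section Conflicts

variable {n N : ℕ}

/-- The sample space: a bijection from columns to rows and a labelling of the columns. -/
abbrev Sample (n N : ℕ) := Equiv.Perm (Fin n) × (Fin n → Fin N)

/-- The symbol of the diagonal cell of `σ` in column `y`. -/
def hue (Λ : LatinSquare n) (σ : Equiv.Perm (Fin n)) (y : Fin n) : Fin n := Λ.sym (σ y) y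

/-- A set of columns each of which shares its symbol with a marked column outside the set. -/
def IsConflict (Λ : LatinSquare n) (ω : Sample n N) (J : Finset (Fin n)) : Prop :=
  ∀ y ∈ J, ∃ y' ∈ marked ω.2 \ J, hue Λ ω.1 y' = hue Λ ω.1 y

theorem pr_conflict_on (Λ : LatinSquare n) (hN : 12 ≤ N) (J : Finset (Fin n)) (a : ℕ) (ha : a < 3)
    (hn : 0 < n) :
    pr (fun ω : Sample n N => N * (marked ω.2).card ≤ 6 * n ∧ (∀ y ∈ J, y ∈ lab ω.2 a) ∧
      IsConflict Λ ω J) ≤ (12 / N ^ 2 : ℝ) ^ J.card := by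
  have hN' : (0 : ℝ) < N := by exact_mod_cast (by omega : 0 < N)
  have hN12 : (12 : ℝ) ≤ N := by exact_mod_cast hN
  have hn' : (0 : ℝ) < n := by exact_mod_cast hn
  have h := pr_prod_le (b := (12 / N : ℝ) ^ J.card)
    (fun ω : Sample n N => N * (marked ω.2).card ≤ 6 * n ∧ (∀ y ∈ J, y ∈ lab ω.2 a) ∧
      IsConflict Λ ω J)
    (fun l => N * (marked l).card ≤ 6 * n ∧ (∀ y ∈ J, y ∈ lab l a))
    (fun ω hω => ⟨hω.1, hω.2.1⟩) (by
      rintro l ⟨h1, h2⟩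
      have hJ : J ⊆ marked l := fun y hy => lab_subset_marked l ha (h2 y hy)
      have hc : ((marked l).card : ℝ) ≤ 6 * n / N := by
        rw [le_div_iff₀ hN', mul_comm]; exact_mod_cast h1
      have hJc : ((marked l \ J).card : ℝ) + J.card = (marked l).card := by
        exact_mod_cast card_sdiff_add_card_eq_card hJ
      have := perm_pr_le (marked l \ J) J disjoint_sdiff_self_left
        (fun σ y => (marked l \ J).image fun y' => Λ.row y (hue Λ σ y'))
        (b := 6 * n / N) (m := n / 2) (by
          intro σ y _
          refine le_trans ?_ hc
          exact_mod_cast card_image_le.trans (card_le_card sdiff_subset))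
        (by
          intro σ τ hστ y _
          apply image_congr
          intro y' hy'
          simp only [hue, hστ y' hy'])
        (by positivity) (by positivity) (by
          have : (6 * n / N : ℝ) ≤ n / 2 := by
            rw [div_le_div_iff₀ hN' (by norm_num)]
            nlinarith
          linarith)
      calc _ ≤ _ := pr_mono (fun σ hσ => ?_)
        _ ≤ _ := this
        _ = _ := by congr 1; field_simp; norm_num
      intro y hy
      obtain ⟨y', hy', he⟩ := hσ.2.2 y hy
      refine mem_image.2 ⟨y', hy', ?_⟩
      rw [he]
      exact Λ.row_sym _ _)
  refine h.trans ?_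
  calc _ ≤ (1 / N : ℝ) ^ J.card * (12 / N) ^ J.card := by
        gcongr
        exact (pr_mono fun l hl => hl.2).trans (pr_label_eq_on J a (by omega))
    _ = _ := by rw [← mul_pow]; congr 1; field_simp

/-- A fixed set of columns contains few labelled columns of any conflict set. -/
theorem pr_conflict_many (Λ : LatinSquare n) (hN : 12 ≤ N) (Z : Finset (Fin n)) (a : ℕ)
    (ha : a < 3) (hn : 0 < n) (j : ℕ) {z : ℝ} (hz : Z.card ≤ z) :
    pr (fun ω : Sample n N => N * (marked ω.2).card ≤ 6 * n ∧
      ∃ J, IsConflict Λ ω J ∧ j ≤ (Z ∩ (J ∩ lab ω.2 a)).card) ≤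
      (36 * z / (j * N ^ 2) : ℝ) ^ j := by
  have h0 : 0 ≤ z := le_trans (by positivity) hz
  calc _ ≤ pr (fun ω : Sample n N => ∃ J ∈ Z.powersetCard j,
        N * (marked ω.2).card ≤ 6 * n ∧ (∀ y ∈ J, y ∈ lab ω.2 a) ∧ IsConflict Λ ω J) := by
        refine pr_mono ?_
        rintro ω ⟨h1, J, hJ, hc⟩
        obtain ⟨J', hJ', hcard⟩ := exists_subset_card_eq hc
        refine ⟨J', mem_powersetCard.2 ⟨hJ'.trans inter_subset_left, hcard⟩, h1, ?_, ?_⟩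
        · intro y hy
          exact (mem_inter.1 (mem_inter.1 (hJ' hy)).2).2
        · intro y hy
          have hJJ : J' ⊆ J := fun z hz => (mem_inter.1 (mem_inter.1 (hJ' hz)).2).1
          obtain ⟨y', hy', he⟩ := hJ y (hJJ hy)
          exact ⟨y', sdiff_subset_sdiff Subset.rfl hJJ hy', he⟩
    _ ≤ (Z.powersetCard j).card * (12 / N ^ 2 : ℝ) ^ j := by
        refine pr_exists_le_card_mul _ _ fun J hJ => ?_
        have := pr_conflict_on Λ hN J a ha hn
        rwa [(mem_powersetCard.1 hJ).2] at this
    _ ≤ (3 * z / j : ℝ) ^ j * (12 / N ^ 2 : ℝ) ^ j := by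
        gcongr
        exact card_powersetCard_le Z j hz
    _ = _ := by
        rw [← mul_pow]; congr 1
        rw [div_mul_div_comm]; congr 1; ring

end Conflicts

section Discrepancy

variable {n N : ℕ}

/-- The centred indicator of a marked label. -/
noncomputable def centred (N : ℕ) (i : Fin N) : ℝ := (if i.val < 3 then 1 else 0) - 3 / N

theorem sum_centred (hN : 3 ≤ N) : ∑ i : Fin N, centred N i = 0 := by
  have hN' : (0 : ℝ) < N := by exact_mod_cast (by omega : 0 < N)
  simp only [centred, sum_sub_distrib, sum_boole]
  have : (univ.filter fun i : Fin N => i.val < 3).card = 3 := by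
    have : (univ.filter fun i : Fin N => i.val < 3) =
        (range 3).attachFin (fun m hm => (mem_range.1 hm).trans_le hN) := by
      ext i; simp
    rw [this, card_attachFin, card_range]
  rw [this]
  simp
  field_simp
  simp

theorem abs_centred_le (hN : 3 ≤ N) (i : Fin N) : |centred N i| ≤ 1 := by
  have hN' : (3 : ℝ) ≤ N := by exact_mod_cast hN
  have h1 : (3 : ℝ) / N ≤ 1 := by rw [div_le_one (by linarith)]; exact hN'
  have h2 : (0 : ℝ) ≤ 3 / N := by positivity
  unfold centred
  rw [abs_le]
  split_ifs <;> constructor <;> linarith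

theorem sum_centred_four_eq_zero (hN : 3 ≤ N) {a b a' b' : Fin n} (h1 : a ≠ b) (h2 : a ≠ a')
    (h3 : a ≠ b') :
    ∑ l : Fin n → Fin N, centred N (l a) * centred N (l b) * (centred N (l a') * centred N (l b'))
      = 0 := by
  have : ∀ l : Fin n → Fin N, centred N (l a) * centred N (l b) *
      (centred N (l a') * centred N (l b')) =
      ∏ y, ((if y = a then centred N (l y) else 1) * (if y = b then centred N (l y) else 1) *
        ((if y = a' then centred N (l y) else 1) * (if y = b' then centred N (l y) else 1))) := by
    intro l
    simp only [prod_mul_distrib, prod_ite_eq', mem_univ, if_true]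
  simp only [this]
  rw [sum_prod_labels (fun y i => (if y = a then centred N i else 1) *
    (if y = b then centred N i else 1) *
        ((if y = a' then centred N i else 1) * (if y = b' then centred N i else 1)))]
  apply prod_eq_zero (mem_univ a)
  simp [h1, h2, h3, sum_centred hN]

theorem sum_centred_four_le (hN : 3 ≤ N) (a b a' b' : Fin n) :
    ∑ l : Fin n → Fin N, centred N (l a) * centred N (l b) * (centred N (l a') * centred N (l b'))
      ≤ (N : ℝ) ^ n := by
  rw [← card_labels]
  calc _ ≤ ∑ _l : Fin n → Fin N, (1 : ℝ) := by
        refine sum_le_sum fun l _ => (le_abs_self _).trans ?_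
        rw [abs_mul, abs_mul, abs_mul]
        have := abs_centred_le hN
        refine mul_le_one₀ (mul_le_one₀ (this _) (abs_nonneg _) (this _)) (by positivity)
          (mul_le_one₀ (this _) (abs_nonneg _) (this _))
    _ = _ := by simp

/-- The pair correlation of two symbol classes. -/
noncomputable def correlation (Λ : LatinSquare n) (l : Fin n → Fin N) (c c' : Fin n) : ℝ :=
  ∑ x, centred N (l (Λ.col x c)) * centred N (l (Λ.col x c'))

theorem sum_correlation_sq_le (Λ : LatinSquare n) (hN : 3 ≤ N) :
    ∑ l : Fin n → Fin N, ∑ c, ∑ c', correlation Λ l c c' ^ 2 ≤ 3 * n ^ 3 * (N : ℝ) ^ n := by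
  have e : ∀ l : Fin n → Fin N, ∑ c, ∑ c', correlation Λ l c c' ^ 2 =
      ∑ c, ∑ c', ∑ x, ∑ x', centred N (l (Λ.col x c)) * centred N (l (Λ.col x c')) *
        (centred N (l (Λ.col x' c)) * centred N (l (Λ.col x' c'))) := by
    intro l
    refine sum_congr rfl fun c _ => sum_congr rfl fun c' _ => ?_
    rw [correlation, sq, sum_mul_sum]
  simp only [e]
  rw [sum_comm]
  have h : ∀ c c' x x' : Fin n, ∑ l : Fin n → Fin N,
      centred N (l (Λ.col x c)) * centred N (l (Λ.col x c')) *
        (centred N (l (Λ.col x' c)) * centred N (l (Λ.col x' c'))) ≤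
      (((if c = c' then 1 else 0) + (if x = x' then 1 else 0)) +
        (if Λ.col x' c' = Λ.col x c then 1 else 0)) * (N : ℝ) ^ n := by
    intro c c' x x'
    have hp : (0 : ℝ) ≤ (N : ℝ) ^ n := by positivity
    by_cases hcond : c = c' ∨ x = x' ∨ Λ.col x' c' = Λ.col x c
    · refine (sum_centred_four_le hN _ _ _ _).trans ?_
      apply le_mul_of_one_le_left hp
      rcases hcond with h | h | h <;> simp only [h, if_true] <;> split_ifs <;> norm_num
    · push Not at hcond
      obtain ⟨h1, h2, h3⟩ := hcond
      rw [sum_centred_four_eq_zero hN]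
      · positivity
      · exact fun h => h1 (Λ.col_inj_right h)
      · exact fun h => h2 (Λ.col_inj_left h)
      · exact fun h => h3 h.symm
  calc _ = ∑ c, ∑ c', ∑ x, ∑ x', ∑ l : Fin n → Fin N,
      centred N (l (Λ.col x c)) * centred N (l (Λ.col x c')) *
        (centred N (l (Λ.col x' c)) * centred N (l (Λ.col x' c'))) := by
        refine sum_congr rfl fun c _ => ?_
        rw [sum_comm]
        refine sum_congr rfl fun c' _ => ?_
        rw [sum_comm]
        refine sum_congr rfl fun x _ => ?_
        rw [sum_comm]
    _ ≤ ∑ c : Fin n, ∑ c' : Fin n, ∑ x : Fin n, ∑ x' : Fin n,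
        (((if c = c' then 1 else 0) + (if x = x' then 1 else 0)) +
        (if Λ.col x' c' = Λ.col x c then 1 else 0)) * (N : ℝ) ^ n :=
        sum_le_sum fun c _ => sum_le_sum fun c' _ => sum_le_sum fun x _ => sum_le_sum fun x' _ =>
          h c c' x x'
    _ ≤ ∑ c : Fin n, ∑ c' : Fin n, ∑ x : Fin n,
        ((n * if c = c' then 1 else 0) + 1 + 1) * (N : ℝ) ^ n := by
        refine sum_le_sum fun c _ => sum_le_sum fun c' _ => sum_le_sum fun x _ => ?_
        rw [← sum_mul, sum_add_distrib, sum_add_distrib, sum_const, card_univ, Fintype.card_fin,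
          nsmul_eq_mul, sum_ite_eq]
        gcongr
        · simp
        · rw [sum_boole]
          have : (univ.filter fun x' => Λ.col x' c' = Λ.col x c).card ≤ 1 := by
            rw [card_le_one]
            intro i hi j hj
            simp only [mem_filter, mem_univ, true_and] at hi hj
            exact Λ.col_inj_left (hi.trans hj.symm)
          exact_mod_cast this
    _ = _ := by
        simp only [sum_const, card_univ, Fintype.card_fin, nsmul_eq_mul, ← mul_sum, ← sum_mul,
          sum_add_distrib, sum_ite_eq, mem_univ, if_true]
        ring

/-- Every combinatorial rectangle contains about the expected number of marked columns. -/
def Balanced (Λ : LatinSquare n) (l : Fin n → Fin N) : Prop :=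
  ∀ A C : Finset (Fin n),
    |∑ x ∈ A, ∑ c ∈ C, centred N (l (Λ.col x c))| ^ 4 ≤ 30 * (n : ℝ) ^ 7

theorem balanced_of_correlation (Λ : LatinSquare n) (l : Fin n → Fin N)
    (h : ∑ c, ∑ c', correlation Λ l c c' ^ 2 ≤ 30 * (n : ℝ) ^ 3) : Balanced Λ l := by
  intro A C
  set f : Fin n → Fin n → ℝ := fun x c => centred N (l (Λ.col x c)) with hf
  have h1 : (∑ x ∈ A, ∑ c ∈ C, f x c) ^ 2 ≤ n * ∑ x, (∑ c ∈ C, f x c) ^ 2 := by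
    calc _ ≤ A.card * ∑ x ∈ A, (∑ c ∈ C, f x c) ^ 2 := sq_sum_le_card_mul_sum_sq
      _ ≤ n * ∑ x, (∑ c ∈ C, f x c) ^ 2 := by
        gcongr
        · exact_mod_cast (card_le_univ A).trans (by simp)
        · exact subset_univ _
  have h2 : ∑ x, (∑ c ∈ C, f x c) ^ 2 = ∑ p ∈ C ×ˢ C, correlation Λ l p.1 p.2 := by
    rw [sum_product]
    simp only [correlation, sq, sum_mul_sum]
    rw [sum_comm]
    refine sum_congr rfl fun c _ => ?_
    rw [sum_comm]
  have h3 : (∑ p ∈ C ×ˢ C, correlation Λ l p.1 p.2) ^ 2 ≤ n ^ 2 * (30 * (n : ℝ) ^ 3) := by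
    calc _ ≤ (C ×ˢ C).card * ∑ p ∈ C ×ˢ C, correlation Λ l p.1 p.2 ^ 2 :=
          sq_sum_le_card_mul_sum_sq
      _ ≤ n ^ 2 * ∑ p : Fin n × Fin n, correlation Λ l p.1 p.2 ^ 2 := by
        gcongr
        · rw [card_product, ← sq]
          exact_mod_cast Nat.pow_le_pow_left ((card_le_univ C).trans (by simp)) 2
        · exact subset_univ _
      _ ≤ _ := by
        gcongr
        rwa [Fintype.sum_prod_type]
  calc |∑ x ∈ A, ∑ c ∈ C, f x c| ^ 4 = ((∑ x ∈ A, ∑ c ∈ C, f x c) ^ 2) ^ 2 := by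
        rw [show 4 = 2 * 2 by norm_num, pow_mul, sq_abs]
    _ ≤ (n * ∑ x, (∑ c ∈ C, f x c) ^ 2) ^ 2 := by gcongr
    _ = n ^ 2 * (∑ p ∈ C ×ˢ C, correlation Λ l p.1 p.2) ^ 2 := by rw [mul_pow, h2]
    _ ≤ n ^ 2 * (n ^ 2 * (30 * (n : ℝ) ^ 3)) := by gcongr
    _ = _ := by ring

theorem pr_not_balanced_le (Λ : LatinSquare n) (hN : 3 ≤ N) (hn : 0 < n) :
    pr (fun l : Fin n → Fin N => ¬ Balanced Λ l) ≤ 1 / 10 := by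
  have hn' : (0 : ℝ) < n := by exact_mod_cast hn
  have hN' : (0 : ℝ) < N := by exact_mod_cast (by omega : 0 < N)
  have h := pr_mul_le_of_moment (P := fun l : Fin n → Fin N => ¬ Balanced Λ l)
    (g := fun l => ∑ c, ∑ c', correlation Λ l c c' ^ 2) (θ := 30 * (n : ℝ) ^ 3)
    (fun l => by positivity) (fun l hl => by
      by_contra hc
      exact hl (balanced_of_correlation Λ l (not_le.1 hc).le))
  rw [card_labels] at h
  have h2 : (∑ l : Fin n → Fin N, ∑ c, ∑ c', correlation Λ l c c' ^ 2) / (N : ℝ) ^ n ≤ 3 * n ^ 3 := by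
    rw [div_le_iff₀ (by positivity)]
    exact sum_correlation_sq_le Λ hN
  have h3 := h.trans h2
  have : (0 : ℝ) < n ^ 3 := by positivity
  nlinarith

end Discrepancy

/-- The relations between the order `n` and the auxiliary parameters: `N` labels, branching `L`,
palettes of size `k`. -/
structure Large (n N L k : ℕ) : Prop where
  N_eq : N = 2 ^ 20
  L_ge_pow : 2 ^ 1000 ≤ L
  k_eq : k = 2 ^ 64 * L
  n_ge : 2 ^ (3000 * L) ≤ n
  n_le : n ≤ L ^ L

namespace Large

variable {n N L k : ℕ}

theorem L_ge (h : Large n N L k) : 2 ^ 200 ≤ L :=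
  (Nat.pow_le_pow_right (by norm_num) (by norm_num)).trans h.L_ge_pow

theorem N_pos (h : Large n N L k) : 0 < N := by rw [h.N_eq]; norm_num

theorem L_pos (h : Large n N L k) : 0 < L := lt_of_lt_of_le (by norm_num) h.L_ge

theorem k_pos (h : Large n N L k) : 0 < k := by rw [h.k_eq]; have := h.L_pos; positivity

theorem n_pos (h : Large n N L k) : 0 < n := lt_of_lt_of_le (by positivity) h.n_ge

theorem L_pow_le (h : Large n N L k) : L ^ 64 ≤ 2 ^ L := by
  have h1 := h.L_ge
  have h2 : L ≤ (2 ^ (L / 128)) ^ 2 := by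
    have h3 : L / 128 + 1 ≤ 2 ^ (L / 128) := Nat.lt_two_pow_self
    have h4 : L ≤ 128 * (L / 128 + 1) := by omega
    have h5 : 128 ≤ L / 128 + 1 := by
      have : 2 ^ 20 ≤ L := le_trans (by norm_num) h1
      omega
    calc L ≤ 128 * (L / 128 + 1) := h4
      _ ≤ (L / 128 + 1) * (L / 128 + 1) := by gcongr
      _ ≤ 2 ^ (L / 128) * 2 ^ (L / 128) := by gcongr
      _ = _ := by ring
  calc L ^ 64 ≤ ((2 ^ (L / 128)) ^ 2) ^ 64 := by gcongr
    _ = 2 ^ (128 * (L / 128)) := by rw [← pow_mul, ← pow_mul]; ring_nf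
    _ ≤ 2 ^ L := Nat.pow_le_pow_right (by norm_num) (Nat.mul_div_le _ _)

theorem k_le_sq (h : Large n N L k) : k ≤ L ^ 2 := by
  rw [h.k_eq, sq]
  have : 2 ^ 64 ≤ L := le_trans (by norm_num) h.L_ge
  gcongr

theorem L_le_k (h : Large n N L k) : L ≤ k := by
  rw [h.k_eq]; have := h.L_pos; nlinarith

theorem n_le_two_pow (h : Large n N L k) : n ≤ 2 ^ (L ^ 2) := by
  calc n ≤ L ^ L := h.n_le
    _ ≤ (2 ^ L) ^ L := by gcongr; exact Nat.lt_two_pow_self.le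
    _ = _ := by rw [← pow_mul, sq]

theorem n_pow_le (h : Large n N L k) (j : ℕ) : n ^ j ≤ 2 ^ (L ^ 2 * j) := by
  rw [pow_mul]
  exact Nat.pow_le_pow_left h.n_le_two_pow j

theorem L_pow_mul_le (h : Large n N L k) (j : ℕ) (hj : j ≤ 2999) : L ^ 64 * 2 ^ (j * L) ≤ n := by
  calc L ^ 64 * 2 ^ (j * L) ≤ 2 ^ L * 2 ^ (j * L) := Nat.mul_le_mul_right _ h.L_pow_le
    _ = 2 ^ ((j + 1) * L) := by rw [← pow_add]; ring_nf
    _ ≤ 2 ^ (3000 * L) := Nat.pow_le_pow_right (by norm_num) (by gcongr; omega)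
    _ ≤ n := h.n_ge

theorem poly_le (h : Large n N L k) (a b i : ℕ) (hab : a + b ≤ 2 ^ 200) :
    a * L ^ i + b ≤ L ^ (i + 1) := by
  have h1 : 1 ≤ L ^ i := Nat.one_le_pow _ _ h.L_pos
  calc a * L ^ i + b ≤ a * L ^ i + b * L ^ i := by nlinarith
    _ = (a + b) * L ^ i := by ring
    _ ≤ L * L ^ i := by gcongr; exact hab.trans h.L_ge
    _ = _ := by ring

theorem L_pow_le_n (h : Large n N L k) {j : ℕ} (hj : j ≤ 64) : L ^ j ≤ n := by
  have := h.L_pow_mul_le 0 (by norm_num)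
  simp at this
  exact (Nat.pow_le_pow_right h.L_pos hj).trans this

end Large

theorem exp_neg_le_two_pow {x : ℝ} {j : ℕ} (h : (j : ℝ) ≤ x) : Real.exp (-x) ≤ (1 / 2) ^ j := by
  have h2 : (2 : ℝ) ≤ Real.exp 1 := by linarith [Real.exp_one_gt_d9]
  calc Real.exp (-x) ≤ Real.exp (-(j : ℝ)) := Real.exp_le_exp.2 (by linarith)
    _ = (Real.exp 1)⁻¹ ^ j := by rw [← Real.exp_neg, ← Real.exp_nat_mul]; ring_nf
    _ ≤ _ := by
      rw [one_div]
      gcongr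

theorem half_pow_le {j : ℕ} (h : 10 ≤ j) : (1 / 2 : ℝ) ^ j ≤ 1 / 1000 := by
  calc (1 / 2 : ℝ) ^ j ≤ (1 / 2) ^ 10 := pow_le_pow_of_le_one (by norm_num) (by norm_num) h
    _ ≤ _ := by norm_num

section Typical

variable {n N L k : ℕ}

instance : Nonempty (Equiv.Perm (Fin n)) := ⟨1⟩

/-- The labels `0`, `1`, `2` are used about as often as expected. -/
def FairLabels (l : Fin n → Fin N) : Prop :=
  ∀ a < 3, N * (lab l a).card ≤ 2 * n ∧ n ≤ 4 * N * (lab l a).card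

theorem FairLabels.card_marked {l : Fin n → Fin N} (h : FairLabels l) :
    N * (marked l).card ≤ 6 * n := by
  have : marked l ⊆ lab l 0 ∪ lab l 1 ∪ lab l 2 := by
    intro y hy
    simp only [mem_union, mem_lab]
    rw [mem_marked] at hy
    omega
  have h2 := (card_le_card this).trans ((card_union_le _ _).trans
    (Nat.add_le_add_right (card_union_le _ _) _))
  have h0 := (h 0 (by norm_num)).1
  have h1 := (h 1 (by norm_num)).1
  have h3 := (h 2 (by norm_num)).1
  calc N * (marked l).card ≤ N * ((lab l 0).card + (lab l 1).card + (lab l 2).card) := by gcongr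
    _ ≤ _ := by nlinarith

theorem pr_not_fair_le (h : Large n N L k) :
    pr (fun l : Fin n → Fin N => ¬ FairLabels l) ≤ 6 / 1000 := by
  have hN : (0 : ℝ) < N := by exact_mod_cast h.N_pos
  have hsmall : Real.exp (-(n / (4 * N))) ≤ 1 / 1000 := by
    refine (exp_neg_le_two_pow (j := 10) ?_).trans (half_pow_le le_rfl)
    rw [le_div_iff₀ (by positivity)]
    have h1 := h.L_pow_le_n (j := 1) (by norm_num)
    have h2 := h.L_ge
    have : 10 * (4 * N) ≤ n := by
      rw [h.N_eq]; rw [pow_one] at h1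
      exact le_trans (by norm_num) (h2.trans h1)
    exact_mod_cast this
  calc _ ≤ pr (fun l : Fin n → Fin N => ∃ a ∈ range 3, (2 * n < N * (lab l a).card) ∨
        4 * N * (univ ∩ lab l a).card ≤ (univ : Finset (Fin n)).card) := by
        refine pr_mono fun l hl => ?_
        unfold FairLabels at hl
        push Not at hl
        obtain ⟨a, ha, hl⟩ := hl
        refine ⟨a, mem_range.2 ha, ?_⟩
        by_cases hc : N * (lab l a).card ≤ 2 * n
        · right; rw [univ_inter, card_univ, Fintype.card_fin]; exact (hl hc).le
        · left; omega
    _ ≤ (range 3).card * (1 / 1000 + 1 / 1000) := by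
        refine pr_exists_le_card_mul _ _ fun a ha => (pr_or_le _ _).trans ?_
        have haN : a < N := by
          rw [h.N_eq]; exact lt_of_lt_of_le (mem_range.1 ha) (by norm_num)
        refine add_le_add ((pr_label_upper a haN).trans hsmall) ?_
        refine (pr_label_lower univ a haN).trans ?_
        rwa [card_univ, Fintype.card_fin]
    _ = _ := by norm_num

/-- Conflict sets contain few columns of each label. -/
def FewConflicts (Λ : LatinSquare n) (ω : Sample n N) : Prop :=
  ∀ J, IsConflict Λ ω J → ∀ a < 3, 192 * N * (J ∩ lab ω.2 a).card ≤ n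

theorem pr_not_fewConflicts_le (h : Large n N L k) (Λ : LatinSquare n) :
    pr (fun ω : Sample n N => FairLabels ω.2 ∧ ¬ FewConflicts Λ ω) ≤ 3 / 1000 := by
  have hN : (0 : ℝ) < N := by exact_mod_cast h.N_pos
  set j := n / (192 * N) + 1 with hj
  have hjn : n < 192 * N * j := by
    rw [hj]
    have := h.N_pos
    have := Nat.lt_mul_div_succ n (show 0 < 192 * N by positivity)
    simpa using this
  have hj10 : 10 ≤ j := by
    have h1 := h.L_pow_le_n (j := 1) (by norm_num)
    have h2 := h.L_ge
    have : 10 * (192 * N) ≤ n := by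
      rw [h.N_eq]; rw [pow_one] at h1
      exact le_trans (by norm_num) (h2.trans h1)
    rw [hj]
    have := (Nat.le_div_iff_mul_le (show 0 < 192 * N by have := h.N_pos; positivity)).2 this
    omega
  calc _ ≤ pr (fun ω : Sample n N => ∃ a ∈ range 3, (N * (marked ω.2).card ≤ 6 * n ∧
        ∃ J, IsConflict Λ ω J ∧ j ≤ (univ ∩ (J ∩ lab ω.2 a)).card)) := by
        refine pr_mono ?_
        rintro ω ⟨hf, hl⟩
        unfold FewConflicts at hl
        push Not at hl
        obtain ⟨J, hJ, a, ha, hl⟩ := hl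
        refine ⟨a, mem_range.2 ha, hf.card_marked, J, hJ, ?_⟩
        rw [univ_inter, hj]
        have := h.N_pos
        exact Nat.succ_le_of_lt (Nat.lt_of_mul_lt_mul_left (lt_of_le_of_lt (Nat.mul_div_le _ _) hl))
    _ ≤ (range 3).card * (1 / 1000) := by
        refine pr_exists_le_card_mul _ _ fun a ha => ?_
        refine (pr_conflict_many Λ (by rw [h.N_eq]; norm_num) univ a (mem_range.1 ha) h.n_pos j
          (z := n) (by simp)).trans ?_
        refine le_trans ?_ (half_pow_le hj10)
        apply pow_le_pow_left₀ (by positivity)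
        have hj0 : (0 : ℝ) < j := by exact_mod_cast (by omega : 0 < j)
        rw [div_le_div_iff₀ (by positivity) (by norm_num)]
        have h1 : (n : ℝ) ≤ 192 * N * j := by exact_mod_cast hjn.le
        have h2 : (N : ℝ) = 2 ^ 20 := by exact_mod_cast h.N_eq
        rw [h2] at h1 ⊢
        nlinarith
    _ = _ := by norm_num

end Typical

section Typical

variable {n N L k : ℕ}

/-- A disjoint-family union bound over all sets of `k` indices. -/
theorem pr_many_le (h : Large n N L k) {Ω : Type*} [Fintype Ω] (f : Fin n → Fin n → Fin n)
    (hf1 : ∀ b, Function.Injective fun u => f u b)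
    (P : Ω → Finset (Fin n) → Finset (Fin n) → Prop)
    (hP : ∀ ω B S S', S' ⊆ S → P ω B S → P ω B S')
    (hE : ∀ (B S : Finset (Fin n)), B.card = k →
      (∀ u ∈ S, ∀ u' ∈ S, u ≠ u' → Disjoint (B.image (f u)) (B.image (f u'))) →
      0 < S.card → pr (fun ω => P ω B S) ≤ (1 / 2) ^ (200 * L * S.card)) :
    pr (fun ω => ∃ B S, B.card = k ∧ n < 2 * 2 ^ (100 * L) * S.card ∧ P ω B S) ≤ 1 / 1000 := by
  have hL := h.L_pos
  have hk2 := h.k_le_sq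
  set d := 2 * 2 ^ (100 * L) * (k ^ 2 + 1) with hd
  have hd0 : 0 < d := by positivity
  set m := n / d with hm
  have hmd : m * d ≤ n := Nat.div_mul_le_self _ _
  have hk4 : k ^ 2 + 1 ≤ L ^ 5 := by
    calc k ^ 2 + 1 ≤ (L ^ 2) ^ 2 + 1 := by gcongr
      _ = 1 * L ^ 4 + 1 := by ring
      _ ≤ L ^ 5 := h.poly_le 1 1 4 (by norm_num)
  have hmbig : k * L ^ 2 + 11 ≤ m := by
    rw [hm, Nat.le_div_iff_mul_le hd0, hd]
    have h1 : k * L ^ 2 + 11 ≤ L ^ 5 := by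
      calc k * L ^ 2 + 11 ≤ L ^ 2 * L ^ 2 + 11 := by gcongr
        _ = 1 * L ^ 4 + 11 := by ring
        _ ≤ L ^ 5 := h.poly_le 1 11 4 (by norm_num)
    calc (k * L ^ 2 + 11) * (2 * 2 ^ (100 * L) * (k ^ 2 + 1))
        ≤ L ^ 5 * (L * 2 ^ (100 * L) * L ^ 5) := by
          gcongr
          exact le_trans (by norm_num) h.L_ge
      _ = L ^ 11 * 2 ^ (100 * L) := by ring
      _ ≤ L ^ 64 * 2 ^ (100 * L) := by gcongr; omega
      _ ≤ n := h.L_pow_mul_le 100 (by norm_num)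
  have hm0 : 0 < m := by omega
  have hnm : 3 * n ≤ 2 ^ (101 * L) * m := by
    have h1 : n < d * (m + 1) := by
      rw [hm]; exact Nat.lt_mul_div_succ n hd0
    have h2 : 12 * L ^ 5 ≤ L ^ 64 := by
      calc 12 * L ^ 5 + 0 ≤ L ^ 6 := h.poly_le 12 0 5 (by norm_num)
        _ ≤ L ^ 64 := Nat.pow_le_pow_right hL (by norm_num)
    calc 3 * n ≤ 3 * (d * (m + 1)) := by omega
      _ ≤ 3 * (d * (2 * m)) := by gcongr; omega
      _ = (12 * (k ^ 2 + 1)) * 2 ^ (100 * L) * m := by rw [hd]; ring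
      _ ≤ (12 * L ^ 5) * 2 ^ (100 * L) * m := by gcongr
      _ ≤ 2 ^ L * 2 ^ (100 * L) * m := by
          gcongr
          exact h2.trans h.L_pow_le
      _ = _ := by rw [← pow_add]; ring_nf
  have hchoose : ((powersetCard m (univ : Finset (Fin n))).card : ℝ) ≤ 2 ^ (101 * L * m) := by
    refine (card_powersetCard_le univ m (z := n) (by simp)).trans ?_
    rw [pow_mul]
    gcongr
    have : (0 : ℝ) < m := by exact_mod_cast hm0
    rw [div_le_iff₀ this]
    exact_mod_cast hnm
  have hchoose2 : ((powersetCard k (univ : Finset (Fin n))).card : ℝ) ≤ 2 ^ m := by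
    have : (powersetCard k (univ : Finset (Fin n))).card ≤ 2 ^ m := by
      rw [card_powersetCard, card_univ, Fintype.card_fin]
      refine (Nat.choose_le_pow n k).trans ((h.n_pow_le k).trans ?_)
      apply Nat.pow_le_pow_right (by norm_num)
      rw [mul_comm]; omega
    exact_mod_cast this
  calc _ ≤ pr (fun ω => ∃ p ∈ (powersetCard k (univ : Finset (Fin n))) ×ˢ
        (powersetCard m (univ : Finset (Fin n))), (∀ u ∈ p.2, ∀ u' ∈ p.2, u ≠ u' →
          Disjoint (p.1.image (f u)) (p.1.image (f u'))) ∧ P ω p.1 p.2) := by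
        refine pr_mono ?_
        rintro ω ⟨B, S, hB, hS, hPω⟩
        have hSm : m * (B.card ^ 2 + 1) ≤ S.card := by
          rw [hB]
          have : 2 * 2 ^ (100 * L) * (m * (k ^ 2 + 1)) < 2 * 2 ^ (100 * L) * S.card := by
            calc _ = m * d := by rw [hd]; ring
              _ ≤ n := hmd
              _ < _ := hS
          exact (Nat.lt_of_mul_lt_mul_left this).le
        obtain ⟨Z', hZ', hc, hdis⟩ := exists_disjoint_family f hf1 B S m hSm
        exact ⟨(B, Z'), by simp [hB, hc], hdis, hP _ _ _ _ hZ' hPω⟩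
    _ ≤ ((powersetCard k (univ : Finset (Fin n))) ×ˢ
        (powersetCard m (univ : Finset (Fin n)))).card * (1 / 2 : ℝ) ^ (200 * L * m) := by
        refine pr_exists_le_card_mul _ _ ?_
        rintro ⟨B, S⟩ hBS
        simp only [mem_product, mem_powersetCard, subset_univ, true_and] at hBS
        by_cases hd : ∀ u ∈ S, ∀ u' ∈ S, u ≠ u' → Disjoint (B.image (f u)) (B.image (f u'))
        · refine (pr_mono fun ω hω => hω.2).trans ?_
          have := hE B S hBS.1 hd (by omega)
          rwa [hBS.2] at this
        · rw [pr_false_of fun ω hω => hd hω.1]; positivity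
    _ ≤ (2 ^ m * 2 ^ (101 * L * m)) * (1 / 2 : ℝ) ^ (200 * L * m) := by
        rw [card_product]; push_cast
        gcongr
    _ ≤ (1 / 2 : ℝ) ^ m := by
        rw [← pow_add, one_div, inv_pow, inv_pow, ← div_eq_mul_inv,
          div_le_iff₀ (by positivity), ← div_eq_inv_mul, le_div_iff₀ (by positivity), ← pow_add]
        apply pow_le_pow_right₀ (by norm_num)
        nlinarith
    _ ≤ _ := half_pow_le (by omega)

theorem card_biUnion_image {f : Fin n → Fin n → Fin n}
    (hf2 : ∀ u, Function.Injective (f u)) {B S : Finset (Fin n)}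
    (hd : ∀ u ∈ S, ∀ u' ∈ S, u ≠ u' → Disjoint (B.image (f u)) (B.image (f u')))
    (T : Finset (Fin n)) :
    (S.biUnion (fun u => B.image (f u)) ∩ T).card =
      ∑ u ∈ S, (B.filter fun b => f u b ∈ T).card := by
  rw [biUnion_inter, card_biUnion]
  · refine sum_congr rfl fun u _ => ?_
    rw [← filter_mem_eq_inter, filter_image, card_image_of_injective _ (hf2 u)]
  · intro u hu u' hu' huu
    exact (hd u hu u' hu' huu).mono inter_subset_left inter_subset_left

/-- For each set of `k` indices, few elements see few columns with label `a`. -/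
def FewUnlabelled (L k : ℕ) (f : Fin n → Fin n → Fin n) (a : ℕ) (l : Fin n → Fin N) : Prop :=
  ∀ B S : Finset (Fin n), B.card = k →
    (∀ u ∈ S, 4 * N * (B.filter fun b => f u b ∈ lab l a).card ≤ k) →
    2 * 2 ^ (100 * L) * S.card ≤ n

theorem pr_not_fewUnlabelled_le (h : Large n N L k) (f : Fin n → Fin n → Fin n)
    (hf1 : ∀ b, Function.Injective fun u => f u b) (hf2 : ∀ u, Function.Injective (f u))
    (a : ℕ) (ha : a < 3) :
    pr (fun l : Fin n → Fin N => ¬ FewUnlabelled L k f a l) ≤ 1 / 1000 := by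
  have hN : (0 : ℝ) < N := by exact_mod_cast h.N_pos
  refine le_trans (pr_mono ?_) (pr_many_le h f hf1 (fun (l : Fin n → Fin N) B S =>
    ∀ u ∈ S, 4 * N * (B.filter fun b => f u b ∈ lab l a).card ≤ k) ?_ ?_)
  · intro l hl
    unfold FewUnlabelled at hl
    push Not at hl
    obtain ⟨B, S, h1, h2, h3⟩ := hl
    exact ⟨B, S, h1, h3, h2⟩
  · intro l B S S' hS hP u hu
    exact hP u (hS hu)
  · intro B S hB hd hS
    have hZ := card_biUnion_image hf2 hd univ
    simp only [inter_univ, mem_univ, filter_true, sum_const, smul_eq_mul, hB] at hZ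
    refine le_trans (pr_mono ?_) ((pr_label_lower (S.biUnion fun u => B.image (f u)) a
      (by rw [h.N_eq]; exact ha.trans (by norm_num))).trans (exp_neg_le_two_pow ?_))
    · intro l hl
      rw [card_biUnion_image hf2 hd, hZ, mul_sum]
      calc _ ≤ ∑ u ∈ S, k := sum_le_sum hl
        _ = _ := by simp
    · rw [hZ, le_div_iff₀ (by positivity)]
      have : 200 * L * S.card * (4 * N) ≤ S.card * k := by
        rw [h.k_eq, h.N_eq]; nlinarith [Nat.zero_le (L * S.card)]
      exact_mod_cast this

/-- For each set of `k` indices, few elements see many columns of a conflict set. -/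
def FewConflicted (L k : ℕ) (f : Fin n → Fin n → Fin n) (a : ℕ) (Λ : LatinSquare n)
    (ω : Sample n N) : Prop :=
  ∀ J B S : Finset (Fin n), IsConflict Λ ω J → B.card = k →
    (∀ u ∈ S, k ≤ 8 * N * (B.filter fun b => f u b ∈ J ∩ lab ω.2 a).card) →
    2 * 2 ^ (100 * L) * S.card ≤ n

theorem pr_not_fewConflicted_le (h : Large n N L k) (f : Fin n → Fin n → Fin n)
    (hf1 : ∀ b, Function.Injective fun u => f u b) (hf2 : ∀ u, Function.Injective (f u))
    (a : ℕ) (ha : a < 3) (Λ : LatinSquare n) :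
    pr (fun ω : Sample n N => FairLabels ω.2 ∧ ¬ FewConflicted L k f a Λ ω) ≤ 1 / 1000 := by
  have hN : (0 : ℝ) < N := by exact_mod_cast h.N_pos
  have hL := h.L_pos
  refine le_trans (pr_mono ?_) (pr_many_le h f hf1 (fun (ω : Sample n N) B S =>
    N * (marked ω.2).card ≤ 6 * n ∧ ∃ J, IsConflict Λ ω J ∧
    ∀ u ∈ S, k ≤ 8 * N * (B.filter fun b => f u b ∈ J ∩ lab ω.2 a).card) ?_ ?_)
  · rintro ω ⟨hf, hl⟩
    unfold FewConflicted at hl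
    push Not at hl
    obtain ⟨J, B, S, h1, h2, h3, h4⟩ := hl
    exact ⟨B, S, h2, h4, hf.card_marked, J, h1, h3⟩
  · rintro l B S S' hS ⟨h1, J, hJ, hP⟩
    exact ⟨h1, J, hJ, fun u hu => hP u (hS hu)⟩
  · intro B S hB hd hS
    have hZ := card_biUnion_image hf2 hd univ
    simp only [inter_univ, mem_univ, filter_true, sum_const, smul_eq_mul, hB] at hZ
    set q := 2 ^ 41 * L with hq
    have hkq : k = 8 * N * q := by rw [h.k_eq, h.N_eq, hq]; ring
    refine le_trans (pr_mono ?_) ((pr_conflict_many Λ (by rw [h.N_eq]; norm_num)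
      (S.biUnion fun u => B.image (f u)) a ha h.n_pos (S.card * q) (z := S.card * k)
      (by rw [hZ]; push_cast; rfl)).trans ?_)
    · rintro ω ⟨h1, J, hJ, hl⟩
      refine ⟨h1, J, hJ, ?_⟩
      rw [card_biUnion_image hf2 hd]
      calc S.card * q = ∑ u ∈ S, q := by simp
        _ ≤ _ := sum_le_sum fun u hu => by
          have := hl u hu
          rw [hkq] at this
          exact Nat.le_of_mul_le_mul_left this (by have := h.N_pos; positivity)
    · have hSr : (0 : ℝ) < S.card := by exact_mod_cast hS
      have hqr : (0 : ℝ) < q := by rw [hq]; push_cast; positivity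
      calc _ ≤ (1 / 2 : ℝ) ^ (S.card * q) := by
            refine pow_le_pow_left₀ (by positivity) ?_ _
            rw [hkq]
            push_cast
            rw [div_le_div_iff₀ (by positivity) (by norm_num)]
            have h2 : (N : ℝ) = 2 ^ 20 := by exact_mod_cast h.N_eq
            rw [h2]
            have : 0 < (S.card : ℝ) * q := by positivity
            nlinarith
        _ ≤ _ := by
            apply pow_le_pow_of_le_one (by norm_num) (by norm_num)
            rw [hq]
            nlinarith [Nat.zero_le (L * S.card)]

/-- Two-step walks along distinct first symbols rarely collide. -/
def FewCollisions (L : ℕ) (Λ : LatinSquare n) (σ : Equiv.Perm (Fin n)) : Prop :=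
  ∀ c₁ c₂ c c' : Fin n, c₁ ≠ c₂ →
    (univ.filter fun z => Λ.col (σ (Λ.col z c₁)) c = Λ.col (σ (Λ.col z c₂)) c').card ≤ 60 * L ^ 2

theorem pr_not_fewCollisions_le (h : Large n N L k) (Λ : LatinSquare n) :
    pr (fun σ : Equiv.Perm (Fin n) => ¬ FewCollisions L Λ σ) ≤ 1 / 1000 := by
  have hL := h.L_pos
  have hn : (0 : ℝ) < n := by exact_mod_cast h.n_pos
  set m := 12 * L ^ 2 with hm
  have hm0 : 0 < m := by positivity
  have hmr : (0 : ℝ) < m := by exact_mod_cast hm0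
  have hmn : 4 * m ≤ n := by
    have h1 : 48 * L ^ 2 + 0 ≤ L ^ 3 := h.poly_le 48 0 2 (by norm_num)
    have h2 := h.L_pow_le_n (j := 3) (by norm_num)
    rw [hm]; omega
  calc _ ≤ pr (fun σ : Equiv.Perm (Fin n) => ∃ p ∈ (univ : Finset (Fin n × Fin n × Fin n × Fin n)) ×ˢ
        (powersetCard m (univ : Finset (Fin n))), (p.1.1 ≠ p.1.2.1 ∧ ∀ u ∈ p.2, ∀ u' ∈ p.2, u ≠ u' →
          Disjoint (({p.1.1, p.1.2.1} : Finset (Fin n)).image (Λ.col u))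
            (({p.1.1, p.1.2.1} : Finset (Fin n)).image (Λ.col u'))) ∧
          ∀ z ∈ p.2, Λ.col (σ (Λ.col z p.1.1)) p.1.2.2.1 =
            Λ.col (σ (Λ.col z p.1.2.1)) p.1.2.2.2) := by
        refine pr_mono ?_
        intro σ hσ
        unfold FewCollisions at hσ
        push Not at hσ
        obtain ⟨c₁, c₂, c, c', hc, hσ⟩ := hσ
        obtain ⟨Z', hZ', hcard, hd⟩ := exists_disjoint_family Λ.col
          (fun b u u' hu => Λ.col_inj_left hu) {c₁, c₂}
          (univ.filter fun z => Λ.col (σ (Λ.col z c₁)) c = Λ.col (σ (Λ.col z c₂)) c') m (by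
            rw [card_pair hc]
            calc m * (2 ^ 2 + 1) = 60 * L ^ 2 := by rw [hm]; ring
              _ ≤ _ := hσ.le)
        refine ⟨((c₁, c₂, c, c'), Z'), by simp [hcard], ⟨hc, hd⟩, ?_⟩
        intro z hz
        exact (mem_filter.1 (hZ' hz)).2
    _ ≤ ((univ : Finset (Fin n × Fin n × Fin n × Fin n)) ×ˢ
        (powersetCard m (univ : Finset (Fin n)))).card * (2 / n : ℝ) ^ m := by
        refine pr_exists_le_card_mul _ _ ?_
        rintro ⟨⟨c₁, c₂, c, c'⟩, S⟩ hS
        simp only [mem_product, mem_powersetCard, subset_univ, true_and, mem_univ] at hS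
        by_cases hd : c₁ ≠ c₂ ∧ ∀ u ∈ S, ∀ u' ∈ S, u ≠ u' →
          Disjoint (({c₁, c₂} : Finset (Fin n)).image (Λ.col u))
            (({c₁, c₂} : Finset (Fin n)).image (Λ.col u'))
        swap
        · rw [pr_false_of fun ω hω => hd hω.1]; positivity
        obtain ⟨hc, hd⟩ := hd
        have hJ : (S.image fun z => Λ.col z c₁).card = m := by
          rw [card_image_of_injective _ fun u u' hu => Λ.col_inj_left hu, hS]
        have hG : (S.image fun z => Λ.col z c₂).card = m := by
          rw [card_image_of_injective _ fun u u' hu => Λ.col_inj_left hu, hS]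
        have := perm_pr_le (S.image fun z => Λ.col z c₂) (S.image fun z => Λ.col z c₁) (by
            rw [disjoint_left]
            intro y hy hy'
            obtain ⟨z, hz, rfl⟩ := mem_image.1 hy
            obtain ⟨z', hz', he⟩ := mem_image.1 hy'
            by_cases hzz : z = z'
            · subst hzz; exact hc (Λ.col_inj_right he)
            · exact disjoint_left.1 (hd z hz z' hz' hzz)
                (mem_image.2 ⟨c₂, by simp, rfl⟩) (mem_image.2 ⟨c₁, by simp, he⟩))
          (fun σ y => {Λ.row (Λ.col (σ (Λ.col (Λ.row y c₁) c₂)) c') c}) (b := 1) (m := n / 2)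
          (by simp) (by
            intro σ τ hστ y hy
            obtain ⟨z, hz, rfl⟩ := mem_image.1 hy
            simp only [Λ.row_col]
            rw [hστ _ (mem_image.2 ⟨z, hz, rfl⟩)])
          (by norm_num) (by positivity) (by
            rw [hJ, hG]
            have : (4 * m : ℝ) ≤ n := by exact_mod_cast hmn
            linarith)
        rw [hJ] at this
        refine (pr_mono fun σ hσ => ?_).trans (this.trans (le_of_eq ?_))
        · intro y hy
          obtain ⟨z, hz, rfl⟩ := mem_image.1 hy
          rw [mem_singleton, Λ.row_col, ← hσ.2 z hz, Λ.row_col]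
        · congr 1; field_simp
    _ ≤ (2 ^ (L ^ 2 * 4) * (3 * n / m) ^ m) * (2 / n : ℝ) ^ m := by
        rw [card_product]; push_cast
        gcongr
        · have := h.n_pow_le 4
          rw [card_univ, Fintype.card_prod, Fintype.card_prod, Fintype.card_prod, Fintype.card_fin]
          have h4 : n * (n * (n * n)) ≤ 2 ^ (L ^ 2 * 4) := by
            calc _ = n ^ 4 := by ring
              _ ≤ _ := this
          exact_mod_cast h4
        · exact card_powersetCard_le univ m (by simp)
    _ = 2 ^ (L ^ 2 * 4) * (6 / m : ℝ) ^ m := by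
        rw [mul_assoc, ← mul_pow]; congr 2; field_simp; norm_num
    _ ≤ 2 ^ (L ^ 2 * 4) * (1 / 2 : ℝ) ^ m := by
        refine mul_le_mul_of_nonneg_left (pow_le_pow_left₀ (by positivity) ?_ _) (by positivity)
        rw [div_le_div_iff₀ hmr (by norm_num)]
        have : 12 ≤ m := by
          have : 1 ≤ L ^ 2 := Nat.one_le_pow _ _ hL
          omega
        have : (12 : ℝ) ≤ m := by exact_mod_cast this
        linarith
    _ = (1 / 2 : ℝ) ^ (8 * L ^ 2) := by
        rw [hm, show 12 * L ^ 2 = L ^ 2 * 4 + 8 * L ^ 2 by ring, pow_add (1 / 2 : ℝ), ← mul_assoc,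
          ← mul_pow]
        norm_num
    _ ≤ _ := half_pow_le (by
        have : 2 ≤ L := le_trans (by norm_num) h.L_ge
        nlinarith)

end Typical

/-- A set on which `g` is injective without fixed points has a large subset disjoint from its
image. -/
theorem exists_subset_disjoint_image {α : Type*} (Y : Finset α) (g : α → α)
    (hg : ∀ a ∈ Y, ∀ b ∈ Y, g a = g b → a = b) (hfix : ∀ a ∈ Y, g a ≠ a) :
    ∃ J ⊆ Y, Y.card ≤ 3 * J.card ∧ ∀ a ∈ J, g a ∉ J := by
  obtain ⟨J, hJ, hmax⟩ := exists_max_image (Y.powerset.filter fun J => ∀ a ∈ J, g a ∉ J) card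
    ⟨∅, by simp⟩
  simp only [mem_filter, mem_powerset] at hJ hmax
  refine ⟨J, hJ.1, ?_, hJ.2⟩
  have hsub : Y ⊆ J ∪ J.image g ∪ (Y.filter fun a => g a ∈ J) := by
    intro a ha
    simp only [mem_union, mem_filter, mem_image]
    by_contra! hc
    obtain ⟨⟨h1, h2⟩, h3⟩ := hc
    have h3 := h3 ha
    have := hmax (insert a J) ⟨insert_subset ha hJ.1, by
      intro b hb
      rcases mem_insert.1 hb with rfl | hb
      · simp only [mem_insert, not_or]
        exact ⟨hfix _ ha, h3⟩
      · simp only [mem_insert, not_or]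
        exact ⟨h2 b hb, hJ.2 b hb⟩⟩
    rw [card_insert_of_notMem h1] at this
    omega
  have h3 : (Y.filter fun a => g a ∈ J).card ≤ J.card := by
    refine card_le_card_of_injOn g (fun a ha => (mem_filter.1 ha).2) ?_
    intro a ha b hb
    exact hg a (mem_filter.1 ha).1 b (mem_filter.1 hb).1
  calc Y.card ≤ _ := card_le_card hsub
    _ ≤ J.card + (J.image g).card + (Y.filter fun a => g a ∈ J).card :=
      (card_union_le _ _).trans (Nat.add_le_add_right (card_union_le _ _) _)
    _ ≤ _ := by
      have := card_image_le (s := J) (f := g)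
      omega

section Typical

variable {n N L k : ℕ}

theorem pr_exists_sublist_le (h : Large n N L k) (D : Finset (Fin n)) (hD : N * D.card ≤ 6 * n)
    (B : Fin n → Fin n → Finset (Fin n) → Equiv.Perm (Fin n) → Fin n → Finset (Fin n))
    (hB : ∀ x y J σ z, N * (B x y J σ z).card ≤ 6 * n)
    (hdep : ∀ x y J (σ τ : Equiv.Perm (Fin n)), (∀ g ∈ D \ J, σ g = τ g) → ∀ z ∈ J,
      B x y J σ z = B x y J τ z) :
    pr (fun σ : Equiv.Perm (Fin n) => ∃ x y, ∃ J ⊆ D, n < 128 * N * J.card ∧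
      J.card ≤ n / (128 * N) + 1 ∧ ∀ z ∈ J, σ z ∈ B x y J σ z) ≤ 1 / 1000 := by
  have hNp := h.N_pos
  have hN : (0 : ℝ) < N := by exact_mod_cast hNp
  have hn : (0 : ℝ) < n := by exact_mod_cast h.n_pos
  have hN2 : (N : ℝ) = 2 ^ 20 := by exact_mod_cast h.N_eq
  set s := n / (128 * N) + 1 with hs
  have hsn : n < 128 * N * s := Nat.lt_mul_div_succ n (show 0 < 128 * N by positivity)
  have hs10 : L ^ 2 * 2 + 10 ≤ s := by
    have h1 := h.L_pow_le_n (j := 4) (by norm_num)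
    have h2 : 128 * N * (L ^ 2 * 2 + 10) ≤ n := by
      calc 128 * N * (L ^ 2 * 2 + 10) = (256 * N) * L ^ 2 + 1280 * N := by ring
        _ ≤ L ^ 3 := h.poly_le _ _ 2 (by rw [h.N_eq]; norm_num)
        _ ≤ L ^ 4 := Nat.pow_le_pow_right h.L_pos (by norm_num)
        _ ≤ n := h1
    have := (Nat.le_div_iff_mul_le (show 0 < 128 * N by positivity)).2
      (show (L ^ 2 * 2 + 10) * (128 * N) ≤ n by rw [mul_comm]; exact h2)
    omega
  have hs0 : (0 : ℝ) < s := by exact_mod_cast (by omega : 0 < s)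
  have hDr : (D.card : ℝ) ≤ 6 * n / N := by
    rw [le_div_iff₀ hN, mul_comm]; exact_mod_cast hD
  have hDn : (6 * n / N : ℝ) ≤ n / 2 := by
    rw [div_le_div_iff₀ hN (by norm_num), hN2]
    nlinarith
  have hn2 : ((n * n : ℕ) : ℝ) ≤ 2 ^ s := by
    have : n * n ≤ 2 ^ s := by
      calc n * n = n ^ 2 := by ring
        _ ≤ _ := h.n_pow_le 2
        _ ≤ _ := Nat.pow_le_pow_right (by norm_num) (by omega)
    exact_mod_cast this
  calc _ ≤ pr (fun σ : Equiv.Perm (Fin n) => ∃ p ∈ (univ : Finset (Fin n × Fin n)) ×ˢ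
        D.powersetCard s, ∀ z ∈ p.2, σ z ∈ B p.1.1 p.1.2 p.2 σ z) := by
        refine pr_mono ?_
        rintro σ ⟨x, y, J, hJ, h1, h2, h3⟩
        refine ⟨((x, y), J), ?_, h3⟩
        simp only [mem_product, mem_univ, true_and, mem_powersetCard]
        refine ⟨hJ, le_antisymm h2 ?_⟩
        rw [hs]
        exact Nat.succ_le_of_lt (Nat.lt_of_mul_lt_mul_left (lt_of_le_of_lt (Nat.mul_div_le _ _) h1))
    _ ≤ ((univ : Finset (Fin n × Fin n)) ×ˢ D.powersetCard s).card *
        ((6 * n / N : ℝ) / (n / 2)) ^ s := by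
        refine pr_exists_le_card_mul _ _ ?_
        rintro ⟨⟨x, y⟩, J⟩ hJ
        simp only [mem_product, mem_univ, true_and, mem_powersetCard] at hJ
        rw [← hJ.2]
        have hc : ((D \ J).card : ℝ) + J.card = D.card := by
          exact_mod_cast card_sdiff_add_card_eq_card hJ.1
        refine perm_pr_le (D \ J) J disjoint_sdiff_self_left _ ?_ ?_ (by positivity)
          (by positivity) ?_
        · intro σ z _
          rw [le_div_iff₀ hN, mul_comm]; exact_mod_cast hB _ _ _ _ _
        · exact hdep _ _ _
        · linarith
    _ ≤ (2 ^ s * (2304 : ℝ) ^ s) * (12 / 2 ^ 20) ^ s := by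
        rw [card_product, card_univ, Fintype.card_prod, Fintype.card_fin, Nat.cast_mul (n * n)]
        have e : (6 * n / N : ℝ) / (n / 2) = 12 / 2 ^ 20 := by
          rw [hN2]; field_simp; norm_num
        rw [e]
        refine mul_le_mul_of_nonneg_right (mul_le_mul hn2 ?_ (by positivity) (by positivity))
          (by positivity)
        refine (card_powersetCard_le D s hDr).trans (pow_le_pow_left₀ (by positivity) ?_ _)
        rw [div_le_iff₀ hs0, mul_div_assoc', div_le_iff₀ hN]
        have : (n : ℝ) ≤ 128 * N * s := by exact_mod_cast hsn.le
        linarith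
    _ ≤ (1 / 2 : ℝ) ^ s := by
        rw [← mul_pow, ← mul_pow]
        exact pow_le_pow_left₀ (by positivity) (by norm_num) _
    _ ≤ _ := half_pow_le (by omega)

/-- Exchanging two cells of the random transversal rarely creates a marked hue or a repeated
symbol. -/
structure RepairSparse (Λ : LatinSquare n) (ω : Sample n N) : Prop where
  hue_col : ∀ y, 32 * N * ((lab ω.2 2).filter fun q => q ≠ y ∧
    ∃ y' ∈ marked ω.2, hue Λ ω.1 y' = Λ.sym (ω.1 q) y).card ≤ n
  sym_eq : ∀ x y, 32 * N * ((lab ω.2 2).filter fun q =>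
    Λ.sym (ω.1 q) y = Λ.sym x q).card ≤ n
  hue_row : ∀ x, 32 * N * ((lab ω.2 2).filter fun q =>
    ∃ y' ∈ marked ω.2, hue Λ ω.1 y' = Λ.sym x q).card ≤ n

theorem exists_subset_card_of_lt {Y J : Finset (Fin n)} (hN : 0 < N) (hY : n < 32 * N * Y.card)
    (hJ : Y.card ≤ 3 * J.card) :
    ∃ J' ⊆ J, n < 128 * N * J'.card ∧ J'.card ≤ n / (128 * N) + 1 := by
  have h1 : n < 128 * N * (n / (128 * N) + 1) :=
    Nat.lt_mul_div_succ n (show 0 < 128 * N by positivity)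
  obtain ⟨J', hJ', hc⟩ := exists_subset_card_eq (s := J) (n := n / (128 * N) + 1) (by
    refine Nat.succ_le_of_lt (Nat.lt_of_mul_lt_mul_left
      (lt_of_le_of_lt (Nat.mul_div_le n (128 * N)) ?_))
    nlinarith)
  exact ⟨J', hJ', by rw [hc]; exact h1, hc.le⟩

theorem pr_not_repairSparse_le (h : Large n N L k) (Λ : LatinSquare n) :
    pr (fun ω : Sample n N => FairLabels ω.2 ∧ ¬ RepairSparse Λ ω) ≤ 3 / 1000 := by
  have hNp := h.N_pos
  refine pr_prod_le' _ (by norm_num) fun l => ?_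
  by_cases hl : FairLabels l
  swap
  · rw [pr_false_of fun σ hσ => hl hσ.1]; norm_num
  have hD := hl.card_marked
  have hP := (hl 2 (by norm_num)).1
  have hPD : lab l 2 ⊆ marked l := lab_subset_marked l (by norm_num)
  have h6n : N ≤ 6 * n := by
    have h1 := h.L_pow_le_n (j := 1) (by norm_num)
    have h2 := h.L_ge
    rw [pow_one] at h1
    rw [h.N_eq]
    exact le_trans (le_trans (by norm_num) (h2.trans h1)) (by omega)
  have key1 := pr_exists_sublist_le h (marked l) hD
    (fun (_ y : Fin n) (J : Finset (Fin n)) σ (_ : Fin n) =>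
      (marked l \ J).image fun y' => Λ.row y (hue Λ σ y'))
    (by
      intro x y J σ z
      refine le_trans ?_ hD
      exact Nat.mul_le_mul_left N (le_trans card_image_le (card_le_card sdiff_subset)))
    (by
      intro x y J σ τ hστ z hz
      apply image_congr
      intro y' hy'
      simp only [hue, hστ y' hy'])
  have key2 := pr_exists_sublist_le h (marked l) hD
    (fun x y _ _ q => {Λ.row y (Λ.sym x q)}) (fun _ _ _ _ _ => by simpa using h6n)
    (by simp)
  have key3 := pr_exists_sublist_le h (marked l) hD
    (fun x _ _ _ y' => (lab l 2).image fun q => Λ.row y' (Λ.sym x q)) (by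
      intro x y J σ z
      refine le_trans (Nat.mul_le_mul_left N card_image_le) (hP.trans (by omega))) (by simp)
  refine le_trans (pr_mono (Q := fun σ => _ ∨ _ ∨ _) ?_) ((pr_or_le _ _).trans
    ((add_le_add key1 ((pr_or_le _ _).trans (add_le_add key2 key3))).trans (by norm_num)))
  rintro σ ⟨-, hσ⟩
  by_contra hc
  push Not at hc
  obtain ⟨hc1, hc2, hc3⟩ := hc
  refine hσ ⟨fun y => ?_, fun x y => ?_, fun x => ?_⟩
  · by_contra! hY
    set Y := (lab l 2).filter fun q => q ≠ y ∧ ∃ y' ∈ marked l, hue Λ σ y' = Λ.sym (σ q) y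
    have hex : ∀ q, ∃ y', q ∈ Y → y' ∈ marked l ∧ hue Λ σ y' = Λ.sym (σ q) y := by
      intro q
      by_cases hq : q ∈ Y
      · obtain ⟨y', h1, h2⟩ := (mem_filter.1 hq).2.2
        exact ⟨y', fun _ => ⟨h1, h2⟩⟩
      · exact ⟨q, fun h => absurd h hq⟩
    choose g hg using hex
    obtain ⟨J, hJY, hJc, hJd⟩ := exists_subset_disjoint_image Y g (by
      intro a ha b hb hab
      have h1 := (hg a ha).2
      rw [hab, (hg b hb).2] at h1
      exact σ.injective (Λ.sym_inj_left h1.symm)) (by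
      intro a ha hab
      have h1 := (hg a ha).2
      rw [hab] at h1
      exact (mem_filter.1 ha).2.1 (Λ.sym_inj_right h1))
    obtain ⟨J', hJ', h1, h2⟩ := exists_subset_card_of_lt hNp hY hJc
    obtain ⟨z, hz, hzz⟩ := hc1 y y J' ((hJ'.trans hJY).trans ((filter_subset _ _).trans hPD)) h1 h2
    refine hzz (mem_image.2 ⟨g z, mem_sdiff.2 ⟨(hg z (hJY (hJ' hz))).1,
      fun hm => hJd z (hJ' hz) (hJ' hm)⟩, ?_⟩)
    rw [(hg z (hJY (hJ' hz))).2]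
    exact Λ.row_sym _ _
  · by_contra! hY
    obtain ⟨J', hJ', h1, h2⟩ := exists_subset_card_of_lt hNp hY (le_mul_of_one_le_left' (by norm_num))
    obtain ⟨z, hz, hzz⟩ := hc2 x y J' (hJ'.trans ((filter_subset _ _).trans hPD)) h1 h2
    refine hzz ?_
    rw [mem_singleton, ← (mem_filter.1 (hJ' hz)).2]
    exact (Λ.row_sym _ _).symm
  · by_contra! hY
    set Y := (lab l 2).filter fun q => ∃ y' ∈ marked l, hue Λ σ y' = Λ.sym x q
    have hex : ∀ q, ∃ y', q ∈ Y → y' ∈ marked l ∧ hue Λ σ y' = Λ.sym x q := by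
      intro q
      by_cases hq : q ∈ Y
      · obtain ⟨y', h1, h2⟩ := (mem_filter.1 hq).2
        exact ⟨y', fun _ => ⟨h1, h2⟩⟩
      · exact ⟨q, fun h => absurd h hq⟩
    choose g hg using hex
    have hc : (Y.image g).card = Y.card := by
      apply card_image_of_injOn
      intro a ha b hb hab
      have h1 := (hg a ha).2
      rw [hab, (hg b hb).2] at h1
      exact Λ.sym_inj_right h1.symm
    obtain ⟨J', hJ', h1, h2⟩ := exists_subset_card_of_lt hNp (Y := Y) (J := Y.image g) hY (by omega)
    obtain ⟨z, hz, hzz⟩ := hc3 x x J' (by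
      intro z hz
      obtain ⟨q, hq, rfl⟩ := mem_image.1 (hJ' hz)
      exact (hg q hq).1) h1 h2
    obtain ⟨q, hq, rfl⟩ := mem_image.1 (hJ' hz)
    refine hzz (mem_image.2 ⟨q, (mem_filter.1 hq).1, ?_⟩)
    rw [← (hg q hq).2]
    exact Λ.row_sym _ _

end Typical

variable {n N L k : ℕ}

/-- The rows in which at least a proportion `p / q` of the symbols of `C` lies in the columns
`V`. -/
noncomputable def LatinSquare.crowd (Λ : LatinSquare n) (C V : Finset (Fin n)) (p q : ℕ) :
    Finset (Fin n) :=
  univ.filter fun z => p * C.card ≤ q * (C.filter fun c => Λ.col z c ∈ V).card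

theorem LatinSquare.mem_crowd (Λ : LatinSquare n) {C V : Finset (Fin n)} {p q : ℕ} {z : Fin n} :
    z ∈ Λ.crowd C V p q ↔ p * C.card ≤ q * (C.filter fun c => Λ.col z c ∈ V).card := by
  simp [LatinSquare.crowd]

theorem LatinSquare.sum_card_filter_col (Λ : LatinSquare n) (C V : Finset (Fin n)) :
    ∑ z, (C.filter fun c => Λ.col z c ∈ V).card = C.card * V.card := by
  simp only [card_filter]
  rw [sum_comm, ← smul_eq_mul, ← sum_const]
  refine sum_congr rfl fun c _ => ?_
  rw [← card_filter, card_eq_card_image_of_row Λ c V]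
where
  card_eq_card_image_of_row (Λ : LatinSquare n) (c : Fin n) (V : Finset (Fin n)) :
      (univ.filter fun z => Λ.col z c ∈ V).card = V.card := by
    refine card_bij (fun z _ => Λ.col z c) (fun z hz => (mem_filter.1 hz).2)
      (fun z _ z' _ h => Λ.col_inj_left h)
      (fun y hy => ⟨Λ.row y c, by simp [Λ.col_row, hy], Λ.col_row y c⟩)

theorem LatinSquare.card_crowd_le (Λ : LatinSquare n) {C V : Finset (Fin n)} {p q : ℕ}
    (hC : 0 < C.card) : p * (Λ.crowd C V p q).card ≤ q * V.card := by
  have h : C.card * (p * (Λ.crowd C V p q).card) ≤ C.card * (q * V.card) := by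
    calc C.card * (p * (Λ.crowd C V p q).card) = ∑ z ∈ Λ.crowd C V p q, p * C.card := by
          rw [sum_const, smul_eq_mul]; ring
      _ ≤ ∑ z ∈ Λ.crowd C V p q, q * (C.filter fun c => Λ.col z c ∈ V).card :=
          sum_le_sum fun z hz => Λ.mem_crowd.1 hz
      _ ≤ ∑ z, q * (C.filter fun c => Λ.col z c ∈ V).card :=
          sum_le_sum_of_subset (subset_univ _)
      _ = _ := by rw [← mul_sum, Λ.sum_card_filter_col]; ring
  exact Nat.le_of_mul_le_mul_left h hC

section Typical

theorem pr_crowd_le (h : Large n N L k) (Λ : LatinSquare n) {C T Tb : Finset (Fin n)}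
    (hC : C.card = k) (hTb : Tb ⊆ T) {t : ℕ} (hT : T.card = t) (ht : 2 ^ 400 * (k * t) ≤ n) :
    pr (fun σ : Equiv.Perm (Fin n) => ∀ y ∈ Tb,
      σ y ∈ Λ.crowd C (Λ.nbr C ((T \ Tb).image σ)) 1 (64 * N)) ≤
        (128 * N * k * t / n : ℝ) ^ Tb.card := by
  have hn : (0 : ℝ) < n := by exact_mod_cast h.n_pos
  have hk := h.k_pos
  have hc : (T \ Tb).card + Tb.card = t := by
    rw [card_sdiff_add_card_eq_card hTb, hT]
  refine (perm_pr_le (T \ Tb) Tb disjoint_sdiff_self_left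
    (fun σ _ => Λ.crowd C (Λ.nbr C ((T \ Tb).image σ)) 1 (64 * N))
    (b := 64 * N * k * t) (m := n / 2) ?_ ?_ (by positivity) (by positivity) ?_).trans
    (le_of_eq ?_)
  · intro σ y _
    have h1 := Λ.card_crowd_le (C := C) (V := Λ.nbr C ((T \ Tb).image σ)) (p := 1) (q := 64 * N)
      (by omega)
    rw [one_mul] at h1
    have h2 : (Λ.nbr C ((T \ Tb).image σ)).card ≤ t * k := by
      refine (Λ.card_nbr_le _ _).trans ?_
      rw [hC]
      refine Nat.mul_le_mul_right k (card_image_le.trans (by omega))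
    have : (Λ.crowd C (Λ.nbr C ((T \ Tb).image σ)) 1 (64 * N)).card ≤ 64 * N * k * t :=
      h1.trans ((Nat.mul_le_mul_left _ h2).trans (le_of_eq (by ring)))
    exact_mod_cast this
  · intro σ τ hστ y _
    have : (T \ Tb).image σ = (T \ Tb).image τ := image_congr fun g hg => hστ g hg
    simp only [this]
  · have h1 : ((T \ Tb).card : ℝ) + Tb.card = t := by exact_mod_cast hc
    have h2 : 2 * t ≤ n := le_trans (Nat.mul_le_mul (le_self_pow₀ (by norm_num) (by norm_num))
      (Nat.le_mul_of_pos_left t hk)) ht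
    have h2 : (2 * t : ℝ) ≤ n := by exact_mod_cast h2
    linarith
  · congr 1; field_simp; ring

/-- Every large set of columns with few parents is spread by `σ`. -/
def Expansive (L k N : ℕ) (Λ : LatinSquare n) (σ : Equiv.Perm (Fin n)) : Prop :=
  ∀ C₁ C₂ S T Tb : Finset (Fin n), C₁.card = k → C₂.card = k → T ⊆ Λ.nbr C₁ S → Tb ⊆ T →
    L * S.card ≤ T.card → 200 * k ≤ T.card → 2 ^ 400 * (k * T.card) ≤ n → T.card ≤ 2 * Tb.card →
    ∃ y ∈ Tb, σ y ∉ Λ.crowd C₂ (Λ.nbr C₂ ((T \ Tb).image σ)) 1 (64 * N)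

theorem expansive_bound (h : Large n N L k) {s t b : ℕ} (hst : L * s ≤ t) (hkt : 200 * k ≤ t)
    (htn : 2 ^ 400 * (k * t) ≤ n) (hb : t ≤ 2 * b) :
    (n : ℝ) ^ (4 * k) * ((n.choose s : ℝ) * (((s * k).choose t : ℝ) * (2 ^ t *
      (128 * N * k * t / n : ℝ) ^ b))) ≤ 1 / 1000 := by
  have hk := h.k_pos
  have hL := h.L_pos
  have hnp := h.n_pos
  have hn : (0 : ℝ) < n := by exact_mod_cast hnp
  have ht0 : 0 < t := by omega
  have htr : (0 : ℝ) < t := by exact_mod_cast ht0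
  have hkr : (0 : ℝ) < k := by exact_mod_cast hk
  have hNr : (0 : ℝ) < N := by exact_mod_cast h.N_pos
  set X : ℝ := 128 * N * k * t / n with hX
  have hX0 : 0 < X := by positivity
  have hXs : X ≤ (1 / 2) ^ 373 := by
    rw [hX, div_le_iff₀ hn]
    have h1 : (2 ^ 400 * (k * t) : ℝ) ≤ n := by exact_mod_cast htn
    have h2 : (N : ℝ) = 2 ^ 20 := by exact_mod_cast h.N_eq
    have h3 : (1 / 2 : ℝ) ^ 373 * 2 ^ 400 = 2 ^ 27 := by
      rw [show (400 : ℕ) = 373 + 27 from rfl, pow_add, ← mul_assoc, ← mul_pow]; norm_num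
    calc (128 * N * k * t : ℝ) = (1 / 2) ^ 373 * (2 ^ 400 * (k * t)) := by
          rw [← mul_assoc, h3, h2]; ring
      _ ≤ _ := mul_le_mul_of_nonneg_left h1 (by positivity)
  have hX1 : X ≤ 1 := hXs.trans (pow_le_one₀ (by norm_num) (by norm_num))
  have hLs : 2 ^ 200 * s ≤ t := le_trans (Nat.mul_le_mul_right s h.L_ge) hst
  set u := t / 8 with hu
  have hu1 : t ≤ 9 * u := by omega
  have hsu : s + u + 2 * u ≤ b := by omega
  -- the growing factor
  have hgrow : (n : ℝ) ^ (4 * k) * X ^ u ≤ 2 ^ t := by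
    rcases le_or_gt (L ^ 2 * (4 * k)) t with hc | hc
    · calc (n : ℝ) ^ (4 * k) * X ^ u ≤ 2 ^ t * 1 := by
            refine mul_le_mul ?_ (pow_le_one₀ hX0.le hX1) (by positivity) (by positivity)
            have : n ^ (4 * k) ≤ 2 ^ t :=
              (h.n_pow_le (4 * k)).trans (Nat.pow_le_pow_right (by norm_num) hc)
            exact_mod_cast this
        _ = _ := mul_one _
    · have hX4 : X ^ 4 ≤ 1 / n := by
        have h1 : 128 * N * k * t ≤ L ^ 8 := by
          have e1 : 128 * N * 4 ≤ L := by
            refine le_trans ?_ h.L_ge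
            rw [h.N_eq]; norm_num
          calc 128 * N * k * t ≤ 128 * N * k * (L ^ 2 * (4 * k)) := by gcongr
            _ = (128 * N * 4) * (L ^ 2 * (k * k)) := by ring
            _ ≤ L * (L ^ 2 * (L ^ 2 * L ^ 2)) := by
              have := h.k_le_sq
              gcongr
            _ = L ^ 7 := by ring
            _ ≤ L ^ 8 := Nat.pow_le_pow_right hL (by norm_num)
        have h2 : (128 * N * k * t) ^ 4 ≤ n := by
          calc (128 * N * k * t) ^ 4 ≤ (L ^ 8) ^ 4 := by gcongr
            _ = L ^ 32 := by ring
            _ ≤ n := h.L_pow_le_n (by norm_num)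
        have h3 : ((128 * N * k * t : ℝ)) ^ 4 ≤ n := by exact_mod_cast h2
        have h1n : (1 : ℝ) ≤ n := by exact_mod_cast hnp
        rw [hX, div_pow, div_le_div_iff₀ (by positivity) hn]
        calc (128 * N * k * t : ℝ) ^ 4 * n ≤ n * n := by gcongr
          _ = n ^ 2 := by ring
          _ ≤ n ^ 4 := pow_le_pow_right₀ h1n (by norm_num)
          _ = _ := by ring
      calc (n : ℝ) ^ (4 * k) * X ^ u ≤ (n : ℝ) ^ (4 * k) * X ^ (4 * (4 * k)) := by
            refine mul_le_mul_of_nonneg_left (pow_le_pow_of_le_one hX0.le hX1 ?_) (by positivity)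
            omega
        _ ≤ (n : ℝ) ^ (4 * k) * (1 / n) ^ (4 * k) := by
            rw [pow_mul X]
            exact mul_le_mul_of_nonneg_left (pow_le_pow_left₀ (by positivity) hX4 _)
              (by positivity)
        _ = 1 := by rw [← mul_pow]; field_simp; simp
        _ ≤ _ := one_le_pow₀ (by norm_num)
  have hS : (n.choose s : ℝ) * X ^ s ≤ 2 ^ (3 * t) := by
    calc (n.choose s : ℝ) * X ^ s ≤ ((n / t : ℝ) ^ s * 3 ^ t) * X ^ s := by
          gcongr
          exact choose_le_div_pow n s t ht0 hnp
      _ = (128 * N * k) ^ s * 3 ^ t := by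
          rw [mul_right_comm, ← mul_pow]
          congr 2
          rw [hX]; field_simp
      _ ≤ (2 ^ L) ^ s * 4 ^ t := by
          have : 128 * N * k ≤ 2 ^ L := by
            refine le_trans ?_ h.L_pow_le
            calc 128 * N * k ≤ L * L ^ 2 := by
                  have := h.k_le_sq
                  gcongr
                  refine le_trans ?_ h.L_ge
                  rw [h.N_eq]; norm_num
              _ = L ^ 3 := by ring
              _ ≤ _ := Nat.pow_le_pow_right hL (by norm_num)
          have : (128 * N * k : ℝ) ≤ 2 ^ L := by exact_mod_cast this
          exact mul_le_mul (pow_le_pow_left₀ (by positivity) this _)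
            (pow_le_pow_left₀ (by norm_num) (by norm_num) _) (by positivity) (by positivity)
      _ ≤ 2 ^ t * 4 ^ t := by
          rw [← pow_mul]
          refine mul_le_mul_of_nonneg_right (pow_le_pow_right₀ (by norm_num) hst) (by positivity)
      _ = _ := by
          rw [pow_mul, ← mul_pow]; norm_num
  have hT : ((s * k).choose t : ℝ) ≤ 2 ^ (66 * t) := by
    refine (choose_le_three_mul_div_pow (s * k) t).trans ?_
    rw [pow_mul]
    refine pow_le_pow_left₀ (by positivity) ?_ _
    rw [div_le_iff₀ htr, h.k_eq]
    have : 3 * (s * (2 ^ 64 * L)) ≤ 2 ^ 66 * t := by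
      calc 3 * (s * (2 ^ 64 * L)) = 3 * 2 ^ 64 * (L * s) := by ring
        _ ≤ 3 * 2 ^ 64 * t := by gcongr
        _ ≤ _ := by gcongr; norm_num
    exact_mod_cast this
  have hX2u : X ^ (2 * u) ≤ (1 / 2) ^ (82 * t) := by
    calc X ^ (2 * u) ≤ ((1 / 2) ^ 373) ^ (2 * u) := pow_le_pow_left₀ hX0.le hXs _
      _ = (1 / 2) ^ (373 * (2 * u)) := by rw [← pow_mul]
      _ ≤ _ := pow_le_pow_of_le_one (by norm_num) (by norm_num) (by omega)
  calc _ ≤ (n : ℝ) ^ (4 * k) * ((n.choose s : ℝ) * (((s * k).choose t : ℝ) * (2 ^ t *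
        X ^ (s + u + 2 * u)))) := by
        have := pow_le_pow_of_le_one hX0.le hX1 hsu
        gcongr
    _ = ((n : ℝ) ^ (4 * k) * X ^ u) * ((n.choose s : ℝ) * X ^ s) * ((s * k).choose t : ℝ) * 2 ^ t *
        X ^ (2 * u) := by rw [pow_add, pow_add]; ring
    _ ≤ 2 ^ t * 2 ^ (3 * t) * 2 ^ (66 * t) * 2 ^ t * (1 / 2) ^ (82 * t) := by
        gcongr
    _ = (1 / 2) ^ (11 * t) := by
        rw [← pow_add, ← pow_add, ← pow_add,
          show 82 * t = t + 3 * t + 66 * t + t + 11 * t by ring, pow_add (1 / 2 : ℝ), ← mul_assoc,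
          ← mul_pow]
        norm_num
    _ ≤ _ := half_pow_le (by omega)

theorem pr_not_expansive_le (h : Large n N L k) (Λ : LatinSquare n) :
    pr (fun σ : Equiv.Perm (Fin n) => ¬ Expansive L k N Λ σ) ≤ 1 / 1000 := by
  have hk := h.k_pos
  have hnp := h.n_pos
  have hn : (0 : ℝ) < n := by exact_mod_cast hnp
  have hcount : ((((range (n + 1)) ×ˢ (range (n + 1))) ×ˢ
      ((powersetCard k (univ : Finset (Fin n))) ×ˢ (powersetCard k (univ : Finset (Fin n))))).card :
      ℝ) ≤ (n : ℝ) ^ (4 * k) := by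
    have h1 : n.choose k ≤ n ^ k := Nat.choose_le_pow n k
    have hn2 : 2 ≤ n := by
      have := h.L_pow_le_n (j := 1) (by norm_num)
      rw [pow_one] at this
      exact le_trans (le_trans (by norm_num) h.L_ge) this
    have hk2 : 2 ≤ k := le_trans (le_trans (by norm_num) h.L_ge) h.L_le_k
    have : (n + 1) * (n + 1) * (n.choose k * n.choose k) ≤ n ^ (4 * k) := by
      calc (n + 1) * (n + 1) * (n.choose k * n.choose k)
          ≤ (n ^ 2 * n ^ 2) * (n ^ k * n ^ k) := by
            have : n + 1 ≤ n ^ 2 := by nlinarith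
            gcongr
        _ = n ^ (2 * k + 4) := by ring
        _ ≤ _ := Nat.pow_le_pow_right hnp (by omega)
    simp only [card_product, card_range, card_powersetCard, card_univ, Fintype.card_fin]
    exact_mod_cast this
  calc _ ≤ pr (fun σ : Equiv.Perm (Fin n) => ∃ p ∈ ((range (n + 1)) ×ˢ (range (n + 1))) ×ˢ
      ((powersetCard k (univ : Finset (Fin n))) ×ˢ (powersetCard k (univ : Finset (Fin n)))),
      (L * p.1.1 ≤ p.1.2 ∧ 200 * k ≤ p.1.2 ∧ 2 ^ 400 * (k * p.1.2) ≤ n) ∧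
      ∃ S ∈ powersetCard p.1.1 (univ : Finset (Fin n)),
        ∃ T ∈ powersetCard p.1.2 (Λ.nbr p.2.1 S), ∃ Tb ∈ T.powerset, p.1.2 ≤ 2 * Tb.card ∧
        ∀ y ∈ Tb, σ y ∈ Λ.crowd p.2.2 (Λ.nbr p.2.2 ((T \ Tb).image σ)) 1 (64 * N)) := by
        refine pr_mono ?_
        intro σ hσ
        unfold Expansive at hσ
        push Not at hσ
        obtain ⟨C₁, C₂, S, T, Tb, h1, h2, h3, h4, h5, h6, h7, h8, h9⟩ := hσ
        refine ⟨((S.card, T.card), (C₁, C₂)), ?_, ⟨h5, h6, h7⟩, S, by simp, T, by simp [h3],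
          Tb, mem_powerset.2 h4, h8, h9⟩
        have hS := card_le_univ S
        have hT := card_le_univ T
        rw [Fintype.card_fin] at hS hT
        simp only [mem_product, mem_range, mem_powersetCard, subset_univ, h1, h2, and_self,
          and_true]
        omega
    _ ≤ (((range (n + 1)) ×ˢ (range (n + 1))) ×ˢ ((powersetCard k (univ : Finset (Fin n))) ×ˢ
          (powersetCard k (univ : Finset (Fin n))))).card *
          ((1 / 1000) / (n : ℝ) ^ (4 * k)) := by
        refine pr_exists_le_card_mul _ _ ?_
        rintro ⟨⟨s, t⟩, C₁, C₂⟩ hp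
        simp only [mem_product, mem_range, mem_powersetCard, subset_univ, true_and] at hp
        by_cases hc : L * s ≤ t ∧ 200 * k ≤ t ∧ 2 ^ 400 * (k * t) ≤ n
        swap
        · rw [pr_false_of fun σ hσ => hc hσ.1]; positivity
        obtain ⟨hst, hkt, htn⟩ := hc
        have hX : (128 * N * k * t / n : ℝ) ≤ 1 := by
          rw [div_le_one hn]
          have : 128 * N * k * t ≤ n := by
            refine le_trans ?_ htn
            rw [mul_assoc]
            refine Nat.mul_le_mul_right _ ?_
            rw [h.N_eq, show 128 * 2 ^ 20 = 2 ^ 27 by norm_num]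
            exact Nat.pow_le_pow_right (by norm_num) (by norm_num)
          exact_mod_cast this
        rw [le_div_iff₀' (by positivity)]
        refine le_trans (mul_le_mul_of_nonneg_left ?_ (by positivity))
          (expansive_bound h hst hkt htn (b := (t + 1) / 2) (by omega))
        refine (pr_mono fun σ hσ => hσ.2).trans ?_
        refine (pr_exists_le_card_mul (b := ((s * k).choose t : ℝ) * (2 ^ t *
          (128 * N * k * t / n : ℝ) ^ ((t + 1) / 2))) _ _ ?_).trans (le_of_eq ?_)
        swap
        · rw [card_powersetCard, card_univ, Fintype.card_fin]
        intro S hS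
        refine (pr_exists_le_card_mul (b := (2 ^ t *
          (128 * N * k * t / n : ℝ) ^ ((t + 1) / 2))) _ _ ?_).trans ?_
        swap
        · refine mul_le_mul_of_nonneg_right ?_ (by positivity)
          rw [card_powersetCard]
          have : (Λ.nbr C₁ S).card ≤ s * k := by
            refine (Λ.card_nbr_le _ _).trans (le_of_eq ?_)
            rw [(mem_powersetCard.1 hS).2, hp.2.1]
          exact_mod_cast Nat.choose_le_choose t this
        intro T hT
        have hTc := (mem_powersetCard.1 hT).2
        refine (pr_exists_le_card_mul (b := (128 * N * k * t / n : ℝ) ^ ((t + 1) / 2))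
          _ _ ?_).trans (le_of_eq ?_)
        swap
        · rw [card_powerset, hTc]; push_cast; rfl
        intro Tb hTb
        by_cases hb : t ≤ 2 * Tb.card
        swap
        · rw [pr_false_of fun σ hσ => hb hσ.1]; positivity
        refine (pr_mono fun σ hσ => hσ.2).trans ((pr_crowd_le h Λ hp.2.2
          (mem_powerset.1 hTb) hTc htn).trans ?_)
        exact pow_le_pow_of_le_one (by positivity) hX (by omega)
    _ ≤ (n : ℝ) ^ (4 * k) * ((1 / 1000) / (n : ℝ) ^ (4 * k)) :=
        mul_le_mul_of_nonneg_right hcount (by positivity)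
    _ = _ := by field_simp

/-- Under the expansion property, lists of symbols at the image of a set of columns reach many
columns. -/
theorem Expansive.card_biUnion_ge {Λ : LatinSquare n}
    {σ : Equiv.Perm (Fin n)} (hσ : Expansive L k N Λ σ) {C₁ C₂ S T : Finset (Fin n)}
    (h1 : C₁.card = k) (h2 : C₂.card = k) (hTS : T ⊆ Λ.nbr C₁ S) (hLS : L * S.card ≤ T.card)
    (hkT : 200 * k ≤ T.card) (hTn : 2 ^ 400 * (k * T.card) ≤ n) (R : Fin n → Finset (Fin n))
    (hR : ∀ y ∈ T, R y ⊆ C₂) (hRk : ∀ y ∈ T, k ≤ 32 * N * (R y).card) :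
    T.card * k ≤ 128 * N * (T.biUnion fun y => (R y).image (Λ.col (σ y))).card := by
  set reach : Finset (Fin n) → Finset (Fin n) :=
    fun A => A.biUnion fun y => (R y).image (Λ.col (σ y)) with hreach
  obtain ⟨A, hA, hmax⟩ := exists_max_image
    (T.powerset.filter fun A => A.card * k ≤ 64 * N * (reach A).card) card ⟨∅, by simp⟩
  simp only [mem_filter, mem_powerset] at hA hmax
  by_cases hc : T.card ≤ 2 * A.card
  · have h3 : (reach A).card ≤ (reach T).card := card_le_card (biUnion_subset_biUnion_of_subset_left _ hA.1)
    calc T.card * k ≤ 2 * A.card * k := by gcongr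
      _ = 2 * (A.card * k) := by ring
      _ ≤ 2 * (64 * N * (reach A).card) := Nat.mul_le_mul_left 2 hA.2
      _ = 128 * N * (reach A).card := by ring
      _ ≤ _ := by gcongr
  · exfalso
    have hcard := card_sdiff_add_card_eq_card hA.1
    obtain ⟨y, hy, hyn⟩ := hσ C₁ C₂ S T (T \ A) h1 h2 hTS sdiff_subset hLS hkT hTn (by omega)
    rw [mem_sdiff] at hy
    refine hyn (Λ.mem_crowd.2 ?_)
    have hTA : T \ (T \ A) = A := Finset.sdiff_sdiff_eq_self hA.1
    rw [hTA, h2, one_mul]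
    have hnot : ¬ (insert y A).card * k ≤ 64 * N * (reach (insert y A)).card := by
      intro hh
      have := hmax (insert y A) ⟨insert_subset hy.1 hA.1, hh⟩
      rw [card_insert_of_notMem hy.2] at this
      omega
    have hins : reach (insert y A) = (R y).image (Λ.col (σ y)) ∪ reach A := by
      simp only [hreach, biUnion_insert]
    have hRc : ((R y).image (Λ.col (σ y))).card = (R y).card :=
      card_image_of_injective _ fun c c' hcc => Λ.col_inj_right hcc
    have hinter : ((R y).image (Λ.col (σ y)) ∩ reach A).card ≤
        (C₂.filter fun c => Λ.col (σ y) c ∈ Λ.nbr C₂ (A.image σ)).card := by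
      rw [← filter_mem_eq_inter, filter_image]
      refine card_image_le.trans (card_le_card ?_)
      intro c hc
      rw [mem_filter] at hc ⊢
      refine ⟨hR y hy.1 hc.1, ?_⟩
      obtain ⟨y', hy', hm⟩ := mem_biUnion.1 hc.2
      obtain ⟨c', hc', he⟩ := mem_image.1 hm
      rw [Λ.mem_nbr]
      exact ⟨σ y', mem_image_of_mem _ hy', c', hR y' (hA.1 hy') hc', he⟩
    have hu := card_union_add_card_inter ((R y).image (Λ.col (σ y))) (reach A)
    rw [← hins, hRc] at hu
    rw [card_insert_of_notMem hy.2] at hnot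
    have hRy := hRk y hy.1
    have hAk := hA.2
    push Not at hnot
    generalize (reach (insert y A)).card = a1 at *
    generalize ((R y).image (Λ.col (σ y)) ∩ reach A).card = a2 at *
    generalize (C₂.filter fun c => Λ.col (σ y) c ∈ Λ.nbr C₂ (A.image σ)).card = a3 at *
    generalize (reach A).card = a4 at *
    generalize (R y).card = a5 at *
    have e1 : 64 * N * (a1 + a2) = 64 * N * (a5 + a4) := by rw [hu]
    have e2 : 64 * N * a2 ≤ 64 * N * a3 := Nat.mul_le_mul_left _ hinter
    nlinarith

end Typical

section Typical

variable {n N L k : ℕ}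

/-- A set of rows of the size reached by the last expansion step, with few collisions. -/
structure FinalSet (N k : ℕ) (Λ : LatinSquare n) (C S : Finset (Fin n)) : Prop where
  card_eq : C.card = k
  le_card : n ≤ 2 ^ 402 * (k * S.card)
  card_le : 2 ^ 400 * (k * S.card) ≤ n
  le_nbr : k * S.card ≤ 128 * N * (Λ.nbr C S).card

theorem FinalSet.card_pos (h : Large n N L k) {Λ : LatinSquare n} {C S : Finset (Fin n)}
    (hF : FinalSet N k Λ C S) : 0 < S.card := by
  by_contra hc
  have h0 : S.card = 0 := by omega
  have := hF.le_card
  rw [h0, mul_zero, mul_zero] at this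
  have := h.n_pos
  omega

theorem FinalSet.nbr_ge (h : Large n N L k) {Λ : LatinSquare n} {C S : Finset (Fin n)}
    (hF : FinalSet N k Λ C S) : 2 ^ 37 * (L * S.card) ≤ (Λ.nbr C S).card := by
  have h1 := hF.le_nbr
  rw [h.k_eq, h.N_eq] at h1
  nlinarith

theorem final_count_le (h : Large n N L k) {s : ℕ} (hs : n ≤ 2 ^ 402 * (k * s)) :
    (n : ℝ) ^ (4 * k) * (n.choose s : ℝ) * (1 / 2) ^ (128 * L * s) ≤ 1 / 1000 := by
  have hk := h.k_pos
  have hL := h.L_pos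
  have hs0 : 0 < s := by
    rcases Nat.eq_zero_or_pos s with rfl | h0
    · have := h.n_pos; simp at hs; omega
    · exact h0
  have hsr : (0 : ℝ) < s := by exact_mod_cast hs0
  have hL402 : 3 * 2 ^ 402 ≤ L := by
    refine le_trans ?_ h.L_ge_pow
    calc 3 * 2 ^ 402 ≤ 2 ^ 2 * 2 ^ 402 := Nat.mul_le_mul_right _ (by norm_num)
      _ = 2 ^ 404 := by rw [← pow_add]
      _ ≤ _ := Nat.pow_le_pow_right (by norm_num) (by norm_num)
  have h1 : (n.choose s : ℝ) ≤ 2 ^ (L * s) := by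
    refine (choose_le_three_mul_div_pow n s).trans ?_
    rw [pow_mul]
    refine pow_le_pow_left₀ (by positivity) ?_ _
    rw [div_le_iff₀ hsr]
    have : 3 * n ≤ 2 ^ L * s := by
      calc 3 * n ≤ 3 * (2 ^ 402 * (k * s)) := Nat.mul_le_mul_left 3 hs
        _ = (3 * 2 ^ 402) * k * s := by ring
        _ ≤ L * L ^ 2 * s := by
          refine Nat.mul_le_mul_right s (Nat.mul_le_mul hL402 h.k_le_sq)
        _ = L ^ 3 * s := by ring
        _ ≤ L ^ 64 * s := Nat.mul_le_mul_right s (Nat.pow_le_pow_right hL (by norm_num))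
        _ ≤ _ := Nat.mul_le_mul_right s h.L_pow_le
    exact_mod_cast this
  have h2 : (n : ℝ) ^ (4 * k) ≤ 2 ^ (L * s) := by
    have h3 : L ^ 2 * (4 * k) ≤ L * s := by
      have h4 : 2 ^ 402 * (k * (L ^ 4)) ≤ 2 ^ 402 * (k * s) := by
        refine le_trans ?_ hs
        refine le_trans ?_ (h.L_pow_le_n (j := 7) (by norm_num))
        calc 2 ^ 402 * (k * L ^ 4) ≤ L * (L ^ 2 * L ^ 4) :=
              Nat.mul_le_mul (le_trans (Nat.le_mul_of_pos_left _ (by norm_num)) hL402)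
                (Nat.mul_le_mul_right _ h.k_le_sq)
          _ = _ := by ring
      have h5 := Nat.le_of_mul_le_mul_left (Nat.le_of_mul_le_mul_left h4 (by positivity)) hk
      calc L ^ 2 * (4 * k) ≤ L ^ 2 * (L * L ^ 2) := by
            refine Nat.mul_le_mul_left _ (Nat.mul_le_mul ?_ h.k_le_sq)
            exact le_trans (by norm_num) h.L_ge
        _ = L * L ^ 4 := by ring
        _ ≤ _ := Nat.mul_le_mul_left _ h5
    have : n ^ (4 * k) ≤ 2 ^ (L * s) :=
      (h.n_pow_le _).trans (Nat.pow_le_pow_right (by norm_num) h3)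
    exact_mod_cast this
  calc _ ≤ 2 ^ (L * s) * 2 ^ (L * s) * (1 / 2 : ℝ) ^ (128 * L * s) := by
        refine mul_le_mul_of_nonneg_right (mul_le_mul h2 h1 ?_ ?_) ?_ <;> positivity
    _ = (1 / 2 : ℝ) ^ (126 * (L * s)) := by
        rw [← pow_add, show 128 * L * s = L * s + L * s + 126 * (L * s) by ring,
          pow_add (1 / 2 : ℝ), ← mul_assoc, ← mul_pow]
        norm_num
    _ ≤ _ := half_pow_le (by
        have : 0 < L * s := by positivity
        omega)

theorem pr_final_le (h : Large n N L k) (Λ : LatinSquare n) {Ω : Type*} [Fintype Ω]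
    (P : Ω → Finset (Fin n) → Finset (Fin n) → Finset (Fin n) → Prop)
    (hP : ∀ C C' S, FinalSet N k Λ C S → C'.card = k →
      pr (fun ω => P ω C C' S) ≤ (1 / 2) ^ (128 * L * S.card)) :
    pr (fun ω => ∃ C C' S, FinalSet N k Λ C S ∧ C'.card = k ∧ P ω C C' S) ≤ 1 / 1000 := by
  have hk := h.k_pos
  have hnp := h.n_pos
  have hn : (0 : ℝ) < n := by exact_mod_cast hnp
  have hcount : (((range (n + 1)) ×ˢ ((powersetCard k (univ : Finset (Fin n))) ×ˢ
      (powersetCard k (univ : Finset (Fin n))))).card : ℝ) ≤ (n : ℝ) ^ (4 * k) := by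
    have h1 : n.choose k ≤ n ^ k := Nat.choose_le_pow n k
    have hn2 : 2 ≤ n := by
      have := h.L_pow_le_n (j := 1) (by norm_num)
      rw [pow_one] at this
      exact le_trans (le_trans (by norm_num) h.L_ge) this
    have hk2 : 2 ≤ k := le_trans (le_trans (by norm_num) h.L_ge) h.L_le_k
    have : (n + 1) * (n.choose k * n.choose k) ≤ n ^ (4 * k) := by
      calc (n + 1) * (n.choose k * n.choose k) ≤ n ^ 2 * (n ^ k * n ^ k) := by
            have : n + 1 ≤ n ^ 2 := by nlinarith
            gcongr
        _ = n ^ (2 * k + 2) := by ring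
        _ ≤ _ := Nat.pow_le_pow_right hnp (by omega)
    simp only [card_product, card_range, card_powersetCard, card_univ, Fintype.card_fin]
    exact_mod_cast this
  calc _ ≤ pr (fun ω => ∃ p ∈ (range (n + 1)) ×ˢ ((powersetCard k (univ : Finset (Fin n))) ×ˢ
      (powersetCard k (univ : Finset (Fin n)))), ∃ S ∈ powersetCard p.1 (univ : Finset (Fin n)),
      FinalSet N k Λ p.2.1 S ∧ P ω p.2.1 p.2.2 S) := by
        refine pr_mono ?_
        rintro ω ⟨C, C', S, hF, hC', hPω⟩
        have hS := card_le_univ S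
        rw [Fintype.card_fin] at hS
        refine ⟨(S.card, C, C'), ?_, S, by simp, hF, hPω⟩
        simp only [mem_product, mem_range, mem_powersetCard, subset_univ, hF.card_eq, hC', and_self,
          and_true]
        omega
    _ ≤ ((range (n + 1)) ×ˢ ((powersetCard k (univ : Finset (Fin n))) ×ˢ
          (powersetCard k (univ : Finset (Fin n))))).card * ((1 / 1000) / (n : ℝ) ^ (4 * k)) := by
        refine pr_exists_le_card_mul _ _ ?_
        rintro ⟨s, C, C'⟩ hp
        simp only [mem_product, mem_range, mem_powersetCard, subset_univ, true_and] at hp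
        by_cases hs : n ≤ 2 ^ 402 * (k * s)
        swap
        · rw [pr_false_of]
          · positivity
          · rintro ω ⟨S, hS, hF, -⟩
            have := hF.le_card
            rw [(mem_powersetCard.1 hS).2] at this
            exact hs this
        rw [le_div_iff₀' (by positivity)]
        refine le_trans (mul_le_mul_of_nonneg_left ?_ (by positivity))
          ((mul_assoc _ _ _).symm.le.trans (final_count_le h hs))
        refine (pr_exists_le_card_mul (b := (1 / 2 : ℝ) ^ (128 * L * s)) _ _ ?_).trans
          (le_of_eq (by rw [card_powersetCard, card_univ, Fintype.card_fin]))
        intro S hS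
        by_cases hF : FinalSet N k Λ C S
        · refine (pr_mono fun ω hω => hω.2).trans ((hP C C' S hF hp.2.2).trans ?_)
          rw [(mem_powersetCard.1 hS).2]
        · rw [pr_false_of fun ω hω => hF hω.1]; positivity
    _ ≤ (n : ℝ) ^ (4 * k) * ((1 / 1000) / (n : ℝ) ^ (4 * k)) :=
        mul_le_mul_of_nonneg_right hcount (by positivity)
    _ = _ := by field_simp

/-- Final neighbourhoods contain their share of columns with label `a`. -/
def FinalLabels (k : ℕ) (Λ : LatinSquare n) (a : ℕ) (l : Fin n → Fin N) : Prop :=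
  ∀ C S, FinalSet N k Λ C S → (Λ.nbr C S).card ≤ 4 * N * (Λ.nbr C S ∩ lab l a).card

theorem pr_not_finalLabels_le (h : Large n N L k) (Λ : LatinSquare n) (a : ℕ) (ha : a < 3) :
    pr (fun l : Fin n → Fin N => ¬ FinalLabels k Λ a l) ≤ 1 / 1000 := by
  have hN : (0 : ℝ) < N := by exact_mod_cast h.N_pos
  refine le_trans (pr_mono ?_) (pr_final_le h Λ (fun (l : Fin n → Fin N) C _ S =>
    4 * N * (Λ.nbr C S ∩ lab l a).card ≤ (Λ.nbr C S).card) ?_)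
  · intro l hl
    unfold FinalLabels at hl
    push Not at hl
    obtain ⟨C, S, hF, hl⟩ := hl
    exact ⟨C, C, S, hF, hF.card_eq, hl.le⟩
  · intro C C' S hF _
    refine (pr_label_lower _ a (by rw [h.N_eq]; exact ha.trans (by norm_num))).trans
      (exp_neg_le_two_pow ?_)
    rw [le_div_iff₀ (by positivity)]
    have : 128 * L * S.card * (4 * N) ≤ (Λ.nbr C S).card := by
      refine le_trans ?_ (hF.nbr_ge h)
      rw [h.N_eq]
      nlinarith [Nat.zero_le (L * S.card)]
    exact_mod_cast this

/-- Final neighbourhoods contain few columns of label `a` in any conflict set. -/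
def FinalConflicts (k : ℕ) (Λ : LatinSquare n) (a : ℕ) (ω : Sample n N) : Prop :=
  ∀ C S J, FinalSet N k Λ C S → IsConflict Λ ω J →
    512 * N * (Λ.nbr C S ∩ (J ∩ lab ω.2 a)).card ≤ (Λ.nbr C S).card

theorem pr_not_finalConflicts_le (h : Large n N L k) (Λ : LatinSquare n) (a : ℕ) (ha : a < 3) :
    pr (fun ω : Sample n N => FairLabels ω.2 ∧ ¬ FinalConflicts k Λ a ω) ≤ 1 / 1000 := by
  have hNp := h.N_pos
  have hN : (0 : ℝ) < N := by exact_mod_cast hNp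
  refine le_trans (pr_mono ?_) (pr_final_le h Λ (fun (ω : Sample n N) C _ S =>
    N * (marked ω.2).card ≤ 6 * n ∧ ∃ J, IsConflict Λ ω J ∧
    (Λ.nbr C S).card / (512 * N) + 1 ≤ (Λ.nbr C S ∩ (J ∩ lab ω.2 a)).card) ?_)
  · rintro ω ⟨hf, hl⟩
    unfold FinalConflicts at hl
    push Not at hl
    obtain ⟨C, S, J, hF, hJ, hl⟩ := hl
    refine ⟨C, C, S, hF, hF.card_eq, hf.card_marked, J, hJ, ?_⟩
    exact Nat.succ_le_of_lt (Nat.lt_of_mul_lt_mul_left (lt_of_le_of_lt (Nat.mul_div_le _ _) hl))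
  · intro C C' S hF _
    set z := (Λ.nbr C S).card with hz
    set j := z / (512 * N) + 1 with hj
    have hj1 : z < 512 * N * j := Nat.lt_mul_div_succ z (show 0 < 512 * N by positivity)
    have hj0 : (0 : ℝ) < j := by exact_mod_cast Nat.succ_pos _
    refine (pr_conflict_many Λ (by rw [h.N_eq]; norm_num) (Λ.nbr C S) a ha h.n_pos j
      (z := z) le_rfl).trans ?_
    calc _ ≤ (1 / 2 : ℝ) ^ j := by
          refine pow_le_pow_left₀ (by positivity) ?_ _
          rw [div_le_div_iff₀ (by positivity) (by norm_num)]
          have h1 : (z : ℝ) ≤ 512 * N * j := by exact_mod_cast hj1.le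
          have h2 : (N : ℝ) = 2 ^ 20 := by exact_mod_cast h.N_eq
          rw [h2] at h1 ⊢
          nlinarith
      _ ≤ _ := by
          apply pow_le_pow_of_le_one (by norm_num) (by norm_num)
          have h1 := hF.nbr_ge h
          rw [← hz] at h1
          rw [h.N_eq] at hj1
          nlinarith

/-- The image of a final labelled neighbourhood reaches more than half of the columns through any
palette, even after deleting a few columns. -/
def FinalSpread (k : ℕ) (Λ : LatinSquare n) (a : ℕ) (ω : Sample n N) : Prop :=
  ∀ C C' S X, FinalSet N k Λ C S → C'.card = k → X ⊆ Λ.nbr C S ∩ lab ω.2 a →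
    64 * X.card ≤ (Λ.nbr C S ∩ lab ω.2 a).card →
    9 * n ≤ 16 * (Λ.nbr C' (((Λ.nbr C S ∩ lab ω.2 a) \ X).image ω.1)).card

theorem pr_small_spread_le (h : Large n N L k) (Λ : LatinSquare n) {C' T G Tb : Finset (Fin n)}
    (hC' : C'.card = k) (hG : Disjoint G Tb) (hGT : G ∪ Tb ⊆ T) (hT : 32 * T.card ≤ n) :
    pr (fun σ : Equiv.Perm (Fin n) => 16 * (Λ.nbr C' (G.image σ)).card ≤ 9 * n ∧
      ∀ y ∈ Tb, σ y ∈ Λ.crowd C' (Λ.nbr C' (G.image σ)) 15 16) ≤ (5 / 8) ^ Tb.card := by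
  have hn : (0 : ℝ) < n := by exact_mod_cast h.n_pos
  have hk := h.k_pos
  have hc : (G ∪ Tb).card = G.card + Tb.card := card_union_of_disjoint hG
  have hle := card_le_card hGT
  refine le_trans (pr_mono ?_) ((perm_pr_le G Tb hG
    (fun σ _ => if 16 * (Λ.nbr C' (G.image σ)).card ≤ 9 * n then
      Λ.crowd C' (Λ.nbr C' (G.image σ)) 15 16 else ∅)
    (b := 3 / 5 * n) (m := 24 / 25 * n) ?_ ?_ (by positivity) (by positivity) ?_).trans
    (le_of_eq ?_))
  · rintro σ ⟨h1, h2⟩ y hy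
    simp only [h1, if_true]
    exact h2 y hy
  · intro σ y _
    split_ifs with h1
    · have h2 := Λ.card_crowd_le (C := C') (V := Λ.nbr C' (G.image σ)) (p := 15) (q := 16)
        (by omega)
      have h3 : (15 * (Λ.crowd C' (Λ.nbr C' (G.image σ)) 15 16).card : ℝ) ≤ 9 * n := by
        exact_mod_cast h2.trans h1
      linarith
    · simp
  · intro σ τ hστ y _
    have : G.image σ = G.image τ := image_congr fun g hg => hστ g hg
    simp only [this]
  · have h1 : (32 * (G.card + Tb.card) : ℝ) ≤ n := by
      have : 32 * (G.card + Tb.card) ≤ n := by omega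
      exact_mod_cast this
    linarith
  · congr 1; field_simp; norm_num

theorem small_pairs_bound {T : Finset (Fin n)} {r : ℕ} (hr : 4 * r ≤ T.card) :
    ((T.powerset.filter fun A => A.card ≤ T.card / 64).card *
      (T.powerset.filter fun A => A.card ≤ T.card / 64).card : ℝ) *
      (5 / 8) ^ (T.card - 2 * (T.card / 64)) ≤ (1 / 2) ^ r := by
  have h1 := card_small_subsets_le T le_rfl (Nat.mul_div_le T.card 64)
  set a : ℝ := ((T.powerset.filter fun A => A.card ≤ T.card / 64).card : ℝ)
  set t := T.card
  have ha : 0 ≤ a := Nat.cast_nonneg _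
  refine le_of_pow_le_pow_left₀ (n := 8) (by norm_num) (by positivity) ?_
  calc (a * a * (5 / 8) ^ (t - 2 * (t / 64))) ^ 8
      = a ^ 8 * a ^ 8 * (5 / 8) ^ ((t - 2 * (t / 64)) * 8) := by
        rw [mul_pow, mul_pow, ← pow_mul]
    _ ≤ 2 ^ t * 2 ^ t * (5 / 8) ^ (7 * t) := by
        refine mul_le_mul (mul_le_mul h1 h1 (by positivity) (by positivity)) ?_ (by positivity)
          (by positivity)
        exact pow_le_pow_of_le_one (by norm_num) (by norm_num) (by omega)
    _ = (2 * 2 * (5 / 8) ^ 7) ^ t := by rw [mul_pow, mul_pow, pow_mul]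
    _ ≤ ((1 / 2) ^ 2) ^ t := pow_le_pow_left₀ (by positivity) (by norm_num) _
    _ = (1 / 2) ^ (2 * t) := by rw [← pow_mul]
    _ ≤ (1 / 2) ^ (r * 8) := pow_le_pow_of_le_one (by norm_num) (by norm_num) (by omega)
    _ = _ := by rw [pow_mul]

theorem exists_crowded_subset (Λ : LatinSquare n) (σ : Equiv.Perm (Fin n)) (C' T : Finset (Fin n)) :
    ∃ G ⊆ T, G.card * C'.card ≤ 16 * (Λ.nbr C' (G.image σ)).card ∧
      ∀ y ∈ T \ G, σ y ∈ Λ.crowd C' (Λ.nbr C' (G.image σ)) 15 16 := by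
  obtain ⟨G, hG, hmax⟩ := exists_max_image
    (T.powerset.filter fun G => G.card * C'.card ≤ 16 * (Λ.nbr C' (G.image σ)).card) card
    ⟨∅, by simp⟩
  simp only [mem_filter, mem_powerset] at hG hmax
  refine ⟨G, hG.1, hG.2, fun y hy => Λ.mem_crowd.2 ?_⟩
  rw [mem_sdiff] at hy
  have hnot : ¬ (insert y G).card * C'.card ≤ 16 * (Λ.nbr C' ((insert y G).image σ)).card := by
    intro hh
    have := hmax (insert y G) ⟨insert_subset hy.1 hG.1, hh⟩
    rw [card_insert_of_notMem hy.2] at this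
    omega
  have hins : Λ.nbr C' ((insert y G).image σ) = C'.image (Λ.col (σ y)) ∪ Λ.nbr C' (G.image σ) := by
    ext w
    simp only [Λ.mem_nbr, mem_union, image_insert, mem_insert, exists_eq_or_imp]
    simp only [mem_image]
  have hCc : (C'.image (Λ.col (σ y))).card = C'.card :=
    card_image_of_injective _ fun c c' hcc => Λ.col_inj_right hcc
  have hinter : (C'.image (Λ.col (σ y)) ∩ Λ.nbr C' (G.image σ)).card ≤
      (C'.filter fun c => Λ.col (σ y) c ∈ Λ.nbr C' (G.image σ)).card := by
    rw [← filter_mem_eq_inter, filter_image]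
    exact card_image_le
  have hu := card_union_add_card_inter (C'.image (Λ.col (σ y))) (Λ.nbr C' (G.image σ))
  rw [← hins, hCc] at hu
  rw [card_insert_of_notMem hy.2] at hnot
  have hGk := hG.2
  push Not at hnot
  nlinarith

theorem pr_not_finalSpread_le (h : Large n N L k) (Λ : LatinSquare n) (a : ℕ) :
    pr (fun ω : Sample n N => FinalLabels k Λ a ω.2 ∧ ¬ FinalSpread k Λ a ω) ≤ 1 / 1000 := by
  have hk := h.k_pos
  refine pr_prod_le' _ (by norm_num) fun l => ?_
  by_cases hl : FinalLabels k Λ a l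
  swap
  · rw [pr_false_of fun σ hσ => hl hσ.1]; norm_num
  refine le_trans (pr_mono ?_) (pr_final_le h Λ (fun (σ : Equiv.Perm (Fin n)) C C' S =>
    ∃ p ∈ ((Λ.nbr C S ∩ lab l a).powerset.filter fun A => A.card ≤ (Λ.nbr C S ∩ lab l a).card / 64)
      ×ˢ ((Λ.nbr C S ∩ lab l a).powerset.filter fun A =>
        A.card ≤ (Λ.nbr C S ∩ lab l a).card / 64),
      16 * (Λ.nbr C' (p.1.image σ)).card ≤ 9 * n ∧
      ∀ y ∈ ((Λ.nbr C S ∩ lab l a) \ p.2) \ p.1,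
        σ y ∈ Λ.crowd C' (Λ.nbr C' (p.1.image σ)) 15 16) ?_)
  · rintro σ ⟨-, hσ⟩
    unfold FinalSpread at hσ
    push Not at hσ
    obtain ⟨C, C', S, X, hF, hC', hX, hXc, hlt⟩ := hσ
    simp only at hX hXc hlt
    refine ⟨C, C', S, hF, hC', ?_⟩
    set T := Λ.nbr C S ∩ lab l a with hT
    obtain ⟨G, hG, hGc, hGy⟩ := exists_crowded_subset Λ σ C' (T \ X)
    have hnb : (Λ.nbr C' (G.image σ)).card ≤ (Λ.nbr C' ((T \ X).image σ)).card :=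
      card_le_card (Λ.nbr_mono (image_subset_image hG))
    have hGn : 16 * (Λ.nbr C' (G.image σ)).card ≤ 9 * n := by omega
    refine ⟨(G, X), ?_, hGn, hGy⟩
    simp only [mem_product, mem_filter, mem_powerset]
    refine ⟨⟨hG.trans sdiff_subset, ?_⟩, hX, (Nat.le_div_iff_mul_le (by norm_num)).2 (by omega)⟩
    rw [Nat.le_div_iff_mul_le (by norm_num)]
    have h1 := (hF.nbr_ge h).trans (hl C S hF)
    rw [← hT] at h1
    have h2 : L * S.card ≤ T.card := by
      rw [h.N_eq] at h1
      have : 2 ^ 37 * (L * S.card) ≤ 2 ^ 37 * T.card := h1.trans (by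
        refine Nat.mul_le_mul_right _ (by norm_num))
      exact Nat.le_of_mul_le_mul_left this (by norm_num)
    have h3 : 576 * n ≤ k * T.card := by
      calc 576 * n ≤ 2 ^ 10 * (2 ^ 402 * (k * S.card)) :=
            Nat.mul_le_mul (by norm_num) hF.le_card
        _ = 2 ^ 412 * (k * S.card) := by rw [← mul_assoc, ← pow_add]
        _ ≤ L * (k * S.card) := Nat.mul_le_mul_right _ (le_trans
            (Nat.pow_le_pow_right (by norm_num) (by norm_num)) h.L_ge_pow)
        _ = k * (L * S.card) := by ring
        _ ≤ _ := Nat.mul_le_mul_left _ h2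
    rw [hC'] at hGc
    have h4 : k * (G.card * 64) ≤ k * T.card := by
      calc k * (G.card * 64) = 64 * (G.card * k) := by ring
        _ ≤ 576 * n := by omega
        _ ≤ _ := h3
    exact Nat.le_of_mul_le_mul_left h4 hk
  · intro C C' S hF hC'
    set T := Λ.nbr C S ∩ lab l a with hT
    have h1 := (hF.nbr_ge h).trans (hl C S hF)
    rw [← hT, h.N_eq] at h1
    have hTn : 32 * T.card ≤ n := by
      have h2 : T.card ≤ k * S.card := by
        calc T.card ≤ (Λ.nbr C S).card := card_le_card inter_subset_left
          _ ≤ S.card * C.card := Λ.card_nbr_le _ _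
          _ = _ := by rw [hF.card_eq, mul_comm]
      refine le_trans (Nat.mul_le_mul ?_ h2) hF.card_le
      calc 32 = 2 ^ 5 := by norm_num
        _ ≤ _ := Nat.pow_le_pow_right (by norm_num) (by norm_num)
    refine (pr_exists_le_card_mul (b := (5 / 8 : ℝ) ^ (T.card - 2 * (T.card / 64))) _ _ ?_).trans ?_
    · rintro ⟨G, X⟩ hp
      simp only [mem_product, mem_filter, mem_powerset] at hp
      refine (pr_small_spread_le h Λ (T := T) hC' disjoint_sdiff
        (union_subset hp.1.1 (sdiff_subset.trans sdiff_subset)) hTn).trans ?_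
      refine pow_le_pow_of_le_one (by norm_num) (by norm_num) ?_
      have e1 := le_card_sdiff G (T \ X)
      have e2 := le_card_sdiff X T
      have e3 : T.card - 2 * (T.card / 64) ≤ ((T \ X) \ G).card := by omega
      exact e3
    · rw [card_product, Nat.cast_mul]
      refine small_pairs_bound ?_
      rw [mul_assoc 128]
      generalize L * S.card = m at h1 ⊢
      norm_num at h1
      omega

end Typical

section Typical

variable {n N L k : ℕ}

/-- Outside a conflict set, a class of columns has all the expansion properties needed to move a
free row along the diagonal of `σ`. -/
structure Side (N L k : ℕ) (Λ : LatinSquare n) (σ : Equiv.Perm (Fin n)) (l : Fin n → Fin N) (a : ℕ)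
    (J : Finset (Fin n)) : Prop where
  poor_row : ∀ B : Finset (Fin n), B.card = k → 2 ^ (100 * L) * (univ.filter fun u =>
    8 * N * (B.filter fun b => Λ.col u b ∈ lab l a \ J).card < k).card ≤ n
  poor_sym : ∀ B : Finset (Fin n), B.card = k → 2 ^ (100 * L) * (univ.filter fun u =>
    8 * N * (B.filter fun b => Λ.col b u ∈ lab l a \ J).card < k).card ≤ n
  collisions : FewCollisions L Λ σ
  expansive : Expansive L k N Λ σ
  finalLabels : FinalLabels k Λ a l
  finalConflicts : ∀ C S, FinalSet N k Λ C S →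
    512 * N * (Λ.nbr C S ∩ (J ∩ lab l a)).card ≤ (Λ.nbr C S).card
  finalSpread : FinalSpread k Λ a (σ, l)

/-- A sample for which the columns of class `a` expand outside every conflict set. -/
structure TypicalSample (L k : ℕ) (Λ : LatinSquare n) (a : ℕ) (ω : Sample n N) : Prop where
  fair : FairLabels ω.2
  unlabelled_row : FewUnlabelled L k (fun u b => Λ.col u b) a ω.2
  unlabelled_sym : FewUnlabelled L k (fun u b => Λ.col b u) a ω.2
  conflicted_row : FewConflicted L k (fun u b => Λ.col u b) a Λ ω
  conflicted_sym : FewConflicted L k (fun u b => Λ.col b u) a Λ ω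
  collisions : FewCollisions L Λ ω.1
  expansive : Expansive L k N Λ ω.1
  finalLabels : FinalLabels k Λ a ω.2
  finalConflicts : FinalConflicts k Λ a ω
  finalSpread : FinalSpread k Λ a ω

theorem pr_snd_le {n N : ℕ} (E : (Fin n → Fin N) → Prop) {b : ℝ} (h : pr E ≤ b) :
    pr (fun ω : Sample n N => E ω.2) ≤ b := by
  rw [pr_snd]
  exact h

theorem pr_fst_le {n N : ℕ} (E : Equiv.Perm (Fin n) → Prop) {b : ℝ} (hb : 0 ≤ b) (h : pr E ≤ b) :
    pr (fun ω : Sample n N => E ω.1) ≤ b :=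
  pr_prod_le' _ hb fun _ => h

theorem pr_not_typicalSample_le (h : Large n N L k) (Λ : LatinSquare n) {a : ℕ} (ha : a < 3) :
    pr (fun ω : Sample n N => ¬ TypicalSample L k Λ a ω) ≤ 1 / 10 := by
  have f1 : ∀ b, Function.Injective fun u => Λ.col u b := fun b u v huv => Λ.col_inj_left huv
  have f2 : ∀ u, Function.Injective fun b => Λ.col u b := fun u b c hbc => Λ.col_inj_right hbc
  have e0 := pr_snd_le _ (pr_not_fair_le h)
  have e1 := pr_snd_le _ (pr_not_fewUnlabelled_le h (fun u b => Λ.col u b) f1 f2 a ha)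
  have e2 := pr_snd_le _ (pr_not_fewUnlabelled_le h (fun u b => Λ.col b u) f2 f1 a ha)
  have e3 := pr_not_fewConflicted_le h (fun u b => Λ.col u b) f1 f2 a ha Λ
  have e4 := pr_not_fewConflicted_le h (fun u b => Λ.col b u) f2 f1 a ha Λ
  have e5 := pr_fst_le (N := N) _ (by norm_num) (pr_not_fewCollisions_le h Λ)
  have e6 := pr_fst_le (N := N) _ (by norm_num) (pr_not_expansive_le h Λ)
  have e7 := pr_snd_le _ (pr_not_finalLabels_le h Λ a ha)
  have e8 := pr_not_finalConflicts_le h Λ a ha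
  have e9 := pr_not_finalSpread_le h Λ a
  have o1 := pr_or_le (Ω := Sample n N) _ _ |>.trans (add_le_add e0 e1)
  have o2 := pr_or_le (Ω := Sample n N) _ _ |>.trans (add_le_add e2 e3)
  have o3 := pr_or_le (Ω := Sample n N) _ _ |>.trans (add_le_add e4 e5)
  have o4 := pr_or_le (Ω := Sample n N) _ _ |>.trans (add_le_add e6 e7)
  have o5 := pr_or_le (Ω := Sample n N) _ _ |>.trans (add_le_add e8 e9)
  have o6 := pr_or_le (Ω := Sample n N) _ _ |>.trans (add_le_add o1 o2)
  have o7 := pr_or_le (Ω := Sample n N) _ _ |>.trans (add_le_add o3 o4)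
  have o8 := pr_or_le (Ω := Sample n N) _ _ |>.trans (add_le_add o6 o7)
  have o9 := pr_or_le (Ω := Sample n N) _ _ |>.trans (add_le_add o8 o5)
  refine (pr_mono fun ω hω => ?_).trans (o9.trans (by norm_num))
  by_contra hc
  simp only [not_or, not_and_or, not_not] at hc
  obtain ⟨⟨⟨⟨g0, g1⟩, ⟨g2, g3⟩⟩, ⟨g4, g5⟩, ⟨g6, g7⟩⟩, g8, g9⟩ := hc
  exact hω ⟨g0, g1, g2, g3.resolve_left (not_not.2 g0), g4.resolve_left (not_not.2 g0), g5, g6, g7,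
    g8.resolve_left (not_not.2 g0), g9.resolve_left (not_not.2 g7)⟩

theorem card_poor_le {f : Fin n → Fin n → Fin n} {a : ℕ} {Λ : LatinSquare n} {ω : Sample n N}
    (h1 : FewUnlabelled L k f a ω.2) (h2 : FewConflicted L k f a Λ ω) {J : Finset (Fin n)}
    (hJ : IsConflict Λ ω J) {B : Finset (Fin n)} (hB : B.card = k) :
    2 ^ (100 * L) * (univ.filter fun u =>
      8 * N * (B.filter fun b => f u b ∈ lab ω.2 a \ J).card < k).card ≤ n := by
  have g1 := h1 B (univ.filter fun u => 4 * N * (B.filter fun b => f u b ∈ lab ω.2 a).card ≤ k) hB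
    (fun u hu => (mem_filter.1 hu).2)
  have g2 := h2 J B (univ.filter fun u => k ≤ 8 * N *
    (B.filter fun b => f u b ∈ J ∩ lab ω.2 a).card) hJ hB (fun u hu => (mem_filter.1 hu).2)
  have hsub : (univ.filter fun u =>
      8 * N * (B.filter fun b => f u b ∈ lab ω.2 a \ J).card < k) ⊆
      (univ.filter fun u => 4 * N * (B.filter fun b => f u b ∈ lab ω.2 a).card ≤ k) ∪
      (univ.filter fun u => k ≤ 8 * N * (B.filter fun b => f u b ∈ J ∩ lab ω.2 a).card) := by
    intro u hu
    simp only [mem_union, mem_filter, mem_univ, true_and] at hu ⊢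
    by_contra hc
    push Not at hc
    have h3 : (B.filter fun b => f u b ∈ lab ω.2 a).card ≤
        (B.filter fun b => f u b ∈ lab ω.2 a \ J).card +
        (B.filter fun b => f u b ∈ J ∩ lab ω.2 a).card := by
      refine le_trans (card_le_card fun b hb => ?_) (card_union_le _ _)
      simp only [mem_union, mem_filter, mem_sdiff, mem_inter] at hb ⊢
      tauto
    have h4 := Nat.mul_le_mul_left (8 * N) h3
    nlinarith [hc.1, hc.2]
  have h3 := Nat.mul_le_mul_left (2 ^ (100 * L)) ((card_le_card hsub).trans (card_union_le _ _))
  rw [mul_add] at h3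
  rw [mul_assoc] at g1 g2
  omega

theorem TypicalSample.side {Λ : LatinSquare n} {a : ℕ} {ω : Sample n N}
    (h : TypicalSample L k Λ a ω) {J : Finset (Fin n)} (hJ : IsConflict Λ ω J) :
    Side N L k Λ ω.1 ω.2 a J where
  poor_row _ hB := card_poor_le h.unlabelled_row h.conflicted_row hJ hB
  poor_sym _ hB := card_poor_le h.unlabelled_sym h.conflicted_sym hJ hB
  collisions := h.collisions
  expansive := h.expansive
  finalLabels := h.finalLabels
  finalConflicts C S hF := h.finalConflicts C S J hF hJ
  finalSpread := h.finalSpread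

/-- The sample seen after exchanging rows and columns. -/
def flip (ω : Sample n N) : Sample n N := (ω.1⁻¹, fun x => ω.2 (ω.1⁻¹ x))

theorem flip_involutive : Function.Involutive (flip (n := n) (N := N)) := by
  rintro ⟨σ, l⟩
  simp [flip]

theorem pr_flip_le {P : Sample n N → Prop} {b : ℝ} (h : pr P ≤ b) :
    pr (fun ω => P (flip ω)) ≤ b :=
  (pr_comp_equiv (flip_involutive (n := n) (N := N)).toPerm P).le.trans h

theorem mem_lab_flip {ω : Sample n N} {a : ℕ} {x : Fin n} :
    x ∈ lab (flip ω).2 a ↔ ω.1⁻¹ x ∈ lab ω.2 a := by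
  simp only [mem_lab, flip]

theorem IsConflict.flip {Λ : LatinSquare n} {ω : Sample n N} {J : Finset (Fin n)}
    (hJ : IsConflict Λ ω J) : IsConflict Λ.transpose (flip ω) (J.image ω.1) := by
  intro x hx
  obtain ⟨y, hy, rfl⟩ := mem_image.1 hx
  obtain ⟨y', hy', he⟩ := hJ y hy
  rw [mem_sdiff, mem_marked] at hy'
  refine ⟨ω.1 y', ?_, ?_⟩
  · rw [mem_sdiff, mem_marked]
    simp [RainbowLatin.flip, hy']
  · simpa [hue, RainbowLatin.flip] using he

theorem exists_typical (h : Large n N L k) (Λ : LatinSquare n) :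
    ∃ ω : Sample n N, FairLabels ω.2 ∧ Balanced Λ ω.2 ∧ Balanced Λ.transpose (flip ω).2 ∧
      FewConflicts Λ ω ∧ RepairSparse Λ ω ∧ ∀ J, IsConflict Λ ω J →
        Side N L k Λ ω.1 ω.2 0 J ∧
        Side N L k Λ.transpose (flip ω).1 (flip ω).2 1 (J.image ω.1) := by
  have hN : 3 ≤ N := by rw [h.N_eq]; norm_num
  have e0 := pr_not_typicalSample_le h Λ (show 0 < 3 by norm_num)
  have e1 : pr (fun ω : Sample n N => ¬ TypicalSample L k Λ.transpose 1 (flip ω)) ≤ 1 / 10 :=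
    pr_flip_le (P := fun ω : Sample n N => ¬ TypicalSample L k Λ.transpose 1 ω)
      (pr_not_typicalSample_le h Λ.transpose (by norm_num))
  have e2 := pr_snd_le _ (pr_not_balanced_le Λ hN h.n_pos)
  have e3 : pr (fun ω : Sample n N => ¬ Balanced Λ.transpose (flip ω).2) ≤ 1 / 10 :=
    pr_flip_le (P := fun ω : Sample n N => ¬ Balanced Λ.transpose ω.2)
      (pr_snd_le (fun l => ¬ Balanced Λ.transpose l)
        (pr_not_balanced_le Λ.transpose hN h.n_pos))
  have e4 := pr_not_fewConflicts_le h Λ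
  have e5 := pr_not_repairSparse_le h Λ
  have o1 := pr_or_le (Ω := Sample n N) _ _ |>.trans (add_le_add e0 e1)
  have o2 := pr_or_le (Ω := Sample n N) _ _ |>.trans (add_le_add e2 e3)
  have o3 := pr_or_le (Ω := Sample n N) _ _ |>.trans (add_le_add e4 e5)
  have o4 := pr_or_le (Ω := Sample n N) _ _ |>.trans (add_le_add o1 o2)
  have o5 := pr_or_le (Ω := Sample n N) _ _ |>.trans (add_le_add o4 o3)
  have : Nonempty (Fin N) := ⟨⟨0, h.N_pos⟩⟩
  obtain ⟨ω, hω⟩ := exists_not_of_pr_lt_one (o5.trans_lt (by norm_num))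
  simp only [not_or, not_and_or, not_not] at hω
  obtain ⟨⟨⟨g0, g1⟩, g2, g3⟩, g4, g5⟩ := hω
  exact ⟨ω, g0.fair, g2, g3, g4.resolve_left (not_not.2 g0.fair),
    g5.resolve_left (not_not.2 g0.fair), fun J hJ => ⟨g0.side hJ, g1.side hJ.flip⟩⟩

end Typical

section Expand

variable {n N L k : ℕ}

/-- The rows from which the columns of `F`, followed by `σ`, can be pursued for `j` rounds with many
choices of a symbol of `C` in each round. -/
noncomputable def survivors (N k : ℕ) (Λ : LatinSquare n) (σ : Equiv.Perm (Fin n))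
    (C F : Finset (Fin n)) : ℕ → Finset (Fin n)
  | 0 => univ
  | j + 1 => univ.filter fun z => k ≤ 16 * N *
      (C.filter fun c => Λ.col z c ∈ F ∧ σ (Λ.col z c) ∈ survivors N k Λ σ C F j).card

theorem card_compl_survivors_le (h : Large n N L k) {Λ : LatinSquare n} {σ : Equiv.Perm (Fin n)}
    {C F W : Finset (Fin n)} (hC : C.card = k)
    (hF : 2 ^ (100 * L) * (univ.filter fun u =>
      8 * N * (C.filter fun b => Λ.col u b ∈ F).card < k).card ≤ n)
    (hW : 2 ^ (100 * L) * W.card ≤ n) (j : ℕ) :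
    2 ^ (100 * L) * (univ \ survivors N k Λ σ C (F \ W) j).card ≤ n * 2 ^ (26 * j) := by
  induction j with
  | zero => simp [survivors]
  | succ j ih =>
    set G := survivors N k Λ σ C (F \ W) j with hG
    set V := W ∪ (univ \ G).image σ.symm with hV
    have hVc : V.card ≤ W.card + (univ \ G).card :=
      (card_union_le _ _).trans (Nat.add_le_add_left card_image_le _)
    have hk := h.k_pos
    have hcr := Λ.card_crowd_le (C := C) (V := V) (p := 1) (q := 16 * N) (by omega)
    have hsub : univ \ survivors N k Λ σ C (F \ W) (j + 1) ⊆ (univ.filter fun u =>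
        8 * N * (C.filter fun b => Λ.col u b ∈ F).card < k) ∪ Λ.crowd C V 1 (16 * N) := by
      intro z hz
      simp only [survivors, mem_sdiff, mem_univ, true_and, mem_filter, not_le, mem_union,
        Λ.mem_crowd] at hz ⊢
      by_contra hc
      push Not at hc
      have h1 : (C.filter fun b => Λ.col z b ∈ F).card ≤ (C.filter fun c => Λ.col z c ∈ F \ W ∧
          σ (Λ.col z c) ∈ G).card + (C.filter fun c => Λ.col z c ∈ V).card := by
        refine le_trans (card_le_card fun c hc => ?_) (card_union_le _ _)
        simp only [hV, mem_union, mem_filter, mem_sdiff, mem_image, mem_univ, true_and] at hc ⊢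
        by_cases h2 : Λ.col z c ∈ W
        · tauto
        · by_cases h3 : σ (Λ.col z c) ∈ G
          · tauto
          · exact Or.inr ⟨hc.1, Or.inr ⟨_, h3, σ.symm_apply_apply _⟩⟩
      have h2 := Nat.mul_le_mul_left (16 * N) h1
      have h3 := hc.1
      have h4 := hc.2
      simp only [mem_sdiff] at h2
      rw [hC] at h4
      nlinarith
    have h1 := (card_le_card hsub).trans (card_union_le _ _)
    have h2 : 2 ^ (100 * L) * (Λ.crowd C V 1 (16 * N)).card ≤
        2 ^ 24 * (n + n * 2 ^ (26 * j)) := by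
      rw [h.N_eq] at hcr ⊢
      calc _ ≤ 2 ^ (100 * L) * (2 ^ 24 * (W.card + (univ \ G).card)) := by
            refine Nat.mul_le_mul_left _ ?_
            omega
        _ = 2 ^ 24 * (2 ^ (100 * L) * W.card + 2 ^ (100 * L) * (univ \ G).card) := by ring
        _ ≤ _ := Nat.mul_le_mul_left _ (Nat.add_le_add hW ih)
    have h3 : n ≤ n * 2 ^ (26 * j) := Nat.le_mul_of_pos_right _ (by positivity)
    calc _ ≤ 2 ^ (100 * L) * ((univ.filter fun u =>
          8 * N * (C.filter fun b => Λ.col u b ∈ F).card < k).card +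
          (Λ.crowd C V 1 (16 * N)).card) := Nat.mul_le_mul_left _ h1
      _ ≤ n + 2 ^ 24 * (n + n * 2 ^ (26 * j)) := by rw [mul_add]; exact Nat.add_le_add hF h2
      _ ≤ 2 ^ 26 * (n * 2 ^ (26 * j)) := by omega
      _ = _ := by rw [mul_add 26, pow_add]; ring

/-- The rows from which two different steps in `C` lead, after one more step in `C`, to the same
column. -/
noncomputable def collidingRows (Λ : LatinSquare n) (σ : Equiv.Perm (Fin n)) (C : Finset (Fin n)) :
    Finset (Fin n) :=
  univ.filter fun z => ∃ c₁ ∈ C, ∃ c₂ ∈ C, ∃ c ∈ C, ∃ c' ∈ C, c₁ ≠ c₂ ∧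
    Λ.col (σ (Λ.col z c₁)) c = Λ.col (σ (Λ.col z c₂)) c'

theorem card_collidingRows_le {Λ : LatinSquare n} {σ : Equiv.Perm (Fin n)}
    (hσ : FewCollisions L Λ σ) (C : Finset (Fin n)) :
    (collidingRows Λ σ C).card ≤ C.card ^ 4 * (60 * L ^ 2) := by
  have hsub : collidingRows Λ σ C ⊆ (((C ×ˢ C) ×ˢ (C ×ˢ C)).filter fun p => p.1.1 ≠ p.1.2).biUnion
      fun p => univ.filter fun z =>
        Λ.col (σ (Λ.col z p.1.1)) p.2.1 = Λ.col (σ (Λ.col z p.1.2)) p.2.2 := by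
    intro z hz
    obtain ⟨c₁, h1, c₂, h2, c, h3, c', h4, hne, he⟩ := (mem_filter.1 hz).2
    simp only [mem_biUnion, mem_filter, mem_product, mem_univ, true_and]
    exact ⟨((c₁, c₂), (c, c')), ⟨⟨⟨h1, h2⟩, h3, h4⟩, hne⟩, he⟩
  refine (card_le_card hsub).trans ((card_biUnion_le_card_mul _ _ (60 * L ^ 2) ?_).trans ?_)
  · intro p hp
    exact hσ _ _ _ _ (mem_filter.1 hp).2
  · refine Nat.mul_le_mul_right _ ((card_filter_le _ _).trans (le_of_eq ?_))
    simp only [card_product]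
    ring

/-- Sets `A i` of rows reachable in `i` rounds: from a row of `A i`, a step in a symbol of `C`
outside a short list to a column of `F` outside a short list, followed by `σ`, leads to `A (i+1)`. -/
structure Trails (L : ℕ) (Λ : LatinSquare n) (σ : Equiv.Perm (Fin n)) (C F V : Finset (Fin n))
    (A : ℕ → Finset (Fin n)) (U : ℕ → Fin n → Finset (Fin n)) : Prop where
  card_V : V.card ≤ 4 * L
  card_U : ∀ i ≤ L + 3, ∀ z ∈ A i, (U i z).card ≤ 4 * L
  step : ∀ i ≤ L + 3, ∀ z ∈ A i, ∀ c ∈ C, c ∉ U i z → Λ.col z c ∈ F → Λ.col z c ∉ V →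
    σ (Λ.col z c) ∈ A (i + 1)

namespace Trails

variable {Λ : LatinSquare n} {σ : Equiv.Perm (Fin n)} {C F V : Finset (Fin n)}
  {A : ℕ → Finset (Fin n)} {U : ℕ → Fin n → Finset (Fin n)}

theorem exists_steps (h : Large n N L k) (hT : Trails L Λ σ C F V A U) {i j : ℕ} (hi : i ≤ L + 3)
    {z : Fin n} (hz : z ∈ A i) (hzj : z ∈ survivors N k Λ σ C F (j + 1)) :
    ∃ R ⊆ C, 2 ^ 39 * L ≤ R.card ∧ ∀ c ∈ R, σ (Λ.col z c) ∈ A (i + 1) ∧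
      σ (Λ.col z c) ∈ survivors N k Λ σ C F j := by
  set Q := C.filter fun c => Λ.col z c ∈ F ∧ σ (Λ.col z c) ∈ survivors N k Λ σ C F j with hQ
  have h1 : k ≤ 16 * N * Q.card := (mem_filter.1 hzj).2
  have h2 : (Q.filter fun c => Λ.col z c ∈ V).card ≤ 4 * L := by
    refine le_trans ?_ hT.card_V
    refine card_le_card_of_injOn (Λ.col z) (fun c hc => (mem_filter.1 hc).2) ?_
    exact fun c _ c' _ hcc => Λ.col_inj_right hcc
  have h3 := hT.card_U i hi z hz
  refine ⟨(Q \ U i z) \ Q.filter fun c => Λ.col z c ∈ V, ?_, ?_, ?_⟩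
  · exact sdiff_subset.trans (sdiff_subset.trans (filter_subset _ _))
  · have h4 := le_card_sdiff (U i z) Q
    have h5 := le_card_sdiff (Q.filter fun c => Λ.col z c ∈ V) (Q \ U i z)
    rw [h.N_eq, h.k_eq] at h1
    have := h.L_pos
    omega
  · intro c hc
    simp only [hQ, mem_sdiff, mem_filter, not_and] at hc
    exact ⟨hT.step i hi z hz c hc.1.1.1 hc.1.2 hc.1.1.2.1 (hc.2 hc.1.1), hc.1.1.2.2⟩

theorem exists_grow (h : Large n N L k) (hT : Trails L Λ σ C F V A U) (hC : C.card = k)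
    (hσ : Expansive L k N Λ σ) {i j : ℕ} (hi : i ≤ L + 3) {S T : Finset (Fin n)}
    (hTS : T ⊆ Λ.nbr C S) (hLS : L * S.card ≤ T.card) (hkT : 200 * k ≤ T.card)
    (hTn : 2 ^ 400 * (k * T.card) ≤ n)
    (hTA : ∀ y ∈ T, σ y ∈ A i ∧ σ y ∈ survivors N k Λ σ C F (j + 1)) :
    ∃ T' ⊆ Λ.nbr C (T.image σ), T'.card = T.card * L ∧
      ∀ y ∈ T', σ y ∈ A (i + 1) ∧ σ y ∈ survivors N k Λ σ C F j := by
  have hex : ∀ y, ∃ R : Finset (Fin n), y ∈ T → R ⊆ C ∧ 2 ^ 39 * L ≤ R.card ∧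
      ∀ c ∈ R, σ (Λ.col (σ y) c) ∈ A (i + 1) ∧
        σ (Λ.col (σ y) c) ∈ survivors N k Λ σ C F j := by
    intro y
    by_cases hy : y ∈ T
    · obtain ⟨R, hR⟩ := hT.exists_steps h hi (hTA y hy).1 (hTA y hy).2
      exact ⟨R, fun _ => hR⟩
    · exact ⟨∅, fun h => absurd h hy⟩
  choose R hR using hex
  have h1 := hσ.card_biUnion_ge hC hC hTS hLS hkT hTn R (fun y hy => (hR y hy).1) (by
    intro y hy
    have := (hR y hy).2.1
    rw [h.k_eq, h.N_eq]
    omega)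
  obtain ⟨T', hT', hc⟩ := exists_subset_card_eq (s := T.biUnion fun y => (R y).image (Λ.col (σ y)))
    (n := T.card * L) (by
      rw [h.k_eq, h.N_eq] at h1
      have e : T.card * (2 ^ 64 * L) = 2 ^ 64 * (T.card * L) := by ring
      rw [e] at h1
      omega)
  refine ⟨T', ?_, hc, ?_⟩
  · intro w hw
    obtain ⟨y, hy, hw⟩ := mem_biUnion.1 (hT' hw)
    obtain ⟨c, hc, rfl⟩ := mem_image.1 hw
    exact Λ.mem_nbr.2 ⟨σ y, mem_image_of_mem _ hy, c, (hR y hy).1 hc, rfl⟩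
  · intro w hw
    obtain ⟨y, hy, hw⟩ := mem_biUnion.1 (hT' hw)
    obtain ⟨c, hc, rfl⟩ := mem_image.1 hw
    exact (hR y hy).2.2 c hc

theorem exists_grow_many (h : Large n N L k) (hT : Trails L Λ σ C F V A U) (hC : C.card = k)
    (hσ : Expansive L k N Λ σ) {j : ℕ} (r : ℕ) : ∀ {i : ℕ}, i + r ≤ L + 3 →
    ∀ {S T : Finset (Fin n)},
    T ⊆ Λ.nbr C S → L * S.card ≤ T.card → 200 * k ≤ T.card →
    2 ^ 400 * (k * (T.card * L ^ r)) ≤ n →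
    (∀ y ∈ T, σ y ∈ A i ∧ σ y ∈ survivors N k Λ σ C F (j + r)) →
    ∃ S' T', T' ⊆ Λ.nbr C S' ∧ L * S'.card ≤ T'.card ∧ T'.card = T.card * L ^ r ∧
      ∀ y ∈ T', σ y ∈ A (i + r) := by
  induction r with
  | zero =>
    intro i _ S T h1 h2 _ _ h5
    exact ⟨S, T, h1, h2, by simp, fun y hy => (h5 y hy).1⟩
  | succ r ih =>
    intro i hi S T h1 h2 h3 h4 h5
    have hL := h.L_pos
    obtain ⟨T', hT', hc, hA⟩ := hT.exists_grow h hC hσ (i := i) (j := j + r) (by omega) h1 h2 h3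
      (le_trans (Nat.mul_le_mul_left _ (Nat.mul_le_mul_left _
        (Nat.le_mul_of_pos_right _ (by positivity)))) h4) h5
    have hI : (T.image σ).card = T.card := card_image_of_injective _ σ.injective
    obtain ⟨S₁, T₁, g1, g2, g3, g4⟩ := ih (i := i + 1) (by omega) hT' (by rw [hI, hc, mul_comm])
      (by rw [hc]; nlinarith) (by rw [hc, mul_assoc T.card, ← pow_succ']; exact h4) hA
    refine ⟨S₁, T₁, g1, g2, by rw [g3, hc, pow_succ']; ring, fun y hy => ?_⟩
    have := g4 y hy
    rwa [add_right_comm, add_assoc] at this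

theorem exists_start (h : Large n N L k) (hT : Trails L Λ σ C F V A U) {z : Fin n} (hz : z ∈ A 0)
    {j : ℕ} (hzj : z ∈ survivors N k Λ σ C F (j + 2)) (hzc : z ∉ collidingRows Λ σ C) {t : ℕ}
    (ht : 200 * k ≤ t) (ht' : t ≤ 200 * k * L) :
    ∃ S T, T ⊆ Λ.nbr C S ∧ L * S.card ≤ T.card ∧ T.card = t ∧
      ∀ y ∈ T, σ y ∈ A 2 ∧ σ y ∈ survivors N k Λ σ C F j := by
  have hL := h.L_pos
  obtain ⟨R, hRC, hRc, hR⟩ := hT.exists_steps h (by omega) hz hzj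
  set s := t / (2 ^ 39 * L) + 1 with hs
  have hts : t < 2 ^ 39 * L * s := Nat.lt_mul_div_succ t (by positivity)
  have hsL : 2 ^ 39 * L * (s - 1) ≤ t := Nat.mul_div_le t _
  have hsR : s ≤ R.card := by
    refine le_trans ?_ hRc
    have : t / (2 ^ 39 * L) ≤ 2 ^ 33 * L := by
      refine Nat.div_le_of_le_mul ?_
      refine ht'.trans ?_
      rw [h.k_eq]
      nlinarith [Nat.zero_le (L * L)]
    omega
  obtain ⟨R₁, hR₁, hR₁c⟩ := exists_subset_card_eq hsR
  set f : Fin n → Fin n := fun c => σ (Λ.col z c) with hf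
  have hfi : Function.Injective f := fun c c' hcc => Λ.col_inj_right (σ.injective hcc)
  have hex : ∀ c, ∃ Q : Finset (Fin n), c ∈ R₁ → Q ⊆ C ∧ 2 ^ 39 * L ≤ Q.card ∧
      ∀ d ∈ Q, σ (Λ.col (f c) d) ∈ A 2 ∧ σ (Λ.col (f c) d) ∈ survivors N k Λ σ C F j := by
    intro c
    by_cases hc : c ∈ R₁
    · obtain ⟨Q, hQ⟩ := hT.exists_steps h (i := 1) (by omega) (hR c (hR₁ hc)).1 (hR c (hR₁ hc)).2
      exact ⟨Q, fun _ => hQ⟩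
    · exact ⟨∅, fun h => absurd h hc⟩
  choose Q hQ using hex
  have hcard : t ≤ (R₁.biUnion fun c => (Q c).image (Λ.col (f c))).card := by
    rw [card_biUnion]
    · calc t ≤ R₁.card * (2 ^ 39 * L) := by rw [hR₁c]; nlinarith
        _ = ∑ c ∈ R₁, 2 ^ 39 * L := by simp
        _ ≤ _ := by
          refine sum_le_sum fun c hc => ?_
          rw [card_image_of_injective _ fun d d' hd => Λ.col_inj_right hd]
          exact (hQ c hc).2.1
    · intro c₁ h1 c₂ h2 hne
      rw [Function.onFun, disjoint_left]
      intro y hy1 hy2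
      obtain ⟨d₁, hd1, rfl⟩ := mem_image.1 hy1
      obtain ⟨d₂, hd2, he⟩ := mem_image.1 hy2
      exact hzc (mem_filter.2 ⟨mem_univ _, c₁, hRC (hR₁ h1), c₂, hRC (hR₁ h2), d₁,
        (hQ c₁ h1).1 hd1, d₂, (hQ c₂ h2).1 hd2, hne, he.symm⟩)
  obtain ⟨T, hTs, hTc⟩ := exists_subset_card_eq hcard
  refine ⟨R₁.image f, T, ?_, ?_, hTc, ?_⟩
  · intro y hy
    obtain ⟨c, hc, hy⟩ := mem_biUnion.1 (hTs hy)
    obtain ⟨d, hd, rfl⟩ := mem_image.1 hy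
    exact Λ.mem_nbr.2 ⟨f c, mem_image_of_mem _ hc, d, (hQ c hc).1 hd, rfl⟩
  · rw [card_image_of_injective _ hfi, hR₁c, hTc]
    have h1 : L * s = L * (s - 1) + L := by
      rw [hs, Nat.add_sub_cancel, mul_add, mul_one]
    have h2 : 2 ^ 39 * (L * (s - 1)) ≤ t := by rw [← mul_assoc]; exact hsL
    rw [h.k_eq] at ht
    omega
  · intro y hy
    obtain ⟨c, hc, hy⟩ := mem_biUnion.1 (hTs hy)
    obtain ⟨d, hd, rfl⟩ := mem_image.1 hy
    exact (hQ c hc).2.2 d hd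

end Trails

end Expand

section Expand

variable {n N L k : ℕ}

theorem exists_growth_parameters (h : Large n N L k) : ∃ f t : ℕ, f ≤ L ∧ 200 * k ≤ t ∧
    t ≤ 200 * k * L ∧ 2 ^ 400 * (k * (t * L ^ f)) ≤ n ∧ n ≤ 2 ^ 402 * (k * (t * L ^ f)) := by
  have hk := h.k_pos
  have hL := h.L_pos
  have hL1 : 1 < L := lt_of_lt_of_le (by norm_num) h.L_ge
  have hKk : 0 < 2 ^ 400 * k := by positivity
  set m := n / (2 ^ 400 * k) with hm
  have hm1 : 2 ^ 400 * k * m ≤ n := Nat.mul_div_le _ _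
  have hm2 : n < 2 ^ 400 * k * (m + 1) := Nat.lt_mul_div_succ _ hKk
  have hkm : 200 * k ≤ m := by
    refine (Nat.le_div_iff_mul_le hKk).2 ?_
    refine le_trans ?_ (h.L_pow_le_n (j := 6) (by norm_num))
    have h1 : 200 * 2 ^ 400 ≤ L := by
      refine le_trans ?_ h.L_ge_pow
      calc 200 * 2 ^ 400 ≤ 2 ^ 8 * 2 ^ 400 := Nat.mul_le_mul_right _ (by norm_num)
        _ = 2 ^ 408 := by rw [← pow_add]
        _ ≤ _ := Nat.pow_le_pow_right (by norm_num) (by norm_num)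
    calc 200 * k * (2 ^ 400 * k) = (200 * 2 ^ 400) * (k * k) := by ring
      _ ≤ L * (L ^ 2 * L ^ 2) := Nat.mul_le_mul h1 (Nat.mul_le_mul h.k_le_sq h.k_le_sq)
      _ = L ^ 5 := by ring
      _ ≤ _ := Nat.pow_le_pow_right hL (by norm_num)
  have hm0 : m / (200 * k) ≠ 0 := by
    have := Nat.div_pos hkm (by positivity)
    omega
  set f := Nat.log L (m / (200 * k)) with hf
  have f1 : L ^ f ≤ m / (200 * k) := Nat.pow_log_le_self L hm0
  have f2 : m / (200 * k) < L ^ (f + 1) := Nat.lt_pow_succ_log_self hL1 _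
  have f3 : L ^ f * (200 * k) ≤ m := (Nat.le_div_iff_mul_le (by positivity)).1 f1
  have f4 : m < L ^ (f + 1) * (200 * k) := (Nat.div_lt_iff_lt_mul (by positivity)).1 f2
  have hLf : 0 < L ^ f := by positivity
  have hfL : f ≤ L := by
    refine (Nat.pow_le_pow_iff_right hL1).1 (le_trans ?_ h.n_le)
    exact f1.trans ((Nat.div_le_self _ _).trans (Nat.div_le_self _ _))
  set t := m / L ^ f with ht
  have t1 : L ^ f * t ≤ m := Nat.mul_div_le _ _
  have t2 : m < L ^ f * (t + 1) := Nat.lt_mul_div_succ _ hLf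
  have t3 : 200 * k ≤ t := (Nat.le_div_iff_mul_le hLf).2 (by rwa [mul_comm])
  refine ⟨f, t, hfL, t3, ?_, ?_, ?_⟩
  · have : L ^ f * t < L ^ f * (200 * k * L) := by
      refine t1.trans_lt (f4.trans_le (le_of_eq (by ring)))
    exact (Nat.lt_of_mul_lt_mul_left this).le
  · refine le_trans ?_ hm1
    rw [mul_assoc, mul_comm t]
    exact Nat.mul_le_mul_left _ (Nat.mul_le_mul_left _ t1)
  · refine hm2.le.trans ?_
    have h1 : m + 1 ≤ 2 * (t * L ^ f) + 2 * (t * L ^ f) := by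
      have : L ^ f ≤ L ^ f * t := Nat.le_mul_of_pos_right _ (by omega)
      rw [mul_add, mul_one] at t2
      rw [mul_comm t]
      omega
    calc 2 ^ 400 * k * (m + 1) ≤ 2 ^ 400 * k * (2 * (t * L ^ f) + 2 * (t * L ^ f)) :=
          Nat.mul_le_mul_left _ h1
      _ = (2 ^ 400 * 2 ^ 2) * (k * (t * L ^ f)) := by ring
      _ = _ := by rw [← pow_add]

/-- From `z`, every system of trails in `C` avoiding `W` reaches, after at most `L + 3` rounds,
rows from which any palette sees more than half of the columns. -/
def Fertile (L k : ℕ) (Λ : LatinSquare n) (σ : Equiv.Perm (Fin n)) (F W C : Finset (Fin n))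
    (z : Fin n) : Prop :=
  ∀ (C' V Rem : Finset (Fin n)) (A : ℕ → Finset (Fin n)) (U : ℕ → Fin n → Finset (Fin n)),
    C'.card = k → Trails L Λ σ C (F \ W) V A U → z ∈ A 0 → 2 ^ (50 * L) * Rem.card ≤ n →
    ∃ i ≤ L + 3, ∃ T ⊆ ((F \ W) \ V) \ Rem, (∀ y ∈ T, σ y ∈ A i) ∧
      9 * n ≤ 16 * (Λ.nbr C' (T.image σ)).card

theorem Trails.exists_finalSet (h : Large n N L k) {Λ : LatinSquare n} {σ : Equiv.Perm (Fin n)}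
    {C F V : Finset (Fin n)} {A : ℕ → Finset (Fin n)} {U : ℕ → Fin n → Finset (Fin n)}
    (hT : Trails L Λ σ C F V A U) (hC : C.card = k) (hσ : Expansive L k N Λ σ) {f t : ℕ}
    (hf : f ≤ L) (ht : 200 * k ≤ t) (ht' : t ≤ 200 * k * L)
    (htn : 2 ^ 400 * (k * (t * L ^ f)) ≤ n) (hnt : n ≤ 2 ^ 402 * (k * (t * L ^ f)))
    {z : Fin n} (hz : z ∈ A 0) (hzj : z ∈ survivors N k Λ σ C F (f + 2))
    (hzc : z ∉ collidingRows Λ σ C) : ∃ S ⊆ A (f + 2), FinalSet N k Λ C S := by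
  have hL := h.L_pos
  obtain ⟨S₀, T₀, a1, a2, a3, a4⟩ := hT.exists_start h hz hzj hzc ht ht'
  obtain ⟨S₁, T₁, b1, b2, b3, b4⟩ := hT.exists_grow_many h hC hσ (j := 0) f (i := 2) (by omega)
    a1 a2 (by rw [a3]; exact ht) (by rw [a3]; exact htn) (by rw [zero_add]; exact a4)
  rw [a3] at b3
  have hI : (T₁.image σ).card = T₁.card := card_image_of_injective _ σ.injective
  refine ⟨T₁.image σ, ?_, hC, ?_, ?_, ?_⟩
  · intro x hx
    obtain ⟨y, hy, rfl⟩ := mem_image.1 hx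
    rw [add_comm]
    exact b4 y hy
  · rw [hI, b3]; exact hnt
  · rw [hI, b3]; exact htn
  · have h1 := hσ.card_biUnion_ge hC hC b1 b2
      (ht.trans (by rw [b3]; exact Nat.le_mul_of_pos_right _ (by positivity)))
      (by rw [b3]; exact htn) (fun _ => C) (fun _ _ => Subset.rfl) (by
        intro y _
        rw [hC]
        exact Nat.le_mul_of_pos_left _ (by have := h.N_pos; positivity))
    rw [hI, mul_comm]
    refine h1.trans (Nat.mul_le_mul_left _ (card_le_card fun w hw => ?_))
    obtain ⟨y, hy, hw⟩ := mem_biUnion.1 hw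
    obtain ⟨c, hc, rfl⟩ := mem_image.1 hw
    exact Λ.mem_nbr.2 ⟨σ y, mem_image_of_mem _ hy, c, hc, rfl⟩

theorem FinalSet.n_le_lab (h : Large n N L k) {Λ : LatinSquare n} {l : Fin n → Fin N} {a : ℕ}
    (hl : FinalLabels k Λ a l) {C S : Finset (Fin n)} (hF : FinalSet N k Λ C S) :
    2 ^ 15 * (L * S.card) ≤ (Λ.nbr C S ∩ lab l a).card ∧
      n ≤ 2 ^ (10 * L) * (Λ.nbr C S ∩ lab l a).card := by
  have h1 := (hF.nbr_ge h).trans (hl C S hF)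
  have h2 : 2 ^ 15 * (L * S.card) ≤ (Λ.nbr C S ∩ lab l a).card := by
    generalize (Λ.nbr C S ∩ lab l a).card = m at h1 ⊢
    rw [h.N_eq] at h1
    omega
  refine ⟨h2, hF.le_card.trans ?_⟩
  calc 2 ^ 402 * (k * S.card) ≤ L * (L ^ 2 * (L * S.card)) := by
        refine Nat.mul_le_mul ?_ (Nat.mul_le_mul h.k_le_sq (Nat.le_mul_of_pos_left _ h.L_pos))
        exact le_trans (Nat.pow_le_pow_right (by norm_num) (by norm_num)) h.L_ge_pow
    _ = L ^ 3 * (L * S.card) := by ring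
    _ ≤ 2 ^ (10 * L) * (L * S.card) := by
        refine Nat.mul_le_mul_right _ ?_
        refine (Nat.pow_le_pow_right h.L_pos (show 3 ≤ 64 by norm_num)).trans (h.L_pow_le.trans ?_)
        exact Nat.pow_le_pow_right (by norm_num) (by omega)
    _ ≤ _ := Nat.mul_le_mul_left _ (by omega)

theorem Side.exists_barren (h : Large n N L k) {Λ : LatinSquare n} {σ : Equiv.Perm (Fin n)}
    {l : Fin n → Fin N} {a : ℕ} {J : Finset (Fin n)} (hS : Side N L k Λ σ l a J)
    {C : Finset (Fin n)} (hC : C.card = k) {W : Finset (Fin n)}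
    (hW : 2 ^ (100 * L) * W.card ≤ n) :
    ∃ B : Finset (Fin n), 2 ^ (60 * L) * B.card ≤ n ∧
      ∀ z ∉ B, Fertile L k Λ σ (lab l a \ J) W C z := by
  have hL := h.L_pos
  have hLg : 2 ^ 100 ≤ L := le_trans (by norm_num) h.L_ge
  obtain ⟨f, t, hf, ht, ht', htn, hnt⟩ := exists_growth_parameters h
  refine ⟨(univ \ survivors N k Λ σ C ((lab l a \ J) \ W) (f + 2)) ∪ collidingRows Λ σ C, ?_, ?_⟩
  · have h1 := card_compl_survivors_le h (σ := σ) hC (hS.poor_row C hC) hW (f + 2)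
    have h2 := card_collidingRows_le hS.collisions C
    obtain ⟨b₁, hb₁⟩ : ∃ b, (univ \ survivors N k Λ σ C ((lab l a \ J) \ W) (f + 2)).card = b :=
      ⟨_, rfl⟩
    rw [hb₁] at h1
    have h3 : 2 * (2 ^ (60 * L) * b₁) ≤ n := by
      have h4 : 2 ^ (40 * L) * (2 ^ (60 * L) * b₁) ≤ n * 2 ^ (26 * L + 52) := by
        rw [← mul_assoc, ← pow_add, ← add_mul]
        refine h1.trans (Nat.mul_le_mul_left _ (Nat.pow_le_pow_right (by norm_num) (by omega)))
      have h5 : 2 ^ (26 * L + 52) * (2 * (2 ^ (60 * L) * b₁)) ≤ 2 ^ (26 * L + 52) * n := by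
        rw [mul_comm _ n]
        refine le_trans ?_ h4
        rw [← mul_assoc, ← pow_succ]
        exact Nat.mul_le_mul_right _ (Nat.pow_le_pow_right (by norm_num) (by omega))
      exact Nat.le_of_mul_le_mul_left h5 (by positivity)
    have h6 : 2 * (2 ^ (60 * L) * (collidingRows Λ σ C).card) ≤ n := by
      refine le_trans ?_ (h.L_pow_mul_le 60 (by norm_num))
      calc 2 * (2 ^ (60 * L) * (collidingRows Λ σ C).card)
          ≤ 2 * (2 ^ (60 * L) * (k ^ 4 * (60 * L ^ 2))) := by
            rw [hC] at h2
            exact Nat.mul_le_mul_left _ (Nat.mul_le_mul_left _ h2)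
        _ ≤ 2 * (2 ^ (60 * L) * ((L ^ 2) ^ 4 * (60 * L ^ 2))) :=
            Nat.mul_le_mul_left _ (Nat.mul_le_mul_left _ (Nat.mul_le_mul_right _
              (Nat.pow_le_pow_left h.k_le_sq 4)))
        _ = (120 * L ^ 10) * 2 ^ (60 * L) := by ring
        _ ≤ L ^ 64 * 2 ^ (60 * L) := by
            refine Nat.mul_le_mul_right _ ?_
            calc 120 * L ^ 10 ≤ L * L ^ 10 := Nat.mul_le_mul_right _ (le_trans (by norm_num) hLg)
              _ = L ^ 11 := by ring
              _ ≤ _ := Nat.pow_le_pow_right hL (by norm_num)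
    refine (Nat.mul_le_mul_left _ (card_union_le _ _)).trans ?_
    rw [mul_add, hb₁]
    omega
  · intro z hz C' V Rem A U hC' hT hzA hRem
    simp only [mem_union, mem_sdiff, mem_univ, true_and, not_or, not_not] at hz
    obtain ⟨S, hSA, hF⟩ := hT.exists_finalSet h hC hS.expansive hf ht ht' htn hnt hzA hz.1 hz.2
    obtain ⟨g1, g2⟩ := hF.n_le_lab h hS.finalLabels
    have g3 := hS.finalConflicts C S hF
    have g4 := hS.finalLabels C S hF
    have hSpos := hF.card_pos h
    set Tp := Λ.nbr C S ∩ lab l a with hTp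
    set good : Finset (Fin n) := Tp.filter fun y =>
      y ∈ (((lab l a \ J) \ W) \ V) \ Rem ∧ σ y ∈ A (f + 3) with hgood
    have hX : 64 * (Tp \ good).card ≤ Tp.card := by
      have hsub : Tp \ good ⊆ (Λ.nbr C S ∩ (J ∩ lab l a)) ∪ W ∪ V ∪ Rem ∪
          S.biUnion fun x => (U (f + 2) x).image (Λ.col x) := by
        intro y hy
        rw [mem_sdiff] at hy
        simp only [hgood, mem_filter, not_and] at hy
        obtain ⟨hyT, hy⟩ := hy
        by_contra hc
        simp only [mem_union, not_or, mem_biUnion, not_exists, not_and] at hc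
        obtain ⟨⟨⟨⟨c1, c2⟩, c3⟩, c4⟩, c5⟩ := hc
        obtain ⟨q1, q2⟩ := mem_inter.1 hyT
        obtain ⟨x, hx, c, hcC, rfl⟩ := Λ.mem_nbr.1 q1
        have q3 : Λ.col x c ∉ J := fun hJ => c1 (mem_inter.2 ⟨q1, mem_inter.2 ⟨hJ, q2⟩⟩)
        have q4 : Λ.col x c ∈ (lab l a \ J) \ W := by simp only [mem_sdiff]; tauto
        refine hy hyT (by simp only [mem_sdiff] at q4 ⊢; tauto) ?_
        exact hT.step (f + 2) (by omega) x (hSA hx) c hcC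
          (fun hU => c5 x hx (mem_image_of_mem _ hU)) q4 c3
      have hU : (S.biUnion fun x => (U (f + 2) x).image (Λ.col x)).card ≤ S.card * (4 * L) :=
        card_biUnion_le_card_mul _ _ _ fun x hx =>
          card_image_le.trans (hT.card_U _ (by omega) x (hSA hx))
      have hsum : (Tp \ good).card ≤ (Λ.nbr C S ∩ (J ∩ lab l a)).card + W.card + V.card +
          Rem.card + S.card * (4 * L) := by
        refine (card_le_card hsub).trans ?_
        refine (card_union_le _ _).trans (Nat.add_le_add ?_ hU)
        refine (card_union_le _ _).trans (Nat.add_le_add_right ?_ _)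
        refine (card_union_le _ _).trans (Nat.add_le_add_right ?_ _)
        exact card_union_le _ _
      have hJ : 128 * (Λ.nbr C S ∩ (J ∩ lab l a)).card ≤ Tp.card := by
        have : N * (128 * (Λ.nbr C S ∩ (J ∩ lab l a)).card) ≤ N * Tp.card := by nlinarith
        exact Nat.le_of_mul_le_mul_left this h.N_pos
      have hsmall : ∀ Y : Finset (Fin n), 2 ^ (50 * L) * Y.card ≤ n → 2 ^ 40 * Y.card ≤ Tp.card := by
        intro Y hY
        have : 2 ^ (10 * L) * (2 ^ 40 * Y.card) ≤ 2 ^ (10 * L) * Tp.card := by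
          refine le_trans ?_ (hY.trans g2)
          rw [← mul_assoc, ← pow_add]
          exact Nat.mul_le_mul_right _ (Nat.pow_le_pow_right (by norm_num) (by omega))
        exact Nat.le_of_mul_le_mul_left this (by positivity)
      have hW' := hsmall W (le_trans (Nat.mul_le_mul_right _
        (Nat.pow_le_pow_right (by norm_num) (by omega))) hW)
      have hR' := hsmall Rem hRem
      have hV := hT.card_V
      have hLS : L ≤ L * S.card := Nat.le_mul_of_pos_right _ hSpos
      have e : S.card * (4 * L) = 4 * (L * S.card) := by ring
      omega
    refine ⟨f + 3, by omega, good, fun y hy => (mem_filter.1 hy).2.1,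
      fun y hy => (mem_filter.1 hy).2.2, ?_⟩
    have := hS.finalSpread C C' S (Tp \ good) hF hC' sdiff_subset hX
    simp only at this
    rwa [← hTp, Finset.sdiff_sdiff_eq_self (filter_subset _ _)] at this

end Expand

section Matching

variable {n : ℕ}

/-- The symbol in a cell. -/
def LatinSquare.val (Λ : LatinSquare n) (e : Fin n × Fin n) : Fin n := Λ.sym e.1 e.2

/-- A set of cells with distinct rows, distinct columns and distinct symbols. -/
structure Rainbow (Λ : LatinSquare n) (M : Finset (Fin n × Fin n)) : Prop where
  fst : Set.InjOn Prod.fst (M : Set (Fin n × Fin n))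
  snd : Set.InjOn Prod.snd (M : Set (Fin n × Fin n))
  val : Set.InjOn Λ.val (M : Set (Fin n × Fin n))

variable {Λ : LatinSquare n} {M : Finset (Fin n × Fin n)}

theorem injOn_of_insert_subset {α β : Type*} [DecidableEq β] {f : α → β} {M S : Finset α} {x : β}
    (hM : Set.InjOn f M) (hx : x ∉ M.image f) (hS : S.card ≤ M.card + 1)
    (h : insert x (M.image f) ⊆ S.image f) :
    Set.InjOn f S ∧ S.card = M.card + 1 ∧ S.image f = insert x (M.image f) := by
  have h1 : (insert x (M.image f)).card = M.card + 1 := by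
    rw [card_insert_of_notMem hx, card_image_of_injOn hM]
  have h2 := card_le_card h
  have h3 : (S.image f).card ≤ S.card := card_image_le
  exact ⟨card_image_iff.1 (by omega), by omega, (eq_of_subset_of_card_le h (by omega)).symm⟩

/-- Replacing the cells `R` by cells `A` which cover the rows and columns of `R`, a free row and a
free column. -/
theorem Rainbow.exchange (hM : Rainbow Λ M) {R A : Finset (Fin n × Fin n)} (hR : R ⊆ M)
    (hc : A.card ≤ R.card + 1) {x y : Fin n} (hx : x ∉ M.image Prod.fst)
    (hy : y ∉ M.image Prod.snd) (h1 : insert x (R.image Prod.fst) ⊆ A.image Prod.fst)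
    (h2 : insert y (R.image Prod.snd) ⊆ A.image Prod.snd)
    (h3 : Set.InjOn Λ.val (A : Set (Fin n × Fin n)))
    (h4 : ∀ e ∈ A, Λ.val e ∉ M.image Λ.val) :
    Rainbow Λ ((M \ R) ∪ A) ∧ ((M \ R) ∪ A).card = M.card + 1 ∧
      ((M \ R) ∪ A).image Prod.fst = insert x (M.image Prod.fst) ∧
      ((M \ R) ∪ A).image Prod.snd = insert y (M.image Prod.snd) := by
  have hcard : ((M \ R) ∪ A).card ≤ M.card + 1 := by
    have := card_union_le (M \ R) A
    have := card_sdiff_add_card_eq_card hR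
    omega
  have key : ∀ (f : Fin n × Fin n → Fin n) (z : Fin n), insert z (R.image f) ⊆ A.image f →
      insert z (M.image f) ⊆ ((M \ R) ∪ A).image f := by
    intro f z h w hw
    rw [image_union, mem_union]
    rcases mem_insert.1 hw with rfl | hw
    · exact Or.inr (h (mem_insert_self _ _))
    · obtain ⟨e, he, rfl⟩ := mem_image.1 hw
      by_cases heR : e ∈ R
      · exact Or.inr (h (mem_insert_of_mem (mem_image_of_mem _ heR)))
      · exact Or.inl (mem_image_of_mem _ (mem_sdiff.2 ⟨he, heR⟩))
  obtain ⟨a1, a2, a3⟩ := injOn_of_insert_subset hM.fst hx hcard (key _ _ h1)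
  obtain ⟨b1, -, b3⟩ := injOn_of_insert_subset hM.snd hy hcard (key _ _ h2)
  refine ⟨⟨a1, b1, ?_⟩, a2, a3, b3⟩
  intro e he e' he' hee
  simp only [coe_union, Set.mem_union, mem_coe, mem_sdiff] at he he'
  rcases he with he | he <;> rcases he' with he' | he'
  · exact hM.val he.1 he'.1 hee
  · exact absurd (mem_image.2 ⟨e, he.1, hee⟩) (h4 e' he')
  · exact absurd (mem_image.2 ⟨e', he'.1, hee.symm⟩) (h4 e he)
  · exact h3 he he' hee

theorem Rainbow.swap (hM : Rainbow Λ M) : Rainbow Λ.transpose (M.image Prod.swap) := by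
  refine ⟨?_, ?_, ?_⟩ <;> intro e he e' he' h <;>
    obtain ⟨d, hd, rfl⟩ := mem_image.1 (mem_coe.1 he) <;>
    obtain ⟨d', hd', rfl⟩ := mem_image.1 (mem_coe.1 he')
  · rw [hM.snd hd hd' h]
  · rw [hM.fst hd hd' h]
  · rw [hM.val hd hd' h]

theorem mem_image_swap {M : Finset (Fin n × Fin n)} {e : Fin n × Fin n} :
    e ∈ M.image Prod.swap ↔ e.swap ∈ M := by
  constructor
  · intro h
    obtain ⟨d, hd, rfl⟩ := mem_image.1 h
    simpa using hd
  · intro h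
    exact mem_image.2 ⟨_, h, Prod.swap_swap e⟩

theorem image_fst_swap (M : Finset (Fin n × Fin n)) :
    (M.image Prod.swap).image Prod.fst = M.image Prod.snd := by
  rw [image_image]; rfl

theorem image_snd_swap (M : Finset (Fin n × Fin n)) :
    (M.image Prod.swap).image Prod.snd = M.image Prod.fst := by
  rw [image_image]; rfl

theorem image_val_swap (M : Finset (Fin n × Fin n)) :
    (M.image Prod.swap).image Λ.transpose.val = M.image Λ.val := by
  rw [image_image]; rfl

/-- A set `R` of cells of `M` and a set `A` of cells with new symbols such that replacing `R` by `A`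
covers the row `x` instead of the row `z`. -/
structure RowEdit (Λ : LatinSquare n) (M : Finset (Fin n × Fin n)) (x z : Fin n)
    (R A : Finset (Fin n × Fin n)) : Prop where
  sub : R ⊆ M
  card : A.card ≤ R.card
  rows : insert x (R.image Prod.fst) ⊆ insert z (A.image Prod.fst)
  cols : R.image Prod.snd ⊆ A.image Prod.snd
  inj : Set.InjOn Λ.val (A : Set (Fin n × Fin n))
  new : ∀ e ∈ A, Λ.val e ∉ M.image Λ.val

namespace RowEdit

theorem refl (x : Fin n) : RowEdit Λ M x x ∅ ∅ := by
  constructor <;> simp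

variable {x z : Fin n} {R A : Finset (Fin n × Fin n)}

theorem extend (h : RowEdit Λ M x z R A) {z' y : Fin n} (hM : (z', y) ∈ M)
    (hy : y ∉ R.image Prod.snd) (hc : Λ.sym z y ∉ M.image Λ.val)
    (hcA : Λ.sym z y ∉ A.image Λ.val) :
    RowEdit Λ M x z' (insert (z', y) R) (insert (z, y) A) := by
  have hR : (z', y) ∉ R := fun hR => hy (mem_image.2 ⟨_, hR, rfl⟩)
  refine ⟨insert_subset hM h.sub, ?_, ?_, ?_, ?_, ?_⟩
  · rw [card_insert_of_notMem hR]
    exact (card_insert_le _ _).trans (Nat.add_le_add_right h.card 1)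
  · intro w hw
    have := @h.rows w
    simp only [image_insert, mem_insert] at hw this ⊢
    tauto
  · intro w hw
    have := @h.cols w
    simp only [image_insert, mem_insert] at hw this ⊢
    tauto
  · have key : ∀ e ∈ A, Λ.val e ≠ Λ.val (z, y) := fun e he hh => hcA (mem_image.2 ⟨e, he, hh⟩)
    rintro e he e' he' hee
    rw [mem_coe, mem_insert] at he he'
    rcases he with rfl | he <;> rcases he' with rfl | he'
    · rfl
    · exact absurd hee.symm (key _ he')
    · exact absurd hee (key _ he)
    · exact h.inj he he' hee
  · intro e he
    rcases mem_insert.1 he with rfl | he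
    · exact hc
    · exact h.new e he

/-- Completing an edit by a cell in the row it uncovers and a free column. -/
theorem augment (h : RowEdit Λ M x z R A) (hM : Rainbow Λ M) (hx : x ∉ M.image Prod.fst) {y : Fin n}
    (hy : y ∉ M.image Prod.snd) (hc : Λ.sym z y ∉ M.image Λ.val)
    (hcA : Λ.sym z y ∉ A.image Λ.val) :
    Rainbow Λ ((M \ R) ∪ insert (z, y) A) ∧ ((M \ R) ∪ insert (z, y) A).card = M.card + 1 ∧
      ((M \ R) ∪ insert (z, y) A).image Prod.fst = insert x (M.image Prod.fst) ∧
      ((M \ R) ∪ insert (z, y) A).image Prod.snd = insert y (M.image Prod.snd) := by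
  refine hM.exchange h.sub ((card_insert_le _ _).trans (Nat.add_le_add_right h.card 1)) hx hy
    ?_ ?_ ?_ ?_
  · rw [image_insert]; exact h.rows
  · rw [image_insert]; exact insert_subset_insert _ h.cols
  · have key : ∀ e ∈ A, Λ.val e ≠ Λ.val (z, y) := fun e he hh => hcA (mem_image.2 ⟨e, he, hh⟩)
    rintro e he e' he' hee
    rw [mem_coe, mem_insert] at he he'
    rcases he with rfl | he <;> rcases he' with rfl | he'
    · rfl
    · exact absurd hee.symm (key _ he')
    · exact absurd hee (key _ he)
    · exact h.inj he he' hee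
  · intro e he
    rcases mem_insert.1 he with rfl | he
    · exact hc
    · exact h.new e he

/-- Joining a row edit and a column edit by one more cell. -/
theorem join (h : RowEdit Λ M x z R A) (hM : Rainbow Λ M) {y w : Fin n}
    {R' A' : Finset (Fin n × Fin n)}
    (h' : RowEdit Λ.transpose (M.image Prod.swap) y w (R'.image Prod.swap) (A'.image Prod.swap))
    (hx : x ∉ M.image Prod.fst) (hy : y ∉ M.image Prod.snd) (hRR : Disjoint R R')
    (hAA : Disjoint (A.image Λ.val) (A'.image Λ.val)) (hc : Λ.sym z w ∉ M.image Λ.val)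
    (hcA : Λ.sym z w ∉ A.image Λ.val) (hcA' : Λ.sym z w ∉ A'.image Λ.val) :
    Rainbow Λ ((M \ (R ∪ R')) ∪ insert (z, w) (A ∪ A')) ∧
      ((M \ (R ∪ R')) ∪ insert (z, w) (A ∪ A')).card = M.card + 1 ∧
      ((M \ (R ∪ R')) ∪ insert (z, w) (A ∪ A')).image Prod.fst = insert x (M.image Prod.fst) ∧
      ((M \ (R ∪ R')) ∪ insert (z, w) (A ∪ A')).image Prod.snd = insert y (M.image Prod.snd) := by
  have swap_card : ∀ S : Finset (Fin n × Fin n), (S.image Prod.swap).card = S.card :=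
    fun S => card_image_of_injective _ Prod.swap_injective
  have c1 := h'.card
  have c2 := h'.rows
  have c3 := h'.cols
  have c4 := h'.inj
  have c5 := h'.new
  rw [swap_card, swap_card] at c1
  rw [image_fst_swap, image_fst_swap] at c2
  rw [image_snd_swap, image_snd_swap] at c3
  rw [image_val_swap] at c5
  have c6 : Set.InjOn Λ.val (A' : Set (Fin n × Fin n)) := by
    intro e he e' he' hee
    exact Prod.swap_injective (c4 (mem_coe.2 (mem_image_of_mem _ he))
      (mem_coe.2 (mem_image_of_mem _ he')) hee)
  have c7 : ∀ e ∈ A', Λ.val e ∉ M.image Λ.val := fun e he => c5 e.swap (mem_image_of_mem _ he)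
  have c8 : R' ⊆ M := by
    intro e he
    have := h'.sub (mem_image_of_mem _ he)
    rwa [mem_image_swap, Prod.swap_swap] at this
  refine hM.exchange (union_subset h.sub c8) ?_ hx hy ?_ ?_ ?_ ?_
  · have := card_union_le A A'
    have := card_insert_le (z, w) (A ∪ A')
    have := h.card
    rw [card_union_of_disjoint hRR]
    omega
  · intro v hv
    have a1 := @h.rows v
    have a2 := @c3 v
    simp only [image_insert, image_union, mem_insert, mem_union] at hv a1 ⊢
    tauto
  · intro v hv
    have a1 := @h.cols v
    have a2 := @c2 v
    simp only [image_insert, image_union, mem_insert, mem_union] at hv a2 ⊢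
    tauto
  · have k1 : ∀ e ∈ A, Λ.val e ≠ Λ.val (z, w) := fun e he hh => hcA (mem_image.2 ⟨e, he, hh⟩)
    have k2 : ∀ e ∈ A', Λ.val e ≠ Λ.val (z, w) := fun e he hh => hcA' (mem_image.2 ⟨e, he, hh⟩)
    have k3 : ∀ e ∈ A, ∀ e' ∈ A', Λ.val e ≠ Λ.val e' := fun e he e' he' hee =>
      disjoint_left.1 hAA (mem_image_of_mem _ he) (hee ▸ mem_image_of_mem _ he')
    rintro e he e' he' hee
    rw [mem_coe, mem_insert, mem_union] at he he'
    rcases he with rfl | he | he <;> rcases he' with rfl | he' | he'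
    · rfl
    · exact absurd hee.symm (k1 _ he')
    · exact absurd hee.symm (k2 _ he')
    · exact absurd hee (k1 _ he)
    · exact h.inj he he' hee
    · exact absurd hee (k3 _ he _ he')
    · exact absurd hee (k2 _ he)
    · exact absurd hee.symm (k3 _ he' _ he)
    · exact c6 he he' hee
  · intro e he
    rw [mem_insert, mem_union] at he
    rcases he with rfl | he | he
    · exact hc
    · exact h.new e he
    · exact c7 e he

end RowEdit

end Matching

section Repair

variable {n N L k : ℕ}

/-- The marked columns whose hue already occurs at a smaller marked column. -/
noncomputable def repeats (Λ : LatinSquare n) (ω : Sample n N) : Finset (Fin n) :=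
  (marked ω.2).filter fun y => ∃ y' ∈ marked ω.2, y' < y ∧ hue Λ ω.1 y' = hue Λ ω.1 y

theorem isConflict_repeats (Λ : LatinSquare n) (ω : Sample n N) :
    IsConflict Λ ω (repeats Λ ω) := by
  intro y hy
  have hy' := (mem_filter.1 hy).1
  have hne : ((marked ω.2).filter fun y' => hue Λ ω.1 y' = hue Λ ω.1 y).Nonempty :=
    ⟨y, mem_filter.2 ⟨hy', rfl⟩⟩
  obtain ⟨z, hz, hmin⟩ := exists_minimal hne
  have h1 := mem_filter.1 hz
  refine ⟨z, mem_sdiff.2 ⟨h1.1, fun h2 => ?_⟩, h1.2⟩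
  obtain ⟨-, y', g1, g2, g3⟩ := mem_filter.1 h2
  exact absurd (hmin (mem_filter.2 ⟨g1, g3.trans h1.2⟩) g2.le) (not_le.2 g2)

theorem injOn_hue (Λ : LatinSquare n) (ω : Sample n N) :
    Set.InjOn (hue Λ ω.1) (marked ω.2 \ repeats Λ ω : Finset (Fin n)) := by
  have key : ∀ y ∈ marked ω.2 \ repeats Λ ω, ∀ y' ∈ marked ω.2 \ repeats Λ ω,
      hue Λ ω.1 y = hue Λ ω.1 y' → ¬ y < y' := by
    intro y hy y' hy' h hlt
    rw [mem_sdiff] at hy hy'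
    exact hy'.2 (mem_filter.2 ⟨hy'.1, y, hy.1, hlt, h⟩)
  intro y hy y' hy' h
  exact le_antisymm (not_lt.1 (key y' hy' y hy h.symm)) (not_lt.1 (key y hy y' hy' h))

theorem card_le_of_few {Λ : LatinSquare n} {ω : Sample n N} {J : Finset (Fin n)}
    (hf : FewConflicts Λ ω) (hJ : IsConflict Λ ω J) (hJm : J ⊆ marked ω.2) :
    192 * N * J.card ≤ 3 * n := by
  have hsub : J ⊆ (J ∩ lab ω.2 0) ∪ (J ∩ lab ω.2 1) ∪ (J ∩ lab ω.2 2) := by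
    intro y hy
    have h1 := mem_marked.1 (hJm hy)
    simp only [mem_union, mem_inter, mem_lab]
    have : (ω.2 y).val = 0 ∨ (ω.2 y).val = 1 ∨ (ω.2 y).val = 2 := by omega
    tauto
  have h1 := (card_le_card hsub).trans ((card_union_le _ _).trans
    (Nat.add_le_add_right (card_union_le _ _) _))
  have h2 := Nat.mul_le_mul_left (192 * N) h1
  have a0 := hf J hJ 0 (by norm_num)
  have a1 := hf J hJ 1 (by norm_num)
  have a2 := hf J hJ 2 (by norm_num)
  rw [mul_add, mul_add] at h2
  omega

theorem exists_partner {Λ : LatinSquare n} {ω : Sample n N} (hfair : FairLabels ω.2)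
    (hr : RepairSparse Λ ω) {J Q E : Finset (Fin n)} {y : Fin n} (hn : 0 < n) (hy : y ∈ J)
    (hJ : 192 * N * (J ∩ lab ω.2 2).card ≤ n) (hQ : 192 * N * Q.card ≤ 3 * n)
    (hE : 192 * N * E.card ≤ 6 * n) :
    ∃ q ∈ (lab ω.2 2 \ J) \ Q, Λ.sym (ω.1 q) y ≠ Λ.sym (ω.1 y) q ∧
      Λ.sym (ω.1 q) y ∉ (marked ω.2).image (hue Λ ω.1) ∪ E ∧
      Λ.sym (ω.1 y) q ∉ (marked ω.2).image (hue Λ ω.1) ∪ E := by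
  by_contra hc
  push Not at hc
  set b₁ := (lab ω.2 2).filter fun q => q ≠ y ∧
    ∃ y' ∈ marked ω.2, hue Λ ω.1 y' = Λ.sym (ω.1 q) y with hb₁
  set b₂ := (lab ω.2 2).filter fun q => Λ.sym (ω.1 q) y = Λ.sym (ω.1 y) q with hb₂
  set b₃ := (lab ω.2 2).filter fun q =>
    ∃ y' ∈ marked ω.2, hue Λ ω.1 y' = Λ.sym (ω.1 y) q with hb₃
  set b₄ := univ.filter fun q => Λ.sym (ω.1 q) y ∈ E with hb₄
  set b₅ := univ.filter fun q => Λ.sym (ω.1 y) q ∈ E with hb₅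
  have e1 : 32 * N * b₁.card ≤ n := hr.hue_col y
  have e2 : 32 * N * b₂.card ≤ n := hr.sym_eq (ω.1 y) y
  have e3 : 32 * N * b₃.card ≤ n := hr.hue_row (ω.1 y)
  have e4 : b₄.card ≤ E.card := card_le_card_of_injOn (fun q => Λ.sym (ω.1 q) y)
    (fun q hq => (mem_filter.1 hq).2) fun q _ q' _ h => ω.1.injective (Λ.sym_inj_left h)
  have e5 : b₅.card ≤ E.card := card_le_card_of_injOn (fun q => Λ.sym (ω.1 y) q)
    (fun q hq => (mem_filter.1 hq).2) fun q _ q' _ h => Λ.sym_inj_right h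
  have hsub : lab ω.2 2 ⊆ (J ∩ lab ω.2 2) ∪ Q ∪ b₁ ∪ b₂ ∪ b₃ ∪ b₄ ∪ b₅ := by
    intro q hq
    by_contra hcon
    simp only [hb₁, hb₂, hb₃, hb₄, hb₅, mem_union, mem_inter, mem_filter, mem_univ, true_and,
      not_or, not_and, hq, and_true] at hcon
    obtain ⟨⟨⟨⟨⟨⟨c1, c2⟩, c3⟩, c4⟩, c5⟩, c6⟩, c7⟩ := hcon
    have hqy : q ≠ y := by rintro rfl; exact c1 hy
    have c3' := c3 hqy
    have d1 := hc q (by simp [mem_sdiff, hq, c1, c2]) c4 (by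
      rw [mem_union, mem_image]; exact not_or.2 ⟨c3', c6⟩)
    rw [mem_union, mem_image] at d1
    exact d1.elim c5 c7
  have h1 := card_le_card hsub
  have h2 : (lab ω.2 2).card ≤ (J ∩ lab ω.2 2).card + Q.card + b₁.card + b₂.card + b₃.card +
      b₄.card + b₅.card := by
    refine h1.trans ?_
    repeat' refine (card_union_le _ _).trans (Nat.add_le_add_right ?_ _)
    exact le_rfl
  have h3 := (hfair 2 (by norm_num)).2
  have h4 : 48 * n ≤ 192 * N * (lab ω.2 2).card := by
    have : 192 * N * (lab ω.2 2).card = 48 * (4 * N * (lab ω.2 2).card) := by ring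
    omega
  have h5 := Nat.mul_le_mul_left (192 * N) h2
  have h6 := Nat.mul_le_mul_left (192 * N) e4
  have h7 := Nat.mul_le_mul_left (192 * N) e5
  have e1' : 192 * N * b₁.card ≤ 6 * n := by nlinarith
  have e2' : 192 * N * b₂.card ≤ 6 * n := by nlinarith
  have e3' : 192 * N * b₃.card ≤ 6 * n := by nlinarith
  simp only [mul_add] at h5
  omega

/-- A rainbow matching in the columns of the set `D` and their images, which contains the cells of
the graph of `σ` outside `Q`, and whose symbols are hues or belong to `E`. -/
structure Repaired (Λ : LatinSquare n) (ω : Sample n N) (D Q E : Finset (Fin n))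
    (M : Finset (Fin n × Fin n)) : Prop where
  rainbow : Rainbow Λ M
  snd : M.image Prod.snd = D
  fst : M.image Prod.fst = D.image ω.1
  diag : ∀ y ∈ (marked ω.2 \ repeats Λ ω) \ Q, (ω.1 y, y) ∈ M
  val : M.image Λ.val ⊆ (marked ω.2).image (hue Λ ω.1) ∪ E

theorem repaired_start (Λ : LatinSquare n) (ω : Sample n N) :
    Repaired Λ ω (marked ω.2 \ repeats Λ ω) ∅ ∅
      ((marked ω.2 \ repeats Λ ω).image fun y => (ω.1 y, y)) where
  rainbow := by
    refine ⟨?_, ?_, ?_⟩ <;> intro e he e' he' h <;>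
      obtain ⟨d, hd, rfl⟩ := mem_image.1 (mem_coe.1 he) <;>
      obtain ⟨d', hd', rfl⟩ := mem_image.1 (mem_coe.1 he')
    · rw [ω.1.injective h]
    · rw [show d = d' from h]
    · rw [injOn_hue Λ ω hd hd' h]
  snd := by rw [image_image]; exact image_id
  fst := by rw [image_image]; rfl
  diag y hy := mem_image_of_mem _ (mem_sdiff.1 hy).1
  val := by
    rw [image_image]
    exact (image_subset_image sdiff_subset).trans subset_union_left

theorem Repaired.step {Λ : LatinSquare n} {ω : Sample n N} {D Q E : Finset (Fin n)}
    {M : Finset (Fin n × Fin n)} (h : Repaired Λ ω D Q E M) {y q : Fin n} (hy : y ∉ D)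
    (hq : q ∈ (marked ω.2 \ repeats Λ ω) \ Q) (h1 : Λ.sym (ω.1 q) y ≠ Λ.sym (ω.1 y) q)
    (h2 : Λ.sym (ω.1 q) y ∉ (marked ω.2).image (hue Λ ω.1) ∪ E)
    (h3 : Λ.sym (ω.1 y) q ∉ (marked ω.2).image (hue Λ ω.1) ∪ E) :
    ∃ M', Repaired Λ ω (insert y D) (insert q Q)
      (insert (Λ.sym (ω.1 q) y) (insert (Λ.sym (ω.1 y) q) E)) M' := by
  have hqM := h.diag q hq
  obtain ⟨g1, -, g3, g4⟩ := h.rainbow.exchange (R := {(ω.1 q, q)})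
    (A := {(ω.1 q, y), (ω.1 y, q)}) (x := ω.1 y) (y := y) (by simpa using hqM)
    (by rw [card_singleton]; exact card_le_two)
    (by rw [h.fst]; simpa using hy) (by rwa [h.snd])
    (by
      intro w
      simp only [image_singleton, image_insert, mem_insert, mem_singleton]
      tauto)
    (by
      intro w
      simp only [image_singleton, image_insert, mem_insert, mem_singleton]
      tauto)
    (by
      intro e he e' he' hee
      simp only [coe_insert, coe_singleton, Set.mem_insert_iff, Set.mem_singleton_iff] at he he'
      rcases he with rfl | rfl <;> rcases he' with rfl | rfl
      · rfl
      · exact absurd hee h1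
      · exact absurd hee.symm h1
      · rfl)
    (by
      intro e he
      simp only [mem_insert, mem_singleton] at he
      rcases he with rfl | rfl
      · exact fun hh => h2 (h.val hh)
      · exact fun hh => h3 (h.val hh))
  refine ⟨_, g1, ?_, ?_, ?_, ?_⟩
  · rw [g4, h.snd]
  · rw [g3, h.fst, image_insert]
  · intro z hz
    simp only [mem_sdiff, mem_insert, not_or] at hz
    refine mem_union_left _ (mem_sdiff.2 ⟨h.diag z (by simp only [mem_sdiff]; tauto), ?_⟩)
    simp only [mem_singleton, Prod.mk.injEq, not_and]
    exact fun _ => hz.2.1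
  · intro c hc
    obtain ⟨e, he, rfl⟩ := mem_image.1 hc
    simp only [mem_union, mem_insert, mem_singleton] at he ⊢
    rcases he with he | rfl | rfl
    · have := h.val (mem_image_of_mem _ (mem_sdiff.1 he).1)
      rw [mem_union] at this
      tauto
    · exact Or.inr (Or.inl rfl)
    · exact Or.inr (Or.inr (Or.inl rfl))

theorem exists_repaired (hn : 0 < n) {Λ : LatinSquare n} {ω : Sample n N}
    (hfair : FairLabels ω.2) (hf : FewConflicts Λ ω) (hr : RepairSparse Λ ω) {S : Finset (Fin n)}
    (hS : S ⊆ repeats Λ ω) : ∃ Q E M, Q ⊆ lab ω.2 2 ∧ Q.card ≤ S.card ∧ E.card ≤ 2 * S.card ∧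
      Repaired Λ ω ((marked ω.2 \ repeats Λ ω) ∪ S) Q E M := by
  have hJ := isConflict_repeats Λ ω
  have hJm : repeats Λ ω ⊆ marked ω.2 := filter_subset _ _
  have hJc := card_le_of_few hf hJ hJm
  induction S using Finset.induction_on with
  | empty => exact ⟨∅, ∅, _, by simp, by simp, by simp, by
      rw [union_empty]; exact repaired_start Λ ω⟩
  | insert y S hyS ih =>
    obtain ⟨Q, E, M, g1, g2, g3, g4⟩ := ih ((subset_insert _ _).trans hS)
    have hyJ := hS (mem_insert_self _ _)
    have hSJ := card_le_card ((subset_insert _ _).trans hS)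
    have hSJ' := Nat.mul_le_mul_left (192 * N) hSJ
    have hQ' := Nat.mul_le_mul_left (192 * N) g2
    have hE' := Nat.mul_le_mul_left (192 * N) g3
    have e : 192 * N * (2 * S.card) = 2 * (192 * N * S.card) := by ring
    obtain ⟨q, q1, q2, q3, q4⟩ := exists_partner hfair hr (J := repeats Λ ω) (Q := Q) (E := E)
      hn hyJ (hf _ hJ 2 (by norm_num)) (by omega) (by omega)
    simp only [mem_sdiff] at q1
    obtain ⟨M', hM'⟩ := g4.step (y := y) (q := q) (by
      simp only [mem_union, mem_sdiff]; tauto)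
      (by
        simp only [mem_sdiff]
        exact ⟨⟨lab_subset_marked _ (by norm_num) q1.1.1, q1.1.2⟩, q1.2⟩) q2 q3 q4
    rw [card_insert_of_notMem hyS]
    have h1 := card_insert_le (Λ.sym (ω.1 q) y) (insert (Λ.sym (ω.1 y) q) E)
    have h2 := card_insert_le (Λ.sym (ω.1 y) q) E
    refine ⟨insert q Q, insert (Λ.sym (ω.1 q) y) (insert (Λ.sym (ω.1 y) q) E), M',
      insert_subset q1.1.1 g1, (card_insert_le _ _).trans (by omega), by omega, ?_⟩
    rw [union_insert]
    exact hM'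

theorem exists_diagonal_matching (hn : 0 < n) {Λ : LatinSquare n} {ω : Sample n N}
    (hfair : FairLabels ω.2) (hf : FewConflicts Λ ω) (hr : RepairSparse Λ ω) :
    ∃ M, Rainbow Λ M ∧ M.image Prod.snd = marked ω.2 ∧ M.image Prod.fst = (marked ω.2).image ω.1 ∧
      ∀ y ∈ (lab ω.2 0 ∪ lab ω.2 1) \ repeats Λ ω, (ω.1 y, y) ∈ M := by
  obtain ⟨Q, E, M, g1, -, -, g4⟩ := exists_repaired hn hfair hf hr (S := repeats Λ ω) Subset.rfl
  have e : (marked ω.2 \ repeats Λ ω) ∪ repeats Λ ω = marked ω.2 :=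
    sdiff_union_of_subset (filter_subset _ _)
  rw [e] at g4
  refine ⟨M, g4.rainbow, g4.snd, g4.fst, fun y hy => g4.diag y ?_⟩
  have hyQ : y ∉ Q := by
    intro hq
    have h1 := mem_lab.1 (g1 hq)
    simp only [mem_sdiff, mem_union, mem_lab] at hy
    omega
  simp only [mem_sdiff, mem_union, mem_lab, mem_marked] at hy ⊢
  refine ⟨⟨by omega, hy.2⟩, hyQ⟩

end Repair

section Bulk

variable {n N L k : ℕ}

/-- The rows outside `D'` which can be uncovered instead of a row of `X` by an edit of at most `i`
cells outside the columns of `D` with symbols of `K`. -/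
noncomputable def reach (Λ : LatinSquare n) (M : Finset (Fin n × Fin n))
    (D D' X K : Finset (Fin n)) (i : ℕ) : Finset (Fin n) :=
  univ.filter fun z => z ∉ D' ∧ ∃ x ∈ X, ∃ R A, RowEdit Λ M x z R A ∧ R.card ≤ i ∧
    (∀ e ∈ R, e.2 ∉ D) ∧ ∀ e ∈ A, Λ.val e ∈ K

/-- The number of symbols of `C` in the rows of `A` outside the columns of `D`. -/
noncomputable def outside (Λ : LatinSquare n) (D A C : Finset (Fin n)) : ℕ :=
  ∑ x ∈ A, (C.filter fun c => Λ.col x c ∉ D).card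

theorem reach_step {Λ : LatinSquare n} {M : Finset (Fin n × Fin n)} (hM : Rainbow Λ M)
    {D D' X K : Finset (Fin n)} {i : ℕ} {y₀ : Fin n}
    (hD : ∀ e ∈ M, e.1 ∈ D' → e.2 ∈ D)
    (hX : ∀ x ∈ X, x ∉ M.image Prod.fst ∧ x ∉ D') (hK : ∀ c ∈ K, c ∉ M.image Λ.val)
    (hmax : ∀ x ∈ X, ∀ z R A, RowEdit Λ M x z R A → (∀ e ∈ R, e.2 ∉ D) → (∀ e ∈ A, Λ.val e ∈ K) →
      ∀ c ∈ K, c ∉ A.image Λ.val → Λ.col z c ≠ y₀ → Λ.col z c ∈ M.image Prod.snd) :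
    ∃ Y : Finset (Fin n), X.card + Y.card ≤ (reach Λ M D D' X K (i + 1)).card ∧
      outside Λ D (reach Λ M D D' X K i) K ≤ (2 * i + 1) * n + outside Λ.transpose D' Y K := by
  set Y := univ.filter fun y => ∃ z', (z', y) ∈ M ∧ z' ∈ reach Λ M D D' X K (i + 1) with hY
  refine ⟨Y, ?_, ?_⟩
  · have hex : ∀ y, ∃ z', y ∈ Y → (z', y) ∈ M ∧ z' ∈ reach Λ M D D' X K (i + 1) := by
      intro y
      by_cases hy : y ∈ Y
      · obtain ⟨z', hz'⟩ := (mem_filter.1 hy).2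
        exact ⟨z', fun _ => hz'⟩
      · exact ⟨y, fun h => absurd h hy⟩
    choose g hg using hex
    have hgi : Set.InjOn g Y := by
      intro y hy y' hy' h
      have := hM.fst (hg y hy).1 (hg y' hy').1 h
      exact congrArg Prod.snd this
    have hdisj : Disjoint X (Y.image g) := by
      rw [disjoint_left]
      intro x hx hxY
      obtain ⟨y, hy, rfl⟩ := mem_image.1 hxY
      exact (hX _ hx).1 (mem_image_of_mem Prod.fst (hg y hy).1)
    rw [← card_image_of_injOn hgi, ← card_union_of_disjoint hdisj]
    refine card_le_card (union_subset ?_ ?_)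
    · intro x hx
      exact mem_filter.2 ⟨mem_univ _, (hX x hx).2, x, hx, ∅, ∅, RowEdit.refl x, by simp, by simp,
        by simp⟩
    · intro x hx
      obtain ⟨y, hy, rfl⟩ := mem_image.1 hx
      exact (hg y hy).2
  · have key : ∀ z ∈ reach Λ M D D' X K i, (K.filter fun c => Λ.col z c ∉ D).card ≤
        (2 * i + 1) + (K.filter fun c => Λ.col z c ∈ Y).card := by
      intro z hz
      obtain ⟨hzD, x, hx, R, A, hRA, hRi, hRD, hAK⟩ := (mem_filter.1 hz).2
      set b₁ := univ.filter fun c => Λ.col z c ∈ insert y₀ (R.image Prod.snd) with hb₁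
      have h1 : b₁.card ≤ i + 1 := by
        refine le_trans (card_le_card_of_injOn (Λ.col z) (fun c hc => (mem_filter.1 hc).2)
          fun c _ c' _ h => Λ.col_inj_right h) ?_
        exact (card_insert_le _ _).trans (Nat.succ_le_succ (card_image_le.trans hRi))
      have h2 : (A.image Λ.val).card ≤ i := card_image_le.trans (hRA.card.trans hRi)
      have hsub : (K.filter fun c => Λ.col z c ∉ D) ⊆ (b₁ ∪ A.image Λ.val) ∪
          K.filter fun c => Λ.col z c ∈ Y := by
        intro c hc
        rw [mem_filter] at hc
        by_contra hcon
        simp only [hb₁, mem_union, mem_filter, mem_univ, true_and, mem_insert, not_or, not_and] at hcon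
        obtain ⟨⟨⟨c1, c2⟩, c3⟩, c4⟩ := hcon
        obtain ⟨⟨z', y⟩, hzy, hy⟩ := mem_image.1 (hmax x hx z R A hRA hRD hAK c hc.1 c3 c1)
        simp only at hy
        subst hy
        refine c4 hc.1 (mem_filter.2 ⟨mem_univ _, z', hzy, mem_filter.2 ⟨mem_univ _, ?_, x, hx,
          insert (z', Λ.col z c) R, insert (z, Λ.col z c) A, ?_, ?_, ?_, ?_⟩⟩)
        · exact fun hz' => hc.2 (hD _ hzy hz')
        · refine hRA.extend hzy c2 ?_ ?_ <;> rw [Λ.sym_col]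
          · exact hK c hc.1
          · exact c3
        · exact (card_insert_le _ _).trans (Nat.succ_le_succ hRi)
        · intro e he
          rcases mem_insert.1 he with rfl | he
          · exact hc.2
          · exact hRD e he
        · intro e he
          rcases mem_insert.1 he with rfl | he
          · simp only [LatinSquare.val, Λ.sym_col]
            exact hc.1
          · exact hAK e he
      have h3 := (card_le_card hsub).trans (card_union_le _ _)
      have h4 := card_union_le b₁ (A.image Λ.val)
      omega
    have hpairs : ∑ z ∈ reach Λ M D D' X K i, (K.filter fun c => Λ.col z c ∈ Y).card ≤
        outside Λ.transpose D' Y K := by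
      rw [outside, ← card_sigma, ← card_sigma]
      refine card_le_card_of_injOn (fun p => ⟨Λ.col p.1 p.2, p.2⟩) ?_ ?_
      · rintro ⟨z, c⟩ hp
        obtain ⟨hz, hc⟩ := mem_sigma.1 hp
        obtain ⟨hcK, hcY⟩ := mem_filter.1 hc
        refine mem_sigma.2 ⟨hcY, mem_filter.2 ⟨hcK, ?_⟩⟩
        rw [LatinSquare.transpose_col, Λ.row_col]
        exact (mem_filter.1 hz).2.1
      · rintro ⟨z, c⟩ - ⟨z', c'⟩ - h
        simp only [Sigma.mk.injEq, heq_eq_eq] at h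
        obtain ⟨h1, rfl⟩ := h
        rw [Λ.col_inj_left h1]
    calc outside Λ D (reach Λ M D D' X K i) K
        ≤ ∑ z ∈ reach Λ M D D' X K i, ((2 * i + 1) + (K.filter fun c => Λ.col z c ∈ Y).card) :=
          sum_le_sum key
      _ = (reach Λ M D D' X K i).card * (2 * i + 1) +
          ∑ z ∈ reach Λ M D D' X K i, (K.filter fun c => Λ.col z c ∈ Y).card := by
          rw [sum_add_distrib, sum_const, smul_eq_mul]
      _ ≤ (2 * i + 1) * n + outside Λ.transpose D' Y K := by
          refine Nat.add_le_add ?_ hpairs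
          rw [mul_comm]
          refine Nat.mul_le_mul_left _ ?_
          simpa using card_le_univ (reach Λ M D D' X K i)

theorem abs_outside_le (h : Large n N L k) {Λ : LatinSquare n} {l : Fin n → Fin N}
    (hl : Balanced Λ l) (A C : Finset (Fin n)) :
    |(outside Λ (marked l) A C : ℝ) - (1 - 3 / N) * (A.card * C.card)| * 2 ^ (600 * L) ≤
      (n : ℝ) ^ 2 := by
  have e : (outside Λ (marked l) A C : ℝ) - (1 - 3 / N) * (A.card * C.card) =
      -∑ x ∈ A, ∑ c ∈ C, centred N (l (Λ.col x c)) := by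
    have h1 : ∀ x ∈ A, ∑ c ∈ C, centred N (l (Λ.col x c)) =
        (1 - 3 / N) * C.card - (C.filter fun c => Λ.col x c ∉ marked l).card := by
      intro x _
      have h2 : ∀ c, centred N (l (Λ.col x c)) =
          (1 - 3 / N : ℝ) - if Λ.col x c ∉ marked l then 1 else 0 := by
        intro c
        simp only [centred, mem_marked]
        by_cases h3 : (l (Λ.col x c)).val < 3 <;> simp [h3]
      simp only [h2, sum_sub_distrib, sum_const, nsmul_eq_mul, sum_boole]
      ring
    rw [sum_congr rfl h1, sum_sub_distrib, sum_const, nsmul_eq_mul, outside]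
    push_cast
    ring
  have hb := hl A C
  rw [e, abs_neg]
  set s := ∑ x ∈ A, ∑ c ∈ C, centred N (l (Λ.col x c)) with hs
  have hn : (30 : ℝ) * (2 ^ (600 * L)) ^ 4 ≤ n := by
    have h1 := h.L_pow_mul_le 2400 (by norm_num)
    have h2 : 30 * (2 ^ (600 * L)) ^ 4 ≤ n := by
      refine le_trans ?_ h1
      rw [← pow_mul, show 600 * L * 4 = 2400 * L by ring]
      refine Nat.mul_le_mul_right _ ?_
      refine le_trans ?_ (Nat.pow_le_pow_right h.L_pos (show 1 ≤ 64 by norm_num))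
      rw [pow_one]
      exact le_trans (by norm_num) h.L_ge
    exact_mod_cast h2
  refine le_of_pow_le_pow_left₀ (n := 4) (by norm_num) (by positivity) ?_
  rw [mul_pow]
  calc |s| ^ 4 * (2 ^ (600 * L)) ^ 4 ≤ 30 * (n : ℝ) ^ 7 * (2 ^ (600 * L)) ^ 4 :=
        mul_le_mul_of_nonneg_right hb (by positivity)
    _ = 30 * (2 ^ (600 * L)) ^ 4 * (n : ℝ) ^ 7 := by ring
    _ ≤ n * (n : ℝ) ^ 7 := mul_le_mul_of_nonneg_right hn (by positivity)
    _ = _ := by ring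

end Bulk

section Near

variable {n N L k : ℕ}

theorem Rainbow.card_image_fst {Λ : LatinSquare n} {M : Finset (Fin n × Fin n)}
    (hM : Rainbow Λ M) : (M.image Prod.fst).card = M.card :=
  card_image_of_injOn hM.fst

theorem Rainbow.card_image_val {Λ : LatinSquare n} {M : Finset (Fin n × Fin n)}
    (hM : Rainbow Λ M) : (M.image Λ.val).card = M.card :=
  card_image_of_injOn hM.val

theorem Rainbow.card_le {Λ : LatinSquare n} {M : Finset (Fin n × Fin n)}
    (hM : Rainbow Λ M) : M.card ≤ n := by
  rw [← hM.card_image_fst]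
  simpa using card_le_univ (M.image Prod.fst)

/-- If no edit can be completed to a larger matching, then few rows are uncovered. -/
theorem deficiency_le_of_maximal (h : Large n N L k) {Λ : LatinSquare n} {l l' : Fin n → Fin N}
    (hl : Balanced Λ l) (hl' : Balanced Λ.transpose l') {M : Finset (Fin n × Fin n)}
    (hM : Rainbow Λ M) {X K : Finset (Fin n)} {y₀ : Fin n}
    (hcX : n ≤ M.card + X.card + (2 * k + 2)) (hcK : n ≤ M.card + K.card + (2 * k + 2))
    (hD : ∀ e ∈ M, e.1 ∈ marked l' → e.2 ∈ marked l)
    (hX : ∀ x ∈ X, x ∉ M.image Prod.fst ∧ x ∉ marked l') (hK : ∀ c ∈ K, c ∉ M.image Λ.val)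
    (hmax : ∀ x ∈ X, ∀ z R A, RowEdit Λ M x z R A → (∀ e ∈ R, e.2 ∉ marked l) →
      (∀ e ∈ A, Λ.val e ∈ K) → ∀ c ∈ K, c ∉ A.image Λ.val → Λ.col z c ≠ y₀ →
        Λ.col z c ∈ M.image Prod.snd) :
    2 ^ (110 * L) * (n - M.card) ≤ n := by
  by_contra hlt
  push Not at hlt
  obtain ⟨m, hm⟩ : ∃ m, n - M.card = m := ⟨_, rfl⟩
  obtain ⟨H, hH⟩ : ∃ H, 2 ^ (110 * L) = H := ⟨_, rfl⟩
  rw [hm, hH] at hlt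
  have hn3 : 2 ^ 64 * H ^ 3 * (2 * (2 * k + 2)) ≤ n := by
    have h1 := h.L_pow_mul_le 330 (by norm_num)
    refine le_trans ?_ h1
    rw [← hH, ← pow_mul, show 110 * L * 3 = 330 * L by ring, h.k_eq]
    have h2 : 2 ^ 64 * (2 * (2 * (2 ^ 64 * L) + 2)) ≤ L ^ 64 := by
      have h3 : L ^ 3 ≤ L ^ 64 := Nat.pow_le_pow_right h.L_pos (by norm_num)
      have h4 : (2 ^ 200) ^ 2 ≤ L ^ 2 := Nat.pow_le_pow_left h.L_ge 2
      have h5 := h.L_pos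
      have h6 : (2 ^ 200) ^ 2 * L ≤ L ^ 3 := by
        rw [pow_succ L 2]
        exact Nat.mul_le_mul_right _ h4
      refine le_trans ?_ (h6.trans h3)
      norm_num
      omega
    calc 2 ^ 64 * 2 ^ (330 * L) * (2 * (2 * (2 ^ 64 * L) + 2))
        = 2 ^ 64 * (2 * (2 * (2 ^ 64 * L) + 2)) * 2 ^ (330 * L) := by ring
      _ ≤ _ := Nat.mul_le_mul_right _ h2
  have hH1 : 1 ≤ H := hH ▸ Nat.one_le_two_pow
  have hm2 : 2 * (2 * k + 2) ≤ m := by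
    by_contra hcon
    push Not at hcon
    have h1 : H * m ≤ H * (2 * (2 * k + 2)) := Nat.mul_le_mul_left _ hcon.le
    have h2 : H * (2 * (2 * k + 2)) ≤ 2 ^ 64 * H ^ 3 * (2 * (2 * k + 2)) := by
      refine Nat.mul_le_mul_right _ ?_
      calc H = 1 * H ^ 1 := by ring
        _ ≤ 2 ^ 64 * H ^ 3 := Nat.mul_le_mul (by norm_num) (Nat.pow_le_pow_right hH1 (by norm_num))
    omega
  have hXm : m ≤ 2 * X.card := by omega
  have hKm : m ≤ 2 * K.card := by omega
  have hθ : (1 / 2 : ℝ) ≤ 1 - 3 / N := by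
    rw [h.N_eq]; norm_num
  have hHR : (1 : ℝ) ≤ H := by exact_mod_cast hH1
  have hltR : (n : ℝ) ≤ H * m := by exact_mod_cast hlt.le
  have hXR : (m : ℝ) ≤ 2 * X.card := by exact_mod_cast hXm
  have hKR : (m : ℝ) ≤ 2 * K.card := by exact_mod_cast hKm
  have hnR : (2 : ℝ) ^ 64 * H ^ 3 ≤ n := by
    have : 2 ^ 64 * H ^ 3 ≤ n :=
      (Nat.le_mul_of_pos_right _ (by omega : 0 < 2 * (2 * k + 2))).trans hn3
    exact_mod_cast this
  obtain ⟨E, hE⟩ : ∃ E : ℝ, (2 : ℝ) ^ (600 * L) = E := ⟨_, rfl⟩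
  have hEH : 64 * (H : ℝ) ^ 2 ≤ E := by
    rw [← hE, ← hH]
    push_cast
    rw [← pow_mul, show (64 : ℝ) = 2 ^ 6 by norm_num, ← pow_add]
    refine pow_le_pow_right₀ (by norm_num) ?_
    have := h.L_pos
    omega
  have hE0 : 0 < E := lt_of_lt_of_le (by positivity) hEH
  have hm0 : (0 : ℝ) ≤ m := by positivity
  have hgain : ∀ i, i ≤ 4 * H →
      X.card + 2 * (reach Λ M (marked l) (marked l') X K i).card ≤
        2 * (reach Λ M (marked l) (marked l') X K (i + 1)).card := by
    intro i hi
    obtain ⟨Y, hY1, hY2⟩ := reach_step (i := i) hM hD hX hK hmax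
    have ha := abs_le.1 ((le_div_iff₀ (by positivity)).2
      (abs_outside_le h hl (reach Λ M (marked l) (marked l') X K i) K))
    have hb := abs_le.1 ((le_div_iff₀ (by positivity)).2 (abs_outside_le h hl' Y K))
    rw [hE] at ha hb
    generalize outside Λ (marked l) (reach Λ M (marked l) (marked l') X K i) K = o at *
    generalize outside Λ.transpose (marked l') Y K = o' at *
    generalize (reach Λ M (marked l) (marked l') X K i).card = a at *
    generalize (reach Λ M (marked l) (marked l') X K (i + 1)).card = a' at *
    generalize Y.card = yc at *
    generalize X.card = xc at *
    generalize K.card = kc at *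
    generalize (1 - 3 / (N : ℝ)) = θ at *
    have hY2R : (o : ℝ) ≤ (2 * i + 1) * n + o' := by exact_mod_cast hY2
    have hiR : (i : ℝ) ≤ 4 * H := by exact_mod_cast hi
    have key : 2 * ((a : ℝ) - yc) ≤ xc := by
      by_contra hcon
      push Not at hcon
      have h1 : θ * kc * (a - yc) ≤ 2 * ((n : ℝ) ^ 2 / E) + (2 * i + 1) * n := by
        nlinarith [ha.1, hb.2]
      have h2 : (m : ℝ) ^ 2 / 16 ≤ θ * kc * (a - yc) := by
        have h3 : (m : ℝ) / 4 ≤ θ * kc := by nlinarith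
        have h4 : (m : ℝ) / 4 ≤ a - yc := by linarith
        calc (m : ℝ) ^ 2 / 16 = m / 4 * (m / 4) := by ring
          _ ≤ _ := mul_le_mul h3 h4 (by positivity) (by nlinarith)
      have h3 : (n : ℝ) ^ 2 / E ≤ n ^ 2 / (64 * H ^ 2) :=
        div_le_div_of_nonneg_left (by positivity) (by positivity) hEH
      have h4 : (2 * (i : ℝ) + 1) * n * H ^ 2 ≤ 9 * (H ^ 3 * n) := by
        have : 2 * (i : ℝ) + 1 ≤ 9 * H := by linarith
        calc (2 * (i : ℝ) + 1) * n * H ^ 2 ≤ 9 * H * n * H ^ 2 := by gcongr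
          _ = _ := by ring
      have h5 : (2 : ℝ) ^ 64 * (H ^ 3 * n) ≤ n ^ 2 := by nlinarith
      have h6 : (n : ℝ) ^ 2 ≤ H ^ 2 * m ^ 2 := by
        rw [← mul_pow]
        exact pow_le_pow_left₀ (by positivity) hltR 2
      have h7 : (0 : ℝ) < H ^ 3 * n := by
        have : (0 : ℝ) < n := by exact_mod_cast h.n_pos
        positivity
      have h8 : (n : ℝ) ^ 2 / (64 * H ^ 2) * H ^ 2 = n ^ 2 / 64 := by
        field_simp
      have h9 : (m : ℝ) ^ 2 / 16 * H ^ 2 ≤ (2 * ((n : ℝ) ^ 2 / (64 * H ^ 2)) + (2 * i + 1) * n) * H ^ 2 :=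
        mul_le_mul_of_nonneg_right (by linarith) (by positivity)
      rw [add_mul, mul_assoc 2, h8] at h9
      linarith
    have key' : 2 * a ≤ xc + 2 * yc := by
      have : (2 * a : ℝ) ≤ xc + 2 * yc := by linarith
      exact_mod_cast this
    omega
  have hind : ∀ i, i ≤ 4 * H → i * X.card ≤ 2 * (reach Λ M (marked l) (marked l') X K i).card := by
    intro i
    induction i with
    | zero => simp
    | succ i ih =>
      intro hi
      have h1 := ih (by omega)
      have h2 := hgain i (by omega)
      rw [Nat.succ_mul]
      omega
  have h1 := hind (4 * H) le_rfl
  have h2 : (reach Λ M (marked l) (marked l') X K (4 * H)).card ≤ n := by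
    simpa using card_le_univ (reach Λ M (marked l) (marked l') X K (4 * H))
  have h3 : H * m ≤ H * (2 * X.card) := Nat.mul_le_mul_left _ hXm
  have h4 : 4 * H * X.card = 2 * (H * (2 * X.card)) := by ring
  omega

theorem exists_near_matching (h : Large n N L k) {Λ : LatinSquare n} {l l' : Fin n → Fin N}
    (hl : Balanced Λ l) (hl' : Balanced Λ.transpose l') {M₁ : Finset (Fin n × Fin n)}
    (hM₁ : Rainbow Λ M₁) (hsnd : M₁.image Prod.snd = marked l)
    (hfst : M₁.image Prod.fst = marked l') {x y : Fin n} (hx : x ∉ M₁.image Prod.fst)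
    (hy : y ∉ M₁.image Prod.snd) {Q : Finset (Fin n)} (hQ : Q.card ≤ 2 * k + 2)
    (hQM : Disjoint Q (M₁.image Λ.val)) :
    ∃ M, M₁ ⊆ M ∧ Rainbow Λ M ∧ x ∉ M.image Prod.fst ∧ y ∉ M.image Prod.snd ∧
      Disjoint Q (M.image Λ.val) ∧ 2 ^ (110 * L) * (n - M.card) ≤ n := by
  obtain ⟨M, hMS, hMmax⟩ := exists_max_image
    (univ.filter fun M : Finset (Fin n × Fin n) => M₁ ⊆ M ∧ Rainbow Λ M ∧ x ∉ M.image Prod.fst ∧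
      y ∉ M.image Prod.snd ∧ Disjoint Q (M.image Λ.val)) card
    ⟨M₁, mem_filter.2 ⟨mem_univ _, Subset.rfl, hM₁, hx, hy, hQM⟩⟩
  obtain ⟨hsub, hM, hxM, hyM, hQd⟩ := (mem_filter.1 hMS).2
  refine ⟨M, hsub, hM, hxM, hyM, hQd, ?_⟩
  set X := (univ \ M.image Prod.fst).erase x with hXdef
  set K := univ \ (M.image Λ.val ∪ Q) with hKdef
  have hcX : X.card + 1 + M.card = n := by
    rw [hXdef, card_erase_add_one (by simpa using hxM), card_sdiff_of_subset (subset_univ _),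
      hM.card_image_fst, card_univ, Fintype.card_fin]
    exact Nat.sub_add_cancel hM.card_le
  have hcK : n ≤ M.card + K.card + (2 * k + 2) := by
    have h1 := card_union_le (M.image Λ.val) Q
    rw [hM.card_image_val] at h1
    rw [hKdef, card_sdiff_of_subset (subset_univ _), card_univ, Fintype.card_fin]
    omega
  have hXmem : ∀ z ∈ X, z ≠ x ∧ z ∉ M.image Prod.fst := by
    intro z hz
    rw [hXdef, mem_erase, mem_sdiff] at hz
    exact ⟨hz.1, hz.2.2⟩
  have hKmem : ∀ c ∈ K, c ∉ M.image Λ.val ∧ c ∉ Q := by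
    intro c hc
    rw [hKdef, mem_sdiff, mem_union, not_or] at hc
    exact hc.2
  refine deficiency_le_of_maximal h hl hl' hM (X := X) (K := K) (y₀ := y) (by omega) hcK ?_ ?_
    (fun c hc => (hKmem c hc).1) ?_
  · intro e he he1
    rw [← hfst] at he1
    obtain ⟨e', he', hee⟩ := mem_image.1 he1
    rw [← hM.fst (hsub he') he hee, ← hsnd]
    exact mem_image_of_mem _ he'
  · intro z hz
    refine ⟨(hXmem z hz).2, fun hz' => (hXmem z hz).2 ?_⟩
    rw [← hfst] at hz'
    exact image_subset_image hsub hz'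
  · intro x' hx' z R A hRA hRD hAK c hc hcA hcy
    by_contra hw
    obtain ⟨hM', hcard, hf, hs⟩ := hRA.augment hM (hXmem x' hx').2 hw
      (by rw [Λ.sym_col]; exact (hKmem c hc).1) (by rw [Λ.sym_col]; exact hcA)
    have := hMmax _ (mem_filter.2 ⟨mem_univ _, ?_, hM', ?_, ?_, ?_⟩)
    · omega
    · intro e he
      refine mem_union_left _ (mem_sdiff.2 ⟨hsub he, fun heR => hRD e heR ?_⟩)
      rw [← hsnd]
      exact mem_image_of_mem _ he
    · rw [hf, mem_insert, not_or]
      exact ⟨(hXmem x' hx').1.symm, hxM⟩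
    · rw [hs, mem_insert, not_or]
      exact ⟨Ne.symm hcy, hyM⟩
    · rw [disjoint_left]
      intro q hq hq'
      obtain ⟨e, he, rfl⟩ := mem_image.1 hq'
      rcases mem_union.1 he with he | he
      · exact disjoint_left.1 hQd hq (mem_image_of_mem _ (mem_sdiff.1 he).1)
      · rcases mem_insert.1 he with rfl | he
        · simp only [LatinSquare.val, Λ.sym_col] at hq
          exact (hKmem c hc).2 hq
        · exact (hKmem _ (hAK e he)).2 hq

end Near

section Augment

variable {n N L k : ℕ}

/-- The diagonal cells of `σ` in the columns of `S`. -/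
noncomputable def diag (σ : Equiv.Perm (Fin n)) (S : Finset (Fin n)) : Finset (Fin n × Fin n) :=
  S.image fun y => (σ y, y)

theorem mem_diag {σ : Equiv.Perm (Fin n)} {S : Finset (Fin n)} {e : Fin n × Fin n} :
    e ∈ diag σ S ↔ e.2 ∈ S ∧ e.1 = σ e.2 := by
  simp only [diag, mem_image]
  constructor
  · rintro ⟨y, hy, rfl⟩
    exact ⟨hy, rfl⟩
  · rintro ⟨h1, h2⟩
    exact ⟨e.2, h1, by rw [← h2]⟩

/-- A row `x` uncovered by `M`, together with free symbols from which short edits can start. -/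
structure Ready (L k : ℕ) (Λ : LatinSquare n) (σ : Equiv.Perm (Fin n)) (F W V : Finset (Fin n))
    (M : Finset (Fin n × Fin n)) (x c : Fin n) (C : Finset (Fin n)) : Prop where
  diag_sub : diag σ ((F \ W) \ V) ⊆ M
  card_V : V.card ≤ 4 * L
  row : x ∉ M.image Prod.fst
  symbol : c ∉ M.image Λ.val
  card_palette : C.card = k
  palette : Disjoint C (M.image Λ.val)
  symbol_notMem : c ∉ C
  col : Λ.col x c ∈ (F \ W) \ V
  fertile : Fertile L k Λ σ F W C (σ (Λ.col x c))

variable {Λ : LatinSquare n} {σ : Equiv.Perm (Fin n)} {F W V : Finset (Fin n)}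
  {M : Finset (Fin n × Fin n)} {x c : Fin n} {C : Finset (Fin n)}

/-- The data of a short edit uncovering `z`, whose removed cells are diagonal except for one cell
outside `P`. -/
structure ShortEdit (L : ℕ) (Λ : LatinSquare n) (σ : Equiv.Perm (Fin n)) (P G Q T : Finset (Fin n))
    (M : Finset (Fin n × Fin n)) (x z w : Fin n) (S : Finset (Fin n)) (A : Finset (Fin n × Fin n)) :
    Prop where
  edit : RowEdit Λ M x z (insert (z, w) (diag σ S)) A
  notMem : w ∉ P
  sub : S ⊆ G
  card : S.card ≤ 4 * L
  val_sub : A.image Λ.val ⊆ Q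
  exists_mem : ∃ y ∈ T, y ∈ S

/-- The rows which a diagonal edit with `i + 1` removed cells uncovers. -/
noncomputable def uncovered (Λ : LatinSquare n) (σ : Equiv.Perm (Fin n)) (G Q : Finset (Fin n))
    (M : Finset (Fin n × Fin n)) (x : Fin n) (i : ℕ) : Finset (Fin n) :=
  univ.filter fun z => ∃ S A, RowEdit Λ M x z (diag σ S) A ∧ S.card ≤ i + 1 ∧ S ⊆ G ∧
    σ⁻¹ z ∈ S ∧ A.image Λ.val ⊆ Q

theorem image_snd_diag (S : Finset (Fin n)) : (diag σ S).image Prod.snd = S := by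
  rw [diag, image_image]
  exact image_id

theorem card_diag (S : Finset (Fin n)) : (diag σ S).card = S.card :=
  card_image_of_injective _ fun _ _ h => congrArg Prod.snd h

theorem diag_insert (S : Finset (Fin n)) (y : Fin n) :
    diag σ (insert y S) = insert (σ y, y) (diag σ S) := image_insert _ _ _

/-- One more step of a diagonal edit. -/
theorem uncovered_step (hdiag : diag σ ((F \ W) \ V) ⊆ M) {Q : Finset (Fin n)} {i : ℕ} {z : Fin n}
    {S : Finset (Fin n)} {A : Finset (Fin n × Fin n)}
    (hRA : RowEdit Λ M x z (diag σ S) A) (hc : S.card ≤ i + 1) (hS : S ⊆ (F \ W) \ V)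
    (hA : A.image Λ.val ⊆ Q) {d : Fin n} (hd : d ∉ M.image Λ.val) (hdQ : d ∈ Q)
    (hdA : d ∉ A.image Λ.val) (hdS : Λ.col z d ∉ S) (hdG : Λ.col z d ∈ (F \ W) \ V) :
    σ (Λ.col z d) ∈ uncovered Λ σ ((F \ W) \ V) Q M x (i + 1) := by
  refine mem_filter.2 ⟨mem_univ _, insert (Λ.col z d) S, insert (z, Λ.col z d) A, ?_,
    (card_insert_le _ _).trans (Nat.succ_le_succ hc), insert_subset hdG hS, ?_, ?_⟩
  · rw [diag_insert]
    refine hRA.extend (hdiag (mem_diag.2 ⟨hdG, rfl⟩)) ?_ ?_ ?_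
    · rwa [image_snd_diag]
    · rwa [Λ.sym_col]
    · rwa [Λ.sym_col]
  · simp
  · rw [image_insert]
    refine insert_subset ?_ hA
    simpa only [LatinSquare.val, Λ.sym_col] using hdQ

theorem Ready.exists_edits (h : Large n N L k) (hr : Ready L k Λ σ F W V M x c C)
    (hM : Rainbow Λ M) {P : Finset (Fin n)} (hFP : F ⊆ P) {C' Rem : Finset (Fin n)}
    (hC' : C'.card = k) (hC'M : Disjoint C' (M.image Λ.val)) (hcC' : c ∉ C')
    (hCC' : Disjoint C C') (hRem : 2 ^ (50 * L) * Rem.card ≤ n) :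
    ∃ Z : Finset (Fin n), 9 * n ≤ 16 * (Z.card + ((n - M.card) + P.card)) ∧
      ∀ z ∈ Z, ∃ w S A, ShortEdit L Λ σ P ((F \ W) \ V) (insert c C ∪ C')
        (((F \ W) \ V) \ Rem) M x z w S A := by
  have hL := h.L_ge
  have hL6 : L + 6 ≤ 2 * L := by
    have : 6 ≤ L := le_trans (by norm_num) hL
    omega
  set G := (F \ W) \ V with hG
  have hGF : G ⊆ F := fun y hy => (mem_sdiff.1 (mem_sdiff.1 hy).1).1
  have hex : ∀ i z, ∃ S A, z ∈ uncovered Λ σ G (insert c C) M x i →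
      RowEdit Λ M x z (diag σ S) A ∧ S.card ≤ i + 1 ∧ S ⊆ G ∧ σ⁻¹ z ∈ S ∧
        A.image Λ.val ⊆ insert c C := by
    intro i z
    by_cases hz : z ∈ uncovered Λ σ G (insert c C) M x i
    · obtain ⟨S, A, hSA⟩ := (mem_filter.1 hz).2
      exact ⟨S, A, fun _ => hSA⟩
    · exact ⟨∅, ∅, fun h => absurd h hz⟩
  choose S A hSA using hex
  have htr : Trails L Λ σ C (F \ W) V (uncovered Λ σ G (insert c C) M x)
      (fun i z => (A i z).image Λ.val ∪ (S i z).image (Λ.sym z)) := by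
    refine ⟨hr.card_V, ?_, ?_⟩
    · intro i hi z hz
      obtain ⟨h1, h2, -⟩ := hSA i z hz
      have h3 := h1.card
      rw [card_diag] at h3
      have h4 := card_union_le ((A i z).image Λ.val) ((S i z).image (Λ.sym z))
      have h5 : ((A i z).image Λ.val).card ≤ (A i z).card := card_image_le
      have h6 : ((S i z).image (Λ.sym z)).card ≤ (S i z).card := card_image_le
      omega
    · intro i hi z hz d hd hdU hdF hdV
      obtain ⟨h1, h2, h3, -, h5⟩ := hSA i z hz
      rw [mem_union, not_or] at hdU
      refine uncovered_step hr.diag_sub h1 h2 h3 h5 (disjoint_left.1 hr.palette hd)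
        (mem_insert_of_mem hd) hdU.1 (fun hm => hdU.2 ?_) (mem_sdiff.2 ⟨hdF, hdV⟩)
      exact mem_image.2 ⟨_, hm, Λ.sym_col _ _⟩
  have hstart : σ (Λ.col x c) ∈ uncovered Λ σ G (insert c C) M x 0 := by
    refine mem_filter.2 ⟨mem_univ _, insert (Λ.col x c) ∅, insert (x, Λ.col x c) ∅, ?_,
      by simp, by simpa only [insert_empty_eq, singleton_subset_iff] using hr.col, by simp, ?_⟩
    · rw [diag_insert]
      refine RowEdit.extend (RowEdit.refl x) (hr.diag_sub (mem_diag.2 ⟨hr.col, rfl⟩)) (by simp) ?_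
        (by simp)
      rw [Λ.sym_col]
      exact hr.symbol
    · simp [LatinSquare.val, Λ.sym_col]
  obtain ⟨i, hi, T, hT, hTA, hbig⟩ := hr.fertile C' V Rem _ _ hC' htr hstart hRem
  set Y := Λ.nbr C' (T.image σ) with hY
  set Y' := (Y \ P) ∩ M.image Prod.snd with hY'
  have hexw : ∀ w, ∃ z, w ∈ M.image Prod.snd → (z, w) ∈ M := by
    intro w
    by_cases hw : w ∈ M.image Prod.snd
    · obtain ⟨⟨z, w'⟩, he, rfl⟩ := mem_image.1 hw
      exact ⟨z, fun _ => he⟩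
    · exact ⟨w, fun h => absurd h hw⟩
  choose g hg using hexw
  have hginj : Set.InjOn g Y' := by
    intro w hw w' hw' hww
    have := hM.fst (hg w (mem_inter.1 hw).2) (hg w' (mem_inter.1 hw').2) hww
    exact congrArg Prod.snd this
  refine ⟨Y'.image g, ?_, ?_⟩
  · rw [card_image_of_injOn hginj]
    have h1 : Y ⊆ (Y' ∪ univ \ M.image Prod.snd) ∪ P := by
      intro w hw
      simp only [hY', mem_union, mem_inter, mem_sdiff, mem_univ, true_and]
      tauto
    have h2 := card_le_card h1
    have h3 := card_union_le (Y' ∪ univ \ M.image Prod.snd) P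
    have h4 := card_union_le Y' (univ \ M.image Prod.snd)
    have h5 : (univ \ M.image Prod.snd).card = n - M.card := by
      rw [card_sdiff_of_subset (subset_univ _), card_image_of_injOn hM.snd, card_univ,
        Fintype.card_fin]
    omega
  · intro z hz
    obtain ⟨w, hw, rfl⟩ := mem_image.1 hz
    obtain ⟨hwY, hwM⟩ := mem_inter.1 hw
    obtain ⟨hwY, hwP⟩ := mem_sdiff.1 hwY
    obtain ⟨u, hu, d, hd, hud⟩ := Λ.mem_nbr.1 hwY
    obtain ⟨y, hyT, rfl⟩ := mem_image.1 hu
    obtain ⟨h1, h2, h3, h4', h5⟩ := hSA i (σ y) (hTA y hyT)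
    have h4 : y ∈ S i (σ y) := by simpa using h4'
    have hsym : Λ.sym (σ y) w = d := by rw [← hud, Λ.sym_col]
    refine ⟨w, S i (σ y), insert (σ y, w) (A i (σ y)), ⟨?_, hwP, h3, by omega, ?_, y, ?_, h4⟩⟩
    · refine h1.extend (hg w hwM) ?_ ?_ ?_
      · rw [image_snd_diag]
        exact fun hh => hwP (hFP (hGF (h3 hh)))
      · rw [hsym]
        exact disjoint_left.1 hC'M hd
      · rw [hsym]
        intro hh
        rcases mem_insert.1 (h5 hh) with rfl | hh
        · exact hcC' hd
        · exact disjoint_left.1 hCC' hh hd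
    · rw [image_insert]
      refine insert_subset (mem_union_right _ ?_) (h5.trans subset_union_left)
      rw [LatinSquare.val, hsym]
      exact hd
    · exact hT hyT

end Augment

section Join

variable {n N L k : ℕ}

theorem image_swap_swap (S : Finset (Fin n × Fin n)) :
    (S.image Prod.swap).image Prod.swap = S := by
  ext e
  rw [mem_image_swap, mem_image_swap, Prod.swap_swap]

theorem card_image_swap (S : Finset (Fin n × Fin n)) : (S.image Prod.swap).card = S.card :=
  card_image_of_injective _ Prod.swap_injective

variable {Λ : LatinSquare n} {σ : Equiv.Perm (Fin n)} {F W V F' W' V' : Finset (Fin n)}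
  {M : Finset (Fin n × Fin n)} {x c y c' : Fin n} {C C' : Finset (Fin n)}

/-- The outcome of one augmentation: only few diagonal cells are lost on either side, and each side
releases a symbol of a prescribed kind. -/
structure Augmented (L : ℕ) (Λ : LatinSquare n) (σ : Equiv.Perm (Fin n))
    (G T G' T' Q S S' : Finset (Fin n)) (M M' : Finset (Fin n × Fin n)) (x y : Fin n) : Prop where
  rainbow : Rainbow Λ M'
  card : M'.card = M.card + 1
  fst : M'.image Prod.fst = insert x (M.image Prod.fst)
  snd : M'.image Prod.snd = insert y (M.image Prod.snd)
  val_sub : M'.image Λ.val ⊆ M.image Λ.val ∪ Q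
  card_row : S.card ≤ 4 * L
  card_col : S'.card ≤ 4 * L
  diag_row : diag σ (G \ S) ⊆ M'
  diag_col : diag σ⁻¹ (G' \ S') ⊆ M'.image Prod.swap
  released_row : ∃ b ∈ T, Λ.sym (σ b) b ∉ M'.image Λ.val
  released_col : ∃ b ∈ T', Λ.transpose.sym (σ⁻¹ b) b ∉ M'.image Λ.val

theorem Ready.exists_augmented (h : Large n N L k) (hr : Ready L k Λ σ F W V M x c C)
    (hr' : Ready L k Λ.transpose σ⁻¹ F' W' V' (M.image Prod.swap) y c' C')
    (hM : Rainbow Λ M) {P P' : Finset (Fin n)} (hFP : F ⊆ P) (hFP' : F' ⊆ P')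
    (hPP : P' = P.image σ) (hFF : ∀ b ∈ F, σ b ∉ F')
    (hsmall : 16 * ((n - M.card) + P.card) < n) {E E' Rem Rem' : Finset (Fin n)} {m : Fin n}
    (hE : E.card = k) (hEM : Disjoint E (M.image Λ.val)) (hcE : c ∉ E) (hCE : Disjoint C E)
    (hE' : E'.card = k) (hEM' : Disjoint E' (M.image Λ.val)) (hcE' : c' ∉ E')
    (hCE' : Disjoint C' E') (hQQ : Disjoint (insert c C ∪ E) (insert c' C' ∪ E'))
    (hm : m ∉ M.image Λ.val) (hmQ : m ∉ insert c C ∪ E) (hmQ' : m ∉ insert c' C' ∪ E')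
    (hRem : 2 ^ (50 * L) * Rem.card ≤ n) (hRem' : 2 ^ (50 * L) * Rem'.card ≤ n) :
    ∃ M' S S', Augmented L Λ σ ((F \ W) \ V) (((F \ W) \ V) \ Rem) ((F' \ W') \ V')
      (((F' \ W') \ V') \ Rem') (insert m ((insert c C ∪ E) ∪ (insert c' C' ∪ E'))) S S' M M' x y := by
  obtain ⟨Z, hZ, hZe⟩ := hr.exists_edits h hM hFP hE hEM hcE hCE hRem
  obtain ⟨Z', hZ', hZe'⟩ := hr'.exists_edits h hM.swap hFP' hE' (by rwa [image_val_swap]) hcE' hCE'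
    hRem'
  set G := (F \ W) \ V with hG
  set G' := (F' \ W') \ V' with hG'
  have hGF : G ⊆ F := fun y hy => (mem_sdiff.1 (mem_sdiff.1 hy).1).1
  have hGF' : G' ⊆ F' := fun y hy => (mem_sdiff.1 (mem_sdiff.1 hy).1).1
  have hPc : P'.card = P.card := by rw [hPP, card_image_of_injective _ σ.injective]
  rw [card_image_swap, hPc] at hZ'
  obtain ⟨w, hw, hwZ'⟩ : ∃ w, w ∈ Z.image (fun z => Λ.col z m) ∧ w ∈ Z' := by
    by_contra hcon
    push Not at hcon
    have h1 : Disjoint (Z.image fun z => Λ.col z m) Z' := disjoint_left.2 hcon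
    have h2 : (Z.image fun z => Λ.col z m).card = Z.card :=
      card_image_of_injective _ fun _ _ => Λ.col_inj_left
    have h3 := card_le_univ ((Z.image fun z => Λ.col z m) ∪ Z')
    rw [card_union_of_disjoint h1, h2, Fintype.card_fin] at h3
    omega
  obtain ⟨z, hz, rfl⟩ := mem_image.1 hw
  obtain ⟨w₁, S, A, he⟩ := hZe z hz
  obtain ⟨z₁, S', A', he'⟩ := hZe' _ hwZ'
  have hsym : Λ.sym z (Λ.col z m) = m := Λ.sym_col _ _
  obtain ⟨R, hR⟩ : ∃ R, insert (z, w₁) (diag σ S) = R := ⟨_, rfl⟩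
  obtain ⟨R', hR'⟩ : ∃ R', (insert (Λ.col z m, z₁) (diag σ⁻¹ S')).image Prod.swap = R' := ⟨_, rfl⟩
  have hedit : RowEdit Λ M x z R A := hR ▸ he.edit
  have hedit' : RowEdit Λ.transpose (M.image Prod.swap) y (Λ.col z m) (R'.image Prod.swap)
      ((A'.image Prod.swap).image Prod.swap) := by
    rw [← hR', image_swap_swap, image_swap_swap]
    exact he'.edit
  have hval' : (A'.image Prod.swap).image Λ.val = A'.image Λ.transpose.val := by
    rw [image_image]; rfl
  have hmemR : ∀ e ∈ R, e = (z, w₁) ∨ (e.2 ∈ S ∧ e.1 = σ e.2) := by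
    intro e he
    rw [← hR, mem_insert, mem_diag] at he
    exact he
  have hmemR' : ∀ e ∈ R', e = (z₁, Λ.col z m) ∨ (e.1 ∈ S' ∧ e.2 = σ⁻¹ e.1) := by
    intro e he
    rw [← hR', mem_image_swap, mem_insert, mem_diag] at he
    rcases he with he | he
    · left; rw [← Prod.swap_swap e, he]; rfl
    · exact Or.inr he
  have hzP : z₁ ∉ P' := he'.notMem
  have hdiagR : ∀ b ∈ F, (σ b, b) ∈ R → b ∈ S := by
    intro b hb hbR
    rcases hmemR _ hbR with h1 | h1
    · have h2 : b = w₁ := congrArg Prod.snd h1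
      exact absurd (hFP hb) (h2 ▸ he.notMem)
    · exact h1.1
  have hdiagR' : ∀ b ∈ F', (b, σ⁻¹ b) ∈ R' → b ∈ S' := by
    intro b hb hbR
    rcases hmemR' _ hbR with h1 | h1
    · have h2 : b = z₁ := congrArg Prod.fst h1
      exact absurd (hFP' hb) (h2 ▸ hzP)
    · exact h1.1
  have hnotR' : ∀ b ∈ F, (σ b, b) ∉ R' := by
    intro b hb hbR
    rcases hmemR' _ hbR with h1 | h1
    · refine hzP ?_
      have h2 : σ b = z₁ := congrArg Prod.fst h1
      rw [← h2, hPP]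
      exact mem_image_of_mem _ (hFP hb)
    · exact hFF b hb (hGF' (he'.sub h1.1))
  have hnotR : ∀ b ∈ F', (b, σ⁻¹ b) ∉ R := by
    intro b hb hbR
    rcases hmemR _ hbR with h1 | h1
    · refine he.notMem ?_
      have hb' := hFP' hb
      rw [hPP, mem_image] at hb'
      obtain ⟨p, hp, rfl⟩ := hb'
      have h2 : σ⁻¹ (σ p) = w₁ := congrArg Prod.snd h1
      rw [← h2]
      simpa using hp
    · refine hFF _ (hGF (he.sub h1.1)) ?_
      simpa using hb
  have hRR : Disjoint R R' := by
    rw [disjoint_left]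
    intro e heR heR'
    rcases hmemR e heR with h1 | ⟨h1, h2⟩
    · rcases hmemR' e heR' with h3 | ⟨h3, h4⟩
      · have h4 := hm
        rw [← hsym] at h4
        refine h4 (mem_image.2 ⟨e, hedit.sub heR, ?_⟩)
        have h5 : e.1 = z := congrArg Prod.fst h1
        have h6 : e.2 = Λ.col z m := congrArg Prod.snd h3
        rw [LatinSquare.val, h5, h6]
      · have h5 := hGF' (he'.sub h3)
        exact hnotR _ h5 (by rw [← h4]; exact heR)
    · have h5 := hGF (he.sub h1)
      exact hnotR' _ h5 (by rw [← h2]; exact heR')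
  obtain ⟨j1, j2, j3, j4⟩ := hedit.join hM hedit' hr.row
    (by have := hr'.row; rwa [image_fst_swap] at this) hRR
    (by rw [hval']; exact disjoint_of_subset_left he.val_sub (disjoint_of_subset_right he'.val_sub hQQ))
    (by rwa [hsym]) (by rw [hsym]; exact fun hh => hmQ (he.val_sub hh))
    (by rw [hsym, hval']; exact fun hh => hmQ' (he'.val_sub hh))
  have hnewval : ∀ e ∈ insert (z, Λ.col z m) (A ∪ A'.image Prod.swap),
      Λ.val e ∈ insert m ((insert c C ∪ E) ∪ (insert c' C' ∪ E')) ∧ Λ.val e ∉ M.image Λ.val := by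
    intro e hee
    rcases mem_insert.1 hee with rfl | hee
    · rw [LatinSquare.val, hsym]
      exact ⟨mem_insert_self _ _, hm⟩
    · rcases mem_union.1 hee with hee | hee
      · exact ⟨mem_insert_of_mem (mem_union_left _ (he.val_sub (mem_image_of_mem _ hee))),
          hedit.new e hee⟩
      · have h1 : Λ.val e ∈ A'.image Λ.transpose.val := by
          rw [← hval']
          exact mem_image_of_mem _ hee
        refine ⟨mem_insert_of_mem (mem_union_right _ (he'.val_sub h1)), ?_⟩
        have := hedit'.new e.swap (mem_image_of_mem _ hee)
        rwa [image_val_swap] at this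
  have hrel : ∀ e ∈ R ∪ R', Λ.val e ∉ ((M \ (R ∪ R')) ∪
      insert (z, Λ.col z m) (A ∪ A'.image Prod.swap)).image Λ.val := by
    intro e heR hcon
    have heM : e ∈ M := by
      rcases mem_union.1 heR with h1 | h1
      · exact hedit.sub h1
      · have := hedit'.sub (mem_image_of_mem _ h1)
        rwa [mem_image_swap, Prod.swap_swap] at this
    obtain ⟨d, hd, hde⟩ := mem_image.1 hcon
    rcases mem_union.1 hd with h1 | h1
    · obtain ⟨h2, h3⟩ := mem_sdiff.1 h1
      exact h3 (hM.val h2 heM hde ▸ heR)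
    · exact (hnewval d h1).2 (hde ▸ mem_image_of_mem _ heM)
  refine ⟨_, S, S', j1, j2, j3, j4, ?_, he.card, he'.card, ?_, ?_, ?_, ?_⟩
  · intro v hv
    obtain ⟨e, hee, rfl⟩ := mem_image.1 hv
    rcases mem_union.1 hee with h1 | h1
    · exact mem_union_left _ (mem_image_of_mem _ (mem_sdiff.1 h1).1)
    · exact mem_union_right _ (hnewval e h1).1
  · intro e hee
    obtain ⟨h1, h2⟩ := mem_diag.1 hee
    obtain ⟨h3, h4⟩ := mem_sdiff.1 h1
    have h5 : e = (σ e.2, e.2) := by rw [← h2]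
    refine mem_union_left _ (mem_sdiff.2 ⟨hr.diag_sub (mem_diag.2 ⟨h3, h2⟩), fun h6 => ?_⟩)
    rw [h5] at h6
    rcases mem_union.1 h6 with h6 | h6
    · exact h4 (hdiagR _ (hGF h3) h6)
    · exact hnotR' _ (hGF h3) h6
  · intro e hee
    obtain ⟨h1, h2⟩ := mem_diag.1 hee
    obtain ⟨h3, h4⟩ := mem_sdiff.1 h1
    have h5 : e.swap = (e.2, σ⁻¹ e.2) := by rw [← h2]; rfl
    rw [mem_image_swap]
    have h7 := hr'.diag_sub (mem_diag.2 ⟨h3, h2⟩)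
    rw [mem_image_swap] at h7
    refine mem_union_left _ (mem_sdiff.2 ⟨h7, fun h6 => ?_⟩)
    rw [h5] at h6
    rcases mem_union.1 h6 with h6 | h6
    · exact hnotR _ (hGF' h3) h6
    · exact h4 (hdiagR' _ (hGF' h3) h6)
  · obtain ⟨b, hb, hbS⟩ := he.exists_mem
    refine ⟨b, hb, hrel (σ b, b) (mem_union_left _ ?_)⟩
    rw [← hR]
    exact mem_insert_of_mem (mem_diag.2 ⟨hbS, rfl⟩)
  · obtain ⟨b, hb, hbS⟩ := he'.exists_mem
    refine ⟨b, hb, hrel (b, σ⁻¹ b) (mem_union_right _ ?_)⟩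
    rw [← hR', mem_image_swap]
    exact mem_insert_of_mem (mem_diag.2 ⟨hbS, rfl⟩)

end Join

section Next

variable {n N L k : ℕ}

theorem Large.k_mul_two_pow_le (h : Large n N L k) : 4 * k * 2 ^ (50 * L) ≤ 2 ^ (60 * L) := by
  have h1 : 4 * k ≤ L ^ 64 := by
    refine le_trans ?_ (Nat.pow_le_pow_right h.L_pos (show 2 ≤ 64 by norm_num))
    rw [h.k_eq, pow_two, ← mul_assoc]
    exact Nat.mul_le_mul_right _ (le_trans (by norm_num) h.L_ge)
  calc 4 * k * 2 ^ (50 * L) ≤ 2 ^ L * 2 ^ (50 * L) := Nat.mul_le_mul_right _ (h1.trans h.L_pow_le)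
    _ = 2 ^ (51 * L) := by rw [← pow_add]; congr 1; ring
    _ ≤ 2 ^ (60 * L) := Nat.pow_le_pow_right (by norm_num) (by omega)

/-- The columns of `G` whose diagonal symbol leads from few rows of `X` to usable columns. -/
noncomputable def unusable (L : ℕ) (Λ : LatinSquare n) (σ : Equiv.Perm (Fin n))
    (F G W B X : Finset (Fin n)) : Finset (Fin n) :=
  G.filter fun b => (X.filter fun x => Λ.col x (Λ.sym (σ b) b) ∈ F \ W ∧
    σ (Λ.col x (Λ.sym (σ b) b)) ∉ B).card ≤ 4 * L

variable {Λ : LatinSquare n} {σ : Equiv.Perm (Fin n)} {M : Finset (Fin n × Fin n)}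

theorem Side.card_unusable_le (h : Large n N L k) {l : Fin n → Fin N} {a : ℕ}
    {J : Finset (Fin n)} (hS : Side N L k Λ σ l a J) (hM : Rainbow Λ M) {G W B X : Finset (Fin n)}
    (hG : diag σ G ⊆ M) (hX : X.card = k) (hW : 2 ^ (60 * L) * W.card ≤ n)
    (hB : 2 ^ (60 * L) * B.card ≤ n) :
    2 ^ (50 * L) * (unusable L Λ σ (lab l a \ J) G W B X).card ≤ n := by
  have hp := hS.poor_sym X hX
  set F := lab l a \ J with hF
  set Poor := univ.filter fun u => 8 * N * (X.filter fun b => Λ.col b u ∈ F).card < k with hPoor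
  have hinj : Set.InjOn (fun b => Λ.sym (σ b) b) (unusable L Λ σ F G W B X) := by
    intro b hb b' hb' hbb
    have h1 := hM.val (hG (mem_diag.2 ⟨(mem_filter.1 hb).1, rfl⟩ : (σ b, b) ∈ _))
      (hG (mem_diag.2 ⟨(mem_filter.1 hb').1, rfl⟩ : (σ b', b') ∈ _)) hbb
    exact congrArg Prod.snd h1
  have hsub : (unusable L Λ σ F G W B X).image (fun b => Λ.sym (σ b) b) ⊆
      Poor ∪ Finset.image₂ Λ.sym X (W ∪ B.image ⇑σ⁻¹) := by
    intro u hu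
    obtain ⟨b, hb, rfl⟩ := mem_image.1 hu
    have hb2 := (mem_filter.1 hb).2
    rw [mem_union]
    by_contra hcon
    push Not at hcon
    obtain ⟨h1, h2⟩ := hcon
    have h3 : k ≤ 8 * N * (X.filter fun x => Λ.col x (Λ.sym (σ b) b) ∈ F).card := by
      by_contra h4
      exact h1 (mem_filter.2 ⟨mem_univ _, not_le.1 h4⟩)
    have h4 : (X.filter fun x => Λ.col x (Λ.sym (σ b) b) ∈ F) ⊆
        X.filter fun x => Λ.col x (Λ.sym (σ b) b) ∈ F \ W ∧ σ (Λ.col x (Λ.sym (σ b) b)) ∉ B := by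
      intro x hx
      obtain ⟨hx1, hx2⟩ := mem_filter.1 hx
      have key : Λ.col x (Λ.sym (σ b) b) ∉ W ∪ B.image ⇑σ⁻¹ := by
        intro h5
        exact h2 (mem_image₂.2 ⟨x, hx1, _, h5, Λ.sym_col _ _⟩)
      rw [mem_union, not_or] at key
      refine mem_filter.2 ⟨hx1, mem_sdiff.2 ⟨hx2, key.1⟩, fun h5 => key.2 ?_⟩
      exact mem_image.2 ⟨_, h5, by simp⟩
    have h5 := (card_le_card h4).trans hb2
    have h6 := h3.trans (Nat.mul_le_mul_left _ h5)
    rw [h.N_eq, h.k_eq] at h6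
    have := h.L_pos
    omega
  have hc := card_le_card hsub
  rw [card_image_of_injOn hinj] at hc
  have hc2 := hc.trans (card_union_le _ _)
  have hc3 : (Finset.image₂ Λ.sym X (W ∪ B.image ⇑σ⁻¹)).card ≤ k * (W.card + B.card) := by
    refine (card_image₂_le _ _ _).trans ?_
    rw [hX]
    exact Nat.mul_le_mul_left _ ((card_union_le _ _).trans
      (Nat.add_le_add_left card_image_le _))
  obtain ⟨Q, hQ⟩ : ∃ Q, 2 ^ (50 * L) = Q := ⟨_, rfl⟩
  have hQ2 : 2 ≤ Q := by
    rw [← hQ]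
    have := h.L_pos
    exact le_trans (by norm_num) (Nat.pow_le_pow_right (by norm_num) (by omega : 1 ≤ 50 * L))
  have hk := h.k_mul_two_pow_le
  rw [hQ] at hk ⊢
  have hP : 2 * (Q * Poor.card) ≤ n := by
    refine le_trans ?_ hp
    rw [show 100 * L = 50 * L + 50 * L by ring, pow_add, hQ, ← mul_assoc]
    exact Nat.mul_le_mul_right _ (Nat.mul_le_mul_right _ hQ2)
  have h1 := (Nat.mul_le_mul_right W.card hk).trans hW
  have h2 := (Nat.mul_le_mul_right B.card hk).trans hB
  have h3 := Nat.mul_le_mul_left Q (hc2.trans (Nat.add_le_add_left hc3 _))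
  rw [mul_add] at h3
  have h4 : 4 * (Q * (k * (W.card + B.card))) = 4 * k * Q * W.card + 4 * k * Q * B.card := by ring
  omega

theorem exists_ready {F G W S B X C : Finset (Fin n)} (hX : ∀ x ∈ X, x ∉ M.image Prod.fst)
    {b : Fin n} (hb : b ∈ G \ unusable L Λ σ F G W B X) (hS : S.card ≤ 4 * L)
    (hdiag : diag σ ((F \ W) \ S) ⊆ M) (hsym : Λ.sym (σ b) b ∉ M.image Λ.val) (hC : C.card = k)
    (hCM : Disjoint C (M.image Λ.val)) (hCb : Λ.sym (σ b) b ∉ C)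
    (hB : ∀ z ∉ B, Fertile L k Λ σ F W C z) :
    ∃ x ∈ X, Ready L k Λ σ F W S M x (Λ.sym (σ b) b) C := by
  obtain ⟨hbG, hb'⟩ := mem_sdiff.1 hb
  have h1 : 4 * L < (X.filter fun x => Λ.col x (Λ.sym (σ b) b) ∈ F \ W ∧
      σ (Λ.col x (Λ.sym (σ b) b)) ∉ B).card := by
    by_contra hcon
    exact hb' (mem_filter.2 ⟨hbG, not_lt.1 hcon⟩)
  obtain ⟨x, hx, hxS⟩ : ∃ x ∈ X.filter fun x => Λ.col x (Λ.sym (σ b) b) ∈ F \ W ∧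
      σ (Λ.col x (Λ.sym (σ b) b)) ∉ B, Λ.col x (Λ.sym (σ b) b) ∉ S := by
    by_contra hcon
    push Not at hcon
    have := card_le_card_of_injOn _ hcon fun x _ x' _ hxx => Λ.col_inj_left hxx
    omega
  obtain ⟨hx1, hx2, hx3⟩ := mem_filter.1 hx
  exact ⟨x, hx1, hdiag, hS, hX x hx1, hsym, hC, hCM, hCb, mem_sdiff.2 ⟨hx2, hxS⟩, hB _ hx3⟩

end Next

section Loop

variable {n N L k : ℕ}

/-- The columns of `F` allow edits to be started from almost every row, whatever short list of
columns is forbidden. -/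
structure Tame (L k : ℕ) (Λ : LatinSquare n) (σ : Equiv.Perm (Fin n)) (F : Finset (Fin n)) :
    Prop where
  barren : ∀ C W : Finset (Fin n), C.card = k → 2 ^ (100 * L) * W.card ≤ n →
    ∃ B : Finset (Fin n), 2 ^ (60 * L) * B.card ≤ n ∧ ∀ z ∉ B, Fertile L k Λ σ F W C z
  unusable : ∀ M : Finset (Fin n × Fin n), Rainbow Λ M → ∀ G W B X : Finset (Fin n),
    diag σ G ⊆ M → X.card = k → 2 ^ (60 * L) * W.card ≤ n → 2 ^ (60 * L) * B.card ≤ n →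
    2 ^ (50 * L) * (unusable L Λ σ F G W B X).card ≤ n

theorem Side.tame (h : Large n N L k) {Λ : LatinSquare n} {σ : Equiv.Perm (Fin n)}
    {l : Fin n → Fin N} {a : ℕ} {J : Finset (Fin n)} (hS : Side N L k Λ σ l a J) :
    Tame L k Λ σ (lab l a \ J) :=
  ⟨fun _ _ hC hW => hS.exists_barren h hC hW,
    fun _ hM _ _ _ _ hG hX hW hB => hS.card_unusable_le h hM hG hX hW hB⟩

/-- Two families of columns and rows from which edits of either side can start. -/
structure Duo (L k : ℕ) (Λ : LatinSquare n) (σ : Equiv.Perm (Fin n))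
    (F F' P P' : Finset (Fin n)) : Prop where
  tame_row : Tame L k Λ σ F
  tame_col : Tame L k Λ.transpose σ⁻¹ F'
  sub_row : F ⊆ P
  sub_col : F' ⊆ P'
  image : P' = P.image σ
  notMem : ∀ b ∈ F, σ b ∉ F'
  card_lt : 32 * P.card < n

/-- A rainbow matching which is ready for an augmentation. -/
structure State (L k : ℕ) (Λ : LatinSquare n) (σ : Equiv.Perm (Fin n))
    (F W V F' W' V' : Finset (Fin n)) (M : Finset (Fin n × Fin n)) : Prop where
  rainbow : Rainbow Λ M
  ready : ∃ x c C y c' C', Ready L k Λ σ F W V M x c C ∧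
    Ready L k Λ.transpose σ⁻¹ F' W' V' (M.image Prod.swap) y c' C' ∧
    Disjoint (insert c C) (insert c' C')

theorem exists_palettes {U : Finset (Fin n)} (hU : 4 * k + 1 ≤ U.card) :
    ∃ E E' D D' : Finset (Fin n), ∃ m, E.card = k ∧ E'.card = k ∧ D.card = k ∧ D'.card = k ∧
      E ⊆ U ∧ E' ⊆ U \ E ∧ D ⊆ U \ (E ∪ E') ∧ D' ⊆ U \ (E ∪ E' ∪ D) ∧ m ∈ U \ (E ∪ E' ∪ D ∪ D') := by
  obtain ⟨E, hE, hEk⟩ := exists_subset_card_eq (show k ≤ U.card by omega)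
  have h1 : k ≤ (U \ E).card := by
    have := le_card_sdiff E U
    omega
  obtain ⟨E', hE', hEk'⟩ := exists_subset_card_eq h1
  have h2 : k ≤ (U \ (E ∪ E')).card := by
    have := le_card_sdiff (E ∪ E') U
    have := card_union_le E E'
    omega
  obtain ⟨D, hD, hDk⟩ := exists_subset_card_eq h2
  have h3 : k ≤ (U \ (E ∪ E' ∪ D)).card := by
    have := le_card_sdiff (E ∪ E' ∪ D) U
    have := card_union_le E E'
    have := card_union_le (E ∪ E') D
    omega
  obtain ⟨D', hD', hDk'⟩ := exists_subset_card_eq h3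
  have h4 : 0 < (U \ (E ∪ E' ∪ D ∪ D')).card := by
    have := le_card_sdiff (E ∪ E' ∪ D ∪ D') U
    have := card_union_le E E'
    have := card_union_le (E ∪ E') D
    have := card_union_le (E ∪ E' ∪ D) D'
    omega
  obtain ⟨m, hm⟩ := card_pos.1 h4
  exact ⟨E, E', D, D', m, hEk, hEk', hDk, hDk', hE, hE', hD, hD', hm⟩

variable {Λ : LatinSquare n} {σ : Equiv.Perm (Fin n)} {F W V F' W' V' P P' : Finset (Fin n)}
  {M : Finset (Fin n × Fin n)}

theorem sdiff_sdiff_comm_union (F W V S : Finset (Fin n)) :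
    (F \ (W ∪ V)) \ S = ((F \ W) \ V) \ S := by
  ext v
  simp only [mem_sdiff, mem_union]
  tauto

theorem State.step (h : Large n N L k) (hF : Duo L k Λ σ F F' P P')
    (hs : State L k Λ σ F W V F' W' V' M) (hd : 7 * k ≤ n - M.card) (hd' : 32 * (n - M.card) ≤ n)
    (hW : 2 ^ (100 * L) * (W ∪ V).card ≤ n) (hW' : 2 ^ (100 * L) * (W' ∪ V').card ≤ n) :
    ∃ M' S S', M'.card = M.card + 1 ∧ S.card ≤ 4 * L ∧ S'.card ≤ 4 * L ∧
      State L k Λ σ F (W ∪ V) S F' (W' ∪ V') S' M' := by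
  obtain ⟨hM, x, c, C, y, c', C', hr, hr', hdis⟩ := hs
  have hk : 3 ≤ k := by
    have h1 := h.L_ge
    have h2 := h.L_le_k
    have : 3 ≤ L := le_trans (by norm_num) h1
    omega
  have hfree : (univ \ M.image Λ.val).card = n - M.card := by
    rw [card_sdiff_of_subset (subset_univ _), hM.card_image_val, card_univ, Fintype.card_fin]
  obtain ⟨U, hU⟩ : ∃ U, (univ \ M.image Λ.val) \ (insert c C ∪ insert c' C') = U := ⟨_, rfl⟩
  have hUc : 4 * k + 1 ≤ U.card := by
    have h1 := le_card_sdiff (insert c C ∪ insert c' C') (univ \ M.image Λ.val)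
    have h2 := card_union_le (insert c C) (insert c' C')
    have h3 := card_insert_le c C
    have h4 := card_insert_le c' C'
    have h5 := hr.card_palette
    have h6 := hr'.card_palette
    rw [hU] at h1
    omega
  obtain ⟨E, E', D, D', m, hE, hE', hD, hD', sE, sE', sD, sD', sm⟩ := exists_palettes hUc
  have hUmem : ∀ u ∈ U, u ∉ M.image Λ.val ∧ u ∉ insert c C ∧ u ∉ insert c' C' := by
    intro u hu
    rw [← hU] at hu
    simp only [mem_sdiff, mem_univ, true_and, mem_union, not_or] at hu
    exact ⟨hu.1, hu.2.1, hu.2.2⟩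
  have hEU : ∀ u ∈ E, u ∈ U := fun u hu => sE hu
  have hEU' : ∀ u ∈ E', u ∈ U ∧ u ∉ E := fun u hu => mem_sdiff.1 (sE' hu)
  have hDU : ∀ u ∈ D, u ∈ U ∧ u ∉ E ∧ u ∉ E' := by
    intro u hu
    simpa only [mem_sdiff, mem_union, not_or] using sD hu
  have hDU' : ∀ u ∈ D', u ∈ U ∧ (u ∉ E ∧ u ∉ E') ∧ u ∉ D := by
    intro u hu
    simpa only [mem_sdiff, mem_union, not_or] using sD' hu
  have hmU : m ∈ U ∧ ((m ∉ E ∧ m ∉ E') ∧ m ∉ D) ∧ m ∉ D' := by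
    simpa only [mem_sdiff, mem_union, not_or] using sm
  obtain ⟨B, hB, hBf⟩ := hF.tame_row.barren D (W ∪ V) hD hW
  obtain ⟨B', hB', hBf'⟩ := hF.tame_col.barren D' (W' ∪ V') hD' hW'
  have hrows : k ≤ ((univ \ M.image Prod.fst).erase x).card := by
    have h1 := pred_card_le_card_erase (s := univ \ M.image Prod.fst) (a := x)
    rw [card_sdiff_of_subset (subset_univ _), card_image_of_injOn hM.fst, card_univ,
      Fintype.card_fin] at h1
    omega
  have hcols : k ≤ ((univ \ M.image Prod.snd).erase y).card := by
    have h1 := pred_card_le_card_erase (s := univ \ M.image Prod.snd) (a := y)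
    rw [card_sdiff_of_subset (subset_univ _), card_image_of_injOn hM.snd, card_univ,
      Fintype.card_fin] at h1
    omega
  obtain ⟨X, hX, hXk⟩ := exists_subset_card_eq hrows
  obtain ⟨Y, hY, hYk⟩ := exists_subset_card_eq hcols
  have hpow : 2 ^ (60 * L) ≤ 2 ^ (100 * L) := Nat.pow_le_pow_right (by norm_num) (by omega)
  have hRem := hF.tame_row.unusable M hM ((F \ W) \ V) (W ∪ V) B X hr.diag_sub hXk
    ((Nat.mul_le_mul_right _ hpow).trans hW) hB
  have hRem' := hF.tame_col.unusable _ hM.swap ((F' \ W') \ V') (W' ∪ V') B' Y hr'.diag_sub hYk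
    ((Nat.mul_le_mul_right _ hpow).trans hW') hB'
  have hcC : ∀ u, u ∈ insert c C → u ∉ insert c' C' := fun u hu => disjoint_left.1 hdis hu
  have hcard := hF.card_lt
  obtain ⟨M', S, S', ha⟩ := hr.exists_augmented h hr' hM hF.sub_row hF.sub_col hF.image hF.notMem
    (E := E) (E' := E') (m := m) (by omega) hE
    (disjoint_left.2 fun u hu => (hUmem u (hEU u hu)).1)
    (fun hc => (hUmem c (hEU c hc)).2.1 (mem_insert_self _ _))
    (disjoint_right.2 fun u hu hC => (hUmem u (hEU u hu)).2.1 (mem_insert_of_mem hC)) hE'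
    (disjoint_left.2 fun u hu => (hUmem u (hEU' u hu).1).1)
    (fun hc => (hUmem c' (hEU' c' hc).1).2.2 (mem_insert_self _ _))
    (disjoint_right.2 fun u hu hC => (hUmem u (hEU' u hu).1).2.2 (mem_insert_of_mem hC))
    (by
      rw [disjoint_left]
      intro u hu hu'
      rcases mem_union.1 hu with hu | hu <;> rcases mem_union.1 hu' with hu' | hu'
      · exact hcC u hu hu'
      · exact (hUmem u (hEU' u hu').1).2.1 hu
      · exact (hUmem u (hEU u hu)).2.2 hu'
      · exact (hEU' u hu').2 hu)
    (hUmem m hmU.1).1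
    (by rw [mem_union, not_or]; exact ⟨(hUmem m hmU.1).2.1, hmU.2.1.1.1⟩)
    (by rw [mem_union, not_or]; exact ⟨(hUmem m hmU.1).2.2, hmU.2.1.1.2⟩) hRem hRem'
  have hnew : ∀ u ∈ U, u ∉ E → u ∉ E' → u ≠ m → u ∉ M'.image Λ.val := by
    intro u hu h1 h2 h3 hcon
    have := ha.val_sub hcon
    simp only [mem_union, mem_insert (a := u) (b := m)] at this
    have h4 := hUmem u hu
    tauto
  have hDM : ∀ u ∈ D, u ∉ M'.image Λ.val := fun u hu =>
    hnew u (hDU u hu).1 (hDU u hu).2.1 (hDU u hu).2.2 (fun hum => hmU.2.1.2 (hum ▸ hu))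
  have hDM' : ∀ u ∈ D', u ∉ M'.image Λ.val := fun u hu =>
    hnew u (hDU' u hu).1 (hDU' u hu).2.1.1 (hDU' u hu).2.1.2 (fun hum => hmU.2.2 (hum ▸ hu))
  obtain ⟨b, hb, hbM⟩ := ha.released_row
  obtain ⟨b', hb', hbM'⟩ := ha.released_col
  have hbG := (mem_sdiff.1 hb).1
  have hbG' := (mem_sdiff.1 hb').1
  have hcell : (σ b, b) ∈ M := hr.diag_sub (mem_diag.2 ⟨hbG, rfl⟩)
  have hcell' : (b', σ⁻¹ b') ∈ M := by
    have := hr'.diag_sub (mem_diag.2 ⟨hbG', rfl⟩ : (σ⁻¹ b', b') ∈ _)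
    rwa [mem_image_swap] at this
  have hval : Λ.sym (σ b) b ∈ M.image Λ.val := mem_image_of_mem Λ.val hcell
  have hval' : Λ.transpose.sym (σ⁻¹ b') b' ∈ M.image Λ.val := mem_image_of_mem Λ.val hcell'
  obtain ⟨x₁, -, hx₁⟩ := exists_ready (M := M') (W := W ∪ V) (C := D) (k := k)
    (fun z hz => by
      have h1 := mem_erase.1 (hX hz)
      rw [ha.fst, mem_insert, not_or]
      exact ⟨h1.1, (mem_sdiff.1 h1.2).2⟩) hb ha.card_row
    (by rw [sdiff_sdiff_comm_union]; exact ha.diag_row) hbM hD (disjoint_left.2 hDM)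
    (fun hh => (hUmem _ (hDU _ hh).1).1 hval) hBf
  obtain ⟨y₁, -, hy₁⟩ := exists_ready (M := M'.image Prod.swap) (W := W' ∪ V') (C := D') (k := k)
    (fun z hz => by
      have h1 := mem_erase.1 (hY hz)
      rw [image_fst_swap, ha.snd, mem_insert, not_or]
      exact ⟨h1.1, (mem_sdiff.1 h1.2).2⟩) hb' ha.card_col
    (by rw [sdiff_sdiff_comm_union]; exact ha.diag_col) (by rwa [image_val_swap]) hD'
    (by rw [image_val_swap]; exact disjoint_left.2 hDM')
    (fun hh => (hUmem _ (hDU' _ hh).1).1 hval') hBf'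
  refine ⟨M', S, S', ha.card, ha.card_row, ha.card_col, ha.rainbow, x₁, _, D, y₁, _, D', hx₁, hy₁, ?_⟩
  rw [disjoint_left]
  intro u hu hu'
  rcases mem_insert.1 hu with rfl | hu <;> rcases mem_insert.1 hu' with he | hu'
  · have h1 := hM.val hcell hcell' he
    have h2 : σ b = b' := congrArg Prod.fst h1
    refine hF.notMem b (mem_sdiff.1 (mem_sdiff.1 hbG).1).1 ?_
    rw [h2]
    exact (mem_sdiff.1 (mem_sdiff.1 hbG').1).1
  · exact (hUmem _ (hDU' _ hu').1).1 hval
  · rw [he] at hu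
    exact (hUmem _ (hDU _ hu).1).1 hval'
  · exact (hDU' u hu').2.2 hu

theorem State.exists_large (h : Large n N L k) (hF : Duo L k Λ σ F F' P P') {m : ℕ}
    (hm : 2 ^ (100 * L) * m ≤ n) (d : ℕ) : ∀ {W V W' V' : Finset (Fin n)}
    {M : Finset (Fin n × Fin n)}, State L k Λ σ F W V F' W' V' M → V.card ≤ 4 * L → V'.card ≤ 4 * L →
      n - M.card = d → W.card + 4 * L * d ≤ m → W'.card + 4 * L * d ≤ m →
      ∃ M₁, Rainbow Λ M₁ ∧ n < M₁.card + 7 * k := by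
  induction d with
  | zero =>
    intro W V W' V' M hs _ _ hd _ _
    have := h.k_pos
    exact ⟨M, hs.rainbow, by omega⟩
  | succ d ih =>
    intro W V W' V' M hs hV hV' hd hW hW'
    by_cases hk : 7 * k ≤ n - M.card
    · have h1 := card_union_le W V
      have h2 := card_union_le W' V'
      rw [Nat.mul_succ] at hW hW'
      have h3 : d + 1 ≤ m := by
        have h4 : 1 * d ≤ 4 * L * d := Nat.mul_le_mul_right d (by have := h.L_pos; omega)
        have := h.L_pos
        omega
      have h5 : 32 * (n - M.card) ≤ n := by
        rw [hd]
        refine le_trans (Nat.mul_le_mul ?_ h3) hm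
        have := h.L_pos
        calc 32 = 2 ^ 5 := by norm_num
          _ ≤ 2 ^ (100 * L) := Nat.pow_le_pow_right (by norm_num) (by omega)
      obtain ⟨M', S, S', hc, hS, hS', hs'⟩ := hs.step h hF hk h5
        ((Nat.mul_le_mul_left _ (by omega)).trans hm) ((Nat.mul_le_mul_left _ (by omega)).trans hm)
      exact ih hs' hS hS' (by omega) (by omega) (by omega)
    · exact ⟨M, hs.rainbow, by omega⟩

end Loop

section Start

variable {n N L k : ℕ}

theorem Tame.exists_start (h : Large n N L k) {Λ : LatinSquare n} {σ : Equiv.Perm (Fin n)}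
    {F : Finset (Fin n)} (ht : Tame L k Λ σ F) (hF : n ≤ 8 * N * F.card) {C : Finset (Fin n)}
    (hC : C.card = k) {E D : Finset (Fin n)} (hED : E.card + D.card < n) :
    ∃ y ∈ F, ∃ c ∉ E, Λ.row y c ∉ D ∧ Fertile L k Λ σ F ∅ C (σ y) := by
  obtain ⟨B, hB, hBf⟩ := ht.barren C ∅ hC (by simp)
  have hn := h.n_pos
  have hBF : B.card < F.card := by
    by_contra hcon
    push Not at hcon
    have h1 : 16 * N ≤ 2 ^ (60 * L) := by
      rw [h.N_eq]
      have := h.L_pos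
      exact le_trans (by norm_num : 16 * 2 ^ 20 ≤ 2 ^ 60) (Nat.pow_le_pow_right (by norm_num) (by omega))
    have h2 := (Nat.mul_le_mul h1 hcon).trans hB
    have h3 : 16 * N * F.card = 2 * (8 * N * F.card) := by ring
    omega
  obtain ⟨y, hy, hyB⟩ : ∃ y ∈ F, σ y ∉ B := by
    by_contra hcon
    push Not at hcon
    have := card_le_card_of_injOn σ hcon σ.injective.injOn
    omega
  obtain ⟨c, -, hc⟩ : ∃ c ∈ (univ : Finset (Fin n)),
      c ∉ E ∪ univ.filter fun c => Λ.row y c ∈ D := by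
    refine exists_mem_notMem_of_card_lt_card ?_
    have h1 : (univ.filter fun c => Λ.row y c ∈ D).card ≤ D.card :=
      card_le_card_of_injOn (Λ.row y) (fun c hc => (mem_filter.1 hc).2)
        fun c _ c' _ hcc => Λ.row_inj_right hcc
    have h2 := card_union_le E (univ.filter fun c => Λ.row y c ∈ D)
    rw [card_univ, Fintype.card_fin]
    omega
  rw [mem_union, not_or] at hc
  exact ⟨y, hy, c, hc.1, fun hh => hc.2 (mem_filter.2 ⟨mem_univ _, hh⟩), hBf _ hyB⟩

theorem marked_flip (ω : Sample n N) : marked (flip ω).2 = (marked ω.2).image ω.1 := by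
  ext x
  rw [mem_marked, mem_image]
  constructor
  · intro hx
    exact ⟨ω.1⁻¹ x, mem_marked.2 hx, by simp⟩
  · rintro ⟨y, hy, rfl⟩
    rw [mem_marked] at hy
    simpa [flip] using hy

theorem card_lab_sdiff {Λ : LatinSquare n} {ω : Sample n N}
    (hfair : FairLabels ω.2) (hf : FewConflicts Λ ω) {J : Finset (Fin n)} (hJ : IsConflict Λ ω J)
    {a : ℕ} (ha : a < 3) : n ≤ 8 * N * (lab ω.2 a \ J).card := by
  have h1 := (hfair a ha).2
  have h2 := hf J hJ a ha
  have h3 := card_sdiff_add_card_inter (lab ω.2 a) J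
  rw [inter_comm] at h3
  rw [← h3] at h1
  generalize (lab ω.2 a \ J).card = u at *
  generalize (J ∩ lab ω.2 a).card = v at *
  have h4 : 192 * N * v = 192 * (N * v) := by ring
  have h5 : 8 * N * u = 8 * (N * u) := by ring
  have h6 : 4 * N * (u + v) = 4 * (N * u) + 4 * (N * v) := by ring
  omega

theorem exists_rainbow (h : Large n N L k) (Λ : LatinSquare n) :
    ∃ M, Rainbow Λ M ∧ n < M.card + 7 * k := by
  obtain ⟨ω, hfair, hbal, hbal', hf, hr, hside⟩ := exists_typical h Λ
  have hn := h.n_pos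
  obtain ⟨J, hJ⟩ : ∃ J, repeats Λ ω = J := ⟨_, rfl⟩
  have hconf : IsConflict Λ ω J := hJ ▸ isConflict_repeats Λ ω
  obtain ⟨M₁, hM₁, hsnd, hfst, hdiag⟩ := exists_diagonal_matching hn hfair hf hr
  rw [hJ] at hdiag
  obtain ⟨hS, hS'⟩ := hside J hconf
  set σ := ω.1 with hσ
  obtain ⟨F, hF⟩ : ∃ F, lab ω.2 0 \ J = F := ⟨_, rfl⟩
  obtain ⟨F', hF'⟩ : ∃ F', lab (flip ω).2 1 \ J.image σ = F' := ⟨_, rfl⟩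
  have hmemF' : ∀ r, r ∈ F' ↔ σ⁻¹ r ∈ lab ω.2 1 \ J := by
    intro r
    rw [← hF', mem_sdiff, mem_sdiff, mem_lab_flip]
    refine and_congr Iff.rfl (not_congr ?_)
    rw [mem_image]
    constructor
    · rintro ⟨y, hy, rfl⟩
      simpa using hy
    · intro hr
      exact ⟨_, hr, by simp⟩
  have hP := hfair.card_marked
  have hPc : 32 * (marked ω.2).card * 2 ^ 10 ≤ n := by
    generalize (marked ω.2).card = p at *
    rw [h.N_eq] at hP
    omega
  have hduo : Duo L k Λ σ F F' (marked ω.2) (marked (flip ω).2) := by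
    refine ⟨hF ▸ hS.tame h, hF' ▸ hS'.tame h, ?_, ?_, marked_flip ω, ?_, by omega⟩
    · rw [← hF]
      exact sdiff_subset.trans (lab_subset_marked _ (by norm_num))
    · rw [← hF']
      exact sdiff_subset.trans (lab_subset_marked _ (by norm_num))
    · intro b hb hb'
      rw [hmemF', mem_sdiff, mem_lab] at hb'
      rw [← hF, mem_sdiff, mem_lab] at hb
      have h1 := hb'.1
      rw [show σ⁻¹ (σ b) = b by simp, hb.1] at h1
      omega
  have hFc : n ≤ 8 * N * F.card := hF ▸ card_lab_sdiff hfair hf hconf (by norm_num)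
  have hFc' : n ≤ 8 * N * F'.card := by
    refine (card_lab_sdiff hfair hf hconf (a := 1) (by norm_num)).trans (Nat.mul_le_mul_left _ ?_)
    refine card_le_card_of_injOn σ (fun y hy => ?_) σ.injective.injOn
    rw [mem_coe, hmemF']
    simpa using hy
  have hM₁c : M₁.card = (marked ω.2).card := by rw [← hsnd, card_image_of_injOn hM₁.snd]
  have hPc' : (marked (flip ω).2).card = (marked ω.2).card := by
    rw [marked_flip, card_image_of_injective _ ω.1.injective]
  have hkn : 32 * k ≤ n := by
    have h1 := h.L_pow_le_n (j := 3) (by norm_num)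
    have h2 := h.k_le_sq
    have h3 : 32 ≤ L := le_trans (by norm_num) h.L_ge
    calc 32 * k ≤ L * L ^ 2 := Nat.mul_le_mul h3 h2
      _ = L ^ 3 := by ring
      _ ≤ n := h1
  have hk1 := h.k_pos
  have hfree : 4 * k + 1 ≤ (univ \ M₁.image Λ.val).card := by
    rw [card_sdiff_of_subset (subset_univ _), hM₁.card_image_val, card_univ, Fintype.card_fin]
    omega
  obtain ⟨C, C', -, -, -, hC, hC', -, -, sC, sC', -⟩ := exists_palettes hfree
  have hCM : Disjoint C (M₁.image Λ.val) :=
    disjoint_left.2 fun u hu => (mem_sdiff.1 (sC hu)).2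
  have hCM' : Disjoint C' (M₁.image Λ.val) :=
    disjoint_left.2 fun u hu => (mem_sdiff.1 (mem_sdiff.1 (sC' hu)).1).2
  have hCC' : ∀ u ∈ C', u ∉ C := fun u hu => (mem_sdiff.1 (sC' hu)).2
  have hEc : (M₁.image Λ.val ∪ (C ∪ C')).card ≤ M₁.card + 2 * k := by
    have h1 := card_union_le (M₁.image Λ.val) (C ∪ C')
    have h2 := card_union_le C C'
    rw [hM₁.card_image_val] at h1
    omega
  obtain ⟨y₀, hy₀, c, hc, hx, hfert⟩ := hduo.tame_row.exists_start h hFc hC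
    (E := M₁.image Λ.val ∪ (C ∪ C')) (D := marked (flip ω).2) (by omega)
  obtain ⟨r₀, hr₀, c', hc', hy, hfert'⟩ := hduo.tame_col.exists_start h hFc' hC'
    (E := insert c (M₁.image Λ.val ∪ (C ∪ C'))) (D := marked ω.2)
    (by have := card_insert_le c (M₁.image Λ.val ∪ (C ∪ C')); omega)
  obtain ⟨x, hxe⟩ : ∃ x, Λ.row y₀ c = x := ⟨_, rfl⟩
  obtain ⟨y, hye⟩ : ∃ y, Λ.transpose.row r₀ c' = y := ⟨_, rfl⟩
  have hxc : Λ.col x c = y₀ := by rw [← hxe, Λ.col_row]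
  have hyc : Λ.transpose.col y c' = r₀ := by rw [← hye, Λ.transpose.col_row]
  rw [hxe] at hx
  rw [hye] at hy
  simp only [mem_union, mem_insert, not_or] at hc hc'
  have hQM : ∀ u ∈ insert c C ∪ insert c' C', u ∉ M₁.image Λ.val := by
    intro u hu
    rcases mem_union.1 hu with hu | hu <;> rcases mem_insert.1 hu with rfl | hu
    · exact hc.1
    · exact disjoint_left.1 hCM hu
    · exact hc'.2.1
    · exact disjoint_left.1 hCM' hu
  have hQc : (insert c C ∪ insert c' C').card ≤ 2 * k + 2 := by
    have h1 := card_union_le (insert c C) (insert c' C')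
    have h2 := card_insert_le c C
    have h3 := card_insert_le c' C'
    omega
  obtain ⟨M, hsub, hM, hxM, hyM, hQ, hdef⟩ := exists_near_matching h hbal hbal' hM₁ hsnd
    (hfst.trans (marked_flip ω).symm) (x := x) (y := y)
    (by rw [hfst, ← marked_flip]; exact hx) (by rw [hsnd]; exact hy) hQc (disjoint_left.2 hQM)
  have hQ' : ∀ u ∈ insert c C ∪ insert c' C', u ∉ M.image Λ.val := fun u hu => disjoint_left.1 hQ hu
  have hstate : State L k Λ σ F ∅ ∅ F' ∅ ∅ M := by
    refine ⟨hM, x, c, C, y, c', C', ⟨?_, by simp, hxM, ?_, hC, ?_, hc.2.1, ?_, ?_⟩,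
      ⟨?_, by simp, ?_, ?_, hC', ?_, hc'.2.2.2, ?_, ?_⟩, ?_⟩
    · intro e he
      obtain ⟨h1, h2⟩ := mem_diag.1 he
      rw [sdiff_empty, sdiff_empty, ← hF] at h1
      have h3 := hdiag e.2 (mem_sdiff.2 ⟨mem_union_left _ (mem_sdiff.1 h1).1, (mem_sdiff.1 h1).2⟩)
      rw [← h2] at h3
      exact hsub h3
    · exact hQ' c (by simp)
    · exact disjoint_left.2 fun u hu => hQ' u (mem_union_left _ (mem_insert_of_mem hu))
    · rw [hxc, sdiff_empty, sdiff_empty]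
      exact hy₀
    · rw [hxc]
      exact hfert
    · intro e he
      obtain ⟨h1, h2⟩ := mem_diag.1 he
      rw [sdiff_empty, sdiff_empty, hmemF', ← h2] at h1
      have h3 := hdiag e.1 (mem_sdiff.2 ⟨mem_union_right _ (mem_sdiff.1 h1).1, (mem_sdiff.1 h1).2⟩)
      rw [mem_image_swap]
      refine hsub ?_
      have h4 : ω.1 e.1 = e.2 := by rw [h2]; simp [hσ]
      rwa [h4] at h3
    · rw [image_fst_swap]
      exact hyM
    · rw [image_val_swap]
      exact hQ' c' (by simp)
    · rw [image_val_swap]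
      exact disjoint_left.2 fun u hu => hQ' u (mem_union_right _ (mem_insert_of_mem hu))
    · rw [hyc, sdiff_empty, sdiff_empty]
      exact hr₀
    · rw [hyc]
      exact hfert'
    · rw [disjoint_left]
      intro u hu hu'
      rcases mem_insert.1 hu with rfl | hu <;> rcases mem_insert.1 hu' with he | hu'
      · exact hc'.1 he.symm
      · exact hc.2.2 hu'
      · rw [he] at hu
        exact hc'.2.2.1 hu
      · exact hCC' u hu' hu
  have hm : 2 ^ (100 * L) * (4 * L * (n - M.card)) ≤ n := by
    refine le_trans ?_ hdef
    rw [← mul_assoc]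
    refine Nat.mul_le_mul_right _ ?_
    have h1 : 4 * L ≤ 2 ^ (10 * L) := by
      have h2 : L < 2 ^ L := Nat.lt_two_pow_self
      have h3 := h.L_pos
      calc 4 * L ≤ 2 ^ 2 * 2 ^ L := by omega
        _ = 2 ^ (2 + L) := by rw [pow_add]
        _ ≤ 2 ^ (10 * L) := Nat.pow_le_pow_right (by norm_num) (by omega)
    calc 2 ^ (100 * L) * (4 * L) ≤ 2 ^ (100 * L) * 2 ^ (10 * L) := Nat.mul_le_mul_left _ h1
      _ = 2 ^ (110 * L) := by rw [← pow_add]; congr 1; ring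
  exact hstate.exists_large h hduo hm (n - M.card) (by simp) (by simp) rfl (by simp) (by simp)

end Start

section Conclusion

variable {n : ℕ}

/-- The Latin square given by a proper colouring of the complete bipartite graph. -/
noncomputable def LatinSquare.ofColoring (c : Fin n × Fin n → Fin n)
    (hrow : ∀ i j j', c (i, j) = c (i, j') → j = j')
    (hcol : ∀ i i' j, c (i, j) = c (i', j) → i = i') : LatinSquare n where
  sym x y := c (x, y)
  col x := (Equiv.ofBijective (fun y => c (x, y))
    (Finite.injective_iff_bijective.1 fun _ _ h => hrow _ _ _ h)).symm
  row y := (Equiv.ofBijective (fun x => c (x, y))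
    (Finite.injective_iff_bijective.1 fun _ _ h => hcol _ _ _ h)).symm
  col_sym x y := Equiv.ofBijective_symm_apply_apply (fun y => c (x, y)) _ y
  sym_col x u := Equiv.ofBijective_apply_symm_apply (fun y => c (x, y)) _ u
  row_sym x y := Equiv.ofBijective_symm_apply_apply (fun x => c (x, y)) _ x
  sym_row y u := Equiv.ofBijective_apply_symm_apply (fun x => c (x, y)) _ u

theorem exists_large_parameters {T : ℕ} (hT : 2 ^ 6000 ≤ T) (hn : T ^ T < n) :
    ∃ m, T ≤ m ∧ m ^ m < n ∧ n ≤ (m + 1) ^ (m + 1) ∧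
      Large n (2 ^ 20) (m + 1) (2 ^ 64 * (m + 1)) := by
  have hT0 : 0 < T := lt_of_lt_of_le (Nat.pow_pos (by norm_num)) hT
  have hex : ∃ L, n ≤ L ^ L :=
    ⟨n, Nat.le_self_pow (Nat.ne_of_gt (lt_of_le_of_lt (Nat.zero_le _) hn)) n⟩
  have hTlt : T < Nat.find hex := by
    by_contra! hle
    refine absurd hn (not_lt.2 ?_)
    refine (Nat.find_spec hex).trans ?_
    exact (Nat.pow_le_pow_left hle _).trans (Nat.pow_le_pow_right hT0 hle)
  obtain ⟨m, hm⟩ := Nat.exists_eq_succ_of_ne_zero (Nat.ne_of_gt (lt_of_le_of_lt (Nat.zero_le _) hTlt))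
  have hspec := Nat.find_spec hex
  have hmin : m ^ m < n := not_le.1 (Nat.find_min hex (by rw [hm]; exact Nat.lt_succ_self m))
  rw [hm] at hspec hTlt
  have hTm : T ≤ m := Nat.lt_succ_iff.1 hTlt
  refine ⟨m, hTm, hmin, hspec, rfl, ?_, rfl, ?_, hspec⟩
  · exact (Nat.pow_le_pow_right (by norm_num) (by norm_num)).trans
      (hT.trans (hTm.trans (Nat.le_succ m)))
  · refine le_trans ?_ hmin.le
    calc 2 ^ (3000 * (m + 1)) ≤ 2 ^ (6000 * m) :=
          Nat.pow_le_pow_right (by norm_num) (by omega)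
      _ = (2 ^ 6000) ^ m := pow_mul _ _ _
      _ ≤ m ^ m := Nat.pow_le_pow_left (hT.trans hTm) m

theorem log_log_pos {x : ℝ} (hx : 3 ≤ x) : 0 < Real.log (Real.log x) := by
  refine Real.log_pos ?_
  rw [Real.lt_log_iff_exp_lt (by linarith)]
  exact Real.exp_one_lt_three.trans_le hx

theorem one_le_log_div_log_log {x : ℝ} (hx : 3 ≤ x) :
    1 ≤ Real.log x / Real.log (Real.log x) := by
  rw [one_le_div (log_log_pos hx)]
  exact Real.log_le_self (Real.log_nonneg (by linarith))

theorem le_log_div_log_log {m : ℕ} (hm : 3 ≤ m) (h₁ : m ^ m ≤ n) (h₂ : n ≤ (m + 1) ^ (m + 1)) :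
    (m : ℝ) / 4 ≤ Real.log n / Real.log (Real.log n) := by
  have hmR : (3 : ℝ) ≤ m := by exact_mod_cast hm
  have hlm : 0 < Real.log m := Real.log_pos (by linarith)
  have hn3 : 3 ≤ n := hm.trans ((Nat.le_self_pow (by omega) m).trans h₁)
  have hnR : (3 : ℝ) ≤ n := by exact_mod_cast hn3
  have hlog : (m : ℝ) * Real.log m ≤ Real.log n := by
    rw [← Real.log_pow]
    exact Real.log_le_log (by positivity) (by exact_mod_cast h₁)
  have hlogn : 0 < Real.log n := Real.log_pos (by linarith)
  have hlog' : Real.log n ≤ (m : ℝ) ^ 4 := by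
    have h3 : Real.log n ≤ ((m + 1 : ℕ) : ℝ) * Real.log ((m + 1 : ℕ) : ℝ) := by
      rw [← Real.log_pow]
      exact Real.log_le_log (by linarith) (by exact_mod_cast h₂)
    have h4 : Real.log ((m + 1 : ℕ) : ℝ) ≤ ((m + 1 : ℕ) : ℝ) := Real.log_le_self (Nat.cast_nonneg _)
    push_cast at h3 h4
    nlinarith [mul_le_mul_of_nonneg_left h4 (by linarith : (0 : ℝ) ≤ m + 1),
      mul_self_nonneg ((m : ℝ) - 2), mul_self_nonneg ((m : ℝ) ^ 2 - 2)]
  have hll : Real.log (Real.log n) ≤ 4 * Real.log m := by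
    have := Real.log_le_log hlogn hlog'
    rwa [Real.log_pow] at this
  rw [div_le_div_iff₀ (by norm_num) (log_log_pos hnR)]
  calc (m : ℝ) * Real.log (Real.log n) ≤ m * (4 * Real.log m) := by gcongr
    _ = m * Real.log m * 4 := by ring
    _ ≤ Real.log n * 4 := by gcongr

end Conclusion

end RainbowLatin

/-- Keevash–Pokrovskiy–Sudakov–Yepremyan: There is a constant `C > 0` such
that for all `n ≥ 3`, every proper edge-coloring of `K_{n,n}` with exactly `n` colors
contains a rainbow matching of size at least `n - C log n / log log n`. Edges of `K_{n,n}`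
are modeled as pairs `(i, j) ∈ Fin n × Fin n`. -/
theorem rainbow_matching_near_perfect :
    ∃ C > (0 : ℝ), ∀ n : ℕ, 3 ≤ n →
      ∀ c : Fin n × Fin n → Fin n,
        (∀ i j j', c (i, j) = c (i, j') → j = j') →
        (∀ i i' j, c (i, j) = c (i', j) → i = i') →
        Function.Surjective c →
        ∃ s : Finset (Fin n × Fin n),
          (n : ℝ) - C * Real.log n / Real.log (Real.log n) ≤ (s.card : ℝ) ∧
          (∀ e ∈ s, ∀ e' ∈ s, e ≠ e' → e.1 ≠ e'.1 ∧ e.2 ≠ e'.2) ∧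
          Set.InjOn c ↑s := by
  obtain ⟨T, hT⟩ : ∃ T : ℕ, 2 ^ 6000 ≤ T := ⟨_, le_rfl⟩
  have hT3 : 3 ≤ T := by
    refine le_trans ?_ hT
    calc 3 ≤ 2 ^ 2 := by norm_num
      _ ≤ 2 ^ 6000 := Nat.pow_le_pow_right (by norm_num) (by norm_num)
  have hTT : (0 : ℝ) ≤ (T : ℝ) ^ T := by positivity
  refine ⟨56 * 2 ^ 64 + (T : ℝ) ^ T, by positivity, fun n hn c hrow hcol _ => ?_⟩
  have hnR : (3 : ℝ) ≤ n := by exact_mod_cast hn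
  have hone := RainbowLatin.one_le_log_div_log_log hnR
  rcases le_or_gt n (T ^ T) with hsmall | hlarge
  · refine ⟨∅, ?_, by simp, by simp⟩
    have h : (n : ℝ) ≤ (T : ℝ) ^ T := by exact_mod_cast hsmall
    rw [mul_div_assoc, Finset.card_empty, Nat.cast_zero]
    nlinarith
  · obtain ⟨m, hTm, hmn, hnm, hL⟩ := RainbowLatin.exists_large_parameters hT hlarge
    obtain ⟨M, hM, hcard⟩ :=
      RainbowLatin.exists_rainbow hL (RainbowLatin.LatinSquare.ofColoring c hrow hcol)
    refine ⟨M, ?_, fun e he e' he' hne => ⟨fun h => hne (hM.fst he he' h),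
      fun h => hne (hM.snd he he' h)⟩, hM.val⟩
    have hratio := RainbowLatin.le_log_div_log_log (hT3.trans hTm) hmn.le hnm
    have hcardR : (n : ℝ) ≤ M.card + 7 * (2 ^ 64 * (m + 1)) := by exact_mod_cast hcard.le
    have hm : (3 : ℝ) ≤ m := by exact_mod_cast hT3.trans hTm
    rw [mul_div_assoc]
    nlinarith
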